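/- arXiv:2301.13608 — 3 statements merged into one kernel-verified Lean document; each statement's English description precedes it below -/
import Mathlib

section
/- Let f, g : ℝ → ℝ be continuously differentiable, with g odd, x·g(x) > 0 for all x ≠ 0, and let F(x) = ∫₀^x f(s) ds. Assume F is odd, F(0) = 0, F'(0) < 0, F has a unique positive zero at some a > 0, and F is strictly monotonically increasing and tends to +∞ on [a, ∞). Then the Liénard equation x'' + f(x)·x' + g(x) = 0 admits a nonconstant periodic solution; that is, there exist T > 0 and a nonconstant twice continuously differentiable function x : ℝ → ℝ with x(t + T) = x(t) for all t, satisfying x''(t) + f(x(t))·x'(t) + g(x(t)) = 0 for all t. -/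
section PartA
open Set Filter Topology

lemma last_ge {u : ℝ → ℝ} (hu : Continuous u) {p q η : ℝ} (hpq : p ≤ q) (hp : η ≤ u p)
    (hq : u q ≤ η) : ∃ s ∈ Icc p q, u s = η ∧ ∀ t ∈ Icc s q, u t ≤ η := by
  have hc : IsCompact (Icc p q ∩ {t | η ≤ u t}) :=
    isCompact_Icc.inter_right (isClosed_le continuous_const hu)
  obtain ⟨s, ⟨hs, hs'⟩, hgr⟩ := hc.exists_isGreatest ⟨p, ⟨le_rfl, hpq⟩, hp⟩
  obtain ⟨t, ht, hte⟩ := intermediate_value_Icc' hs.2 hu.continuousOn ⟨hq, hs'⟩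
  have hts : t = s := le_antisymm (hgr ⟨⟨hs.1.trans ht.1, ht.2⟩, hte.ge⟩) ht.1
  refine ⟨s, hs, hts ▸ hte, fun r hr => ?_⟩
  by_contra hcon
  push Not at hcon
  have h1 : r = s := le_antisymm (hgr ⟨⟨hs.1.trans hr.1, hr.2⟩, hcon.le⟩) hr.1
  subst h1
  rw [← hts, hte] at hcon
  exact lt_irrefl _ hcon

lemma first_ge {u : ℝ → ℝ} (hu : Continuous u) {p q η : ℝ} (hpq : p ≤ q) (hp : u p ≤ η)
    (hq : η ≤ u q) : ∃ s ∈ Icc p q, u s = η ∧ ∀ t ∈ Icc p s, u t ≤ η := by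
  obtain ⟨s, hs, h1, h2⟩ := last_ge (u := fun t => u (-t)) (hu.comp continuous_neg)
    (p := -q) (q := -p) (η := η) (by linarith) (by simpa using hq) (by simpa using hp)
  refine ⟨-s, ⟨by linarith [hs.2], by linarith [hs.1]⟩, h1, fun t ht => ?_⟩
  have := h2 (-t) ⟨by linarith [ht.2], by linarith [ht.1]⟩
  simpa using this

/-- if `u' ≥ 0` as long as `u ≤ η`, then `u ≥ η` persists. -/
lemma barrier {u u' : ℝ → ℝ} (hu : ∀ t, HasDerivAt u (u' t) t) {p q η : ℝ} (hpq : p ≤ q)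
    (hp : η ≤ u p) (h : ∀ t ∈ Icc p q, u t ≤ η → 0 ≤ u' t) : η ≤ u q := by
  by_contra hcon
  push Not at hcon
  have hc : Continuous u := continuous_iff_continuousAt.2 fun t => (hu t).continuousAt
  obtain ⟨s, hs, h1, h2⟩ := last_ge hc hpq hp hcon.le
  have : MonotoneOn u (Icc s q) := by
    apply monotoneOn_of_deriv_nonneg (convex_Icc _ _) hc.continuousOn
    · exact fun t _ => (hu t).differentiableAt.differentiableWithinAt
    · intro t ht
      rw [interior_Icc] at ht
      rw [(hu t).deriv]
      exact h t ⟨hs.1.trans ht.1.le, ht.2.le⟩ (h2 t ⟨ht.1.le, ht.2.le⟩)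
  have := this ⟨le_rfl, hs.2⟩ ⟨hs.2, le_rfl⟩ hs.2
  linarith

/-- linear decay -/
lemma decay {u u' : ℝ → ℝ} (hu : ∀ t, HasDerivAt u (u' t) t) {p c : ℝ}
    (h : ∀ t, p ≤ t → u' t ≤ -c) {q : ℝ} (hq : p ≤ q) : u q ≤ u p - c * (q - p) := by
  have hc : Continuous u := continuous_iff_continuousAt.2 fun t => (hu t).continuousAt
  have hd : ∀ t, HasDerivAt (fun t => u t + c * t) (u' t + c) t := fun t => by
    have h1 := (hu t).add ((hasDerivAt_id' t).const_mul c)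
    rw [mul_one] at h1
    exact h1
  have : AntitoneOn (fun t => u t + c * t) (Icc p q) := by
    apply antitoneOn_of_deriv_nonpos (convex_Icc _ _)
      (by fun_prop)
    · exact fun t _ => (hd t).differentiableAt.differentiableWithinAt
    · intro t ht
      rw [interior_Icc] at ht
      rw [(hd t).deriv]
      linarith [h t ht.1.le]
  have := this ⟨le_rfl, hq⟩ ⟨hq, le_rfl⟩ hq
  simp only at this
  linarith

structure IsSol (F g : ℝ → ℝ) (x y : ℝ → ℝ) : Prop where
  hx : ∀ t, HasDerivAt x (y t - F (x t)) t
  hy : ∀ t, HasDerivAt y (-g (x t)) t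

structure LH (F g G : ℝ → ℝ) (a b m K : ℝ) : Prop where
  ha : 0 < a
  hab : a ≤ b
  hm : 0 ≤ m
  hK : 0 < K
  Fc : Continuous F
  gc : Continuous g
  F0 : F 0 = 0
  Fa : F a = 0
  Fneg : ∀ x, 0 < x → x < a → F x < 0
  Fm : ∀ x, 0 ≤ x → -m ≤ F x
  FK1 : ∀ x, 0 ≤ x → x ≤ b → F x ≤ K
  FK2 : ∀ x, b ≤ x → K ≤ F x
  g0 : g 0 = 0
  glow : ∀ η, 0 < η → ∃ c, 0 < c ∧ ∀ x, η ≤ x → c ≤ g x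
  G0 : G 0 = 0
  hG : ∀ x, HasDerivAt G (g x) x

variable {F g G x y : ℝ → ℝ} {a b m K : ℝ}

lemma IsSol.xc (h : IsSol F g x y) : Continuous x :=
  continuous_iff_continuousAt.2 fun t => (h.hx t).continuousAt
lemma IsSol.yc (h : IsSol F g x y) : Continuous y :=
  continuous_iff_continuousAt.2 fun t => (h.hy t).continuousAt

lemma LH.gpos (H : LH F g G a b m K) {z : ℝ} (hz : 0 < z) : 0 < g z := by
  obtain ⟨c, hc, h⟩ := H.glow z hz
  exact hc.trans_le (h z le_rfl)
lemma LH.gnn (H : LH F g G a b m K) {z : ℝ} (hz : 0 ≤ z) : 0 ≤ g z := by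
  rcases hz.eq_or_lt with h | h
  · rw [← h, H.g0]
  · exact (H.gpos h).le

lemma LH.Gmono (H : LH F g G a b m K) : StrictMonoOn G (Ici 0) := by
  apply strictMonoOn_of_deriv_pos (convex_Ici _)
  · exact fun t _ => (H.hG t).continuousAt.continuousWithinAt
  · intro t ht
    rw [interior_Ici] at ht
    rw [(H.hG t).deriv]
    exact H.gpos ht

lemma IsSol.hE (h : IsSol F g x y) (H : LH F g G a b m K) (k t : ℝ) :
    HasDerivAt (fun t => (y t - k)^2/2 + G (x t)) (g (x t) * (k - F (x t))) t := by
  have h1 := ((((h.hy t).sub_const k).pow 2).div_const 2).add ((H.hG (x t)).comp t (h.hx t))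
  have e : g (x t) * (k - F (x t)) = (2:ℕ) * (y t - k) ^ (2 - 1) * -g (x t) / 2
      + g (x t) * (y t - F (x t)) := by
    push_cast
    ring
  rw [e]
  exact h1

lemma IsSol.E_mono (h : IsSol F g x y) (H : LH F g G a b m K) {k s t : ℝ} (hst : s ≤ t)
    (hh : ∀ u ∈ Icc s t, 0 ≤ x u ∧ F (x u) ≤ k) :
    (y s - k)^2/2 + G (x s) ≤ (y t - k)^2/2 + G (x t) := by
  have : MonotoneOn (fun t => (y t - k)^2/2 + G (x t)) (Icc s t) := by
    apply monotoneOn_of_deriv_nonneg (convex_Icc _ _)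
    · exact fun u _ => (h.hE H k u).continuousAt.continuousWithinAt
    · exact fun u _ => (h.hE H k u).differentiableAt.differentiableWithinAt
    · intro u hu
      rw [interior_Icc] at hu
      rw [(h.hE H k u).deriv]
      obtain ⟨h1, h2⟩ := hh u ⟨hu.1.le, hu.2.le⟩
      exact mul_nonneg (H.gnn h1) (by linarith)
  exact this ⟨le_rfl, hst⟩ ⟨hst, le_rfl⟩ hst

lemma IsSol.E_anti (h : IsSol F g x y) (H : LH F g G a b m K) {k s t : ℝ} (hst : s ≤ t)
    (hh : ∀ u ∈ Icc s t, 0 ≤ x u ∧ k ≤ F (x u)) :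
    (y t - k)^2/2 + G (x t) ≤ (y s - k)^2/2 + G (x s) := by
  have : AntitoneOn (fun t => (y t - k)^2/2 + G (x t)) (Icc s t) := by
    apply antitoneOn_of_deriv_nonpos (convex_Icc _ _)
    · exact fun u _ => (h.hE H k u).continuousAt.continuousWithinAt
    · exact fun u _ => (h.hE H k u).differentiableAt.differentiableWithinAt
    · intro u hu
      rw [interior_Icc] at hu
      rw [(h.hE H k u).deriv]
      obtain ⟨h1, h2⟩ := hh u ⟨hu.1.le, hu.2.le⟩
      exact mul_nonpos_of_nonneg_of_nonpos (H.gnn h1) (by linarith)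
  exact this ⟨le_rfl, hst⟩ ⟨hst, le_rfl⟩ hst

lemma IsSol.y_anti (h : IsSol F g x y) (H : LH F g G a b m K) {p q : ℝ}
    (hpos : ∀ t ∈ Ioo p q, 0 < x t) : StrictAntiOn y (Icc p q) := by
  apply strictAntiOn_of_deriv_neg (convex_Icc _ _) h.yc.continuousOn
  intro t ht
  rw [interior_Icc] at ht
  rw [(h.hy t).deriv]
  linarith [H.gpos (hpos t ht)]

/-- the half return -/
structure IsRet (x y : ℝ → ℝ) (τ : ℝ) : Prop where
  pos : 0 < τ
  xpos : ∀ t ∈ Ioo 0 τ, 0 < x t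
  x0 : x τ = 0
  yneg : y τ < 0

lemma start_pos (h : IsSol F g x y) (H : LH F g G a b m K) (hx0 : x 0 = 0) (hy0 : 0 < y 0) :
    ∃ δ > 0, ∀ t ∈ Ioc 0 δ, 0 < x t := by
  have h1 : ∀ᶠ t in 𝓝 (0:ℝ), 0 < y t - F (x t) := by
    have hc : Continuous fun t => y t - F (x t) := h.yc.sub (H.Fc.comp h.xc)
    apply hc.continuousAt.eventually_const_lt
    simpa [hx0, H.F0] using hy0
  obtain ⟨δ, hδ, h2⟩ := Metric.eventually_nhds_iff.1 h1
  refine ⟨δ/2, by positivity, fun t ht => ?_⟩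
  have : StrictMonoOn x (Icc 0 (δ/2)) := by
    apply strictMonoOn_of_deriv_pos (convex_Icc _ _) h.xc.continuousOn
    intro s hs
    rw [interior_Icc] at hs
    rw [(h.hx s).deriv]
    apply h2
    rw [Real.dist_eq, abs_lt]
    constructor <;> linarith [hs.1, hs.2]
  have := this ⟨le_rfl, by positivity⟩ ⟨ht.1.le, ht.2⟩ ht.1
  linarith

lemma not_forever (h : IsSol F g x y) (H : LH F g G a b m K) (hpos : ∀ t, 0 < t → 0 < x t) :
    False := by
  have hya : ∀ s t, 0 ≤ s → s ≤ t → y t ≤ y s := by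
    intro s t hs hst
    rcases hst.eq_or_lt with e | e
    · rw [e]
    · exact (h.y_anti H (p := s) (q := t) (fun u hu => hpos u (hs.trans_lt hu.1))
        ⟨le_rfl, hst⟩ ⟨hst, le_rfl⟩ e).le
  -- if y is very negative we are done
  have key : ∀ t, 0 < t → ¬ (y t ≤ -m - 1) := by
    intro t ht hyt
    have := decay h.hx (p := t) (c := 1) (fun s hs => by
      have h1 := hya t s ht.le hs
      have h2 := H.Fm (x s) (hpos s (by linarith)).le
      linarith) (q := t + x t) (by linarith [hpos t ht])
    have h2 := hpos (t + x t) (by linarith [hpos t ht])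
    linarith
  -- step 1
  have s1 : ∃ t, 0 < t ∧ y t < 0 := by
    by_contra hcon
    push Not at hcon
    set η := min (x 1) a with hη
    have hη0 : 0 < η := lt_min (hpos 1 one_pos) H.ha
    have hb : ∀ t, 1 ≤ t → η ≤ x t := by
      intro t ht
      apply barrier h.hx ht (min_le_left _ _)
      intro s hs hxs
      have h1 := hcon s (by linarith [hs.1])
      have h2 : F (x s) ≤ 0 := by
        rcases (hxs.trans (min_le_right _ _)).eq_or_lt with e | e
        · rw [e, H.Fa]
        · exact (H.Fneg _ (hpos s (by linarith [hs.1])) e).le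
      linarith
    obtain ⟨c, hc, hgc⟩ := H.glow η hη0
    have hy1 := hcon 1 one_pos
    have hp : 0 ≤ (y 1 + 1) / c := by positivity
    have := decay h.hy (p := 1) (c := c) (fun s hs => by
      linarith [hgc _ (hb s hs)]) (q := 1 + (y 1 + 1)/c) (by linarith)
    have h3 := hcon (1 + (y 1 + 1)/c) (by linarith)
    have h4 : c * ((1 + (y 1 + 1)/c) - 1) = y 1 + 1 := by field_simp; ring
    linarith
  obtain ⟨t2, ht2, hy2⟩ := s1
  set κ := - y t2 with hκ
  have hκ0 : 0 < κ := by linarith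
  obtain ⟨η, hη, hFη⟩ : ∃ η > 0, ∀ z, 0 ≤ z → z ≤ η → -(κ/2) ≤ F z := by
    have : ∀ᶠ z in 𝓝 (0:ℝ), -(κ/2) < F z := by
      apply H.Fc.continuousAt.eventually_const_lt
      rw [H.F0]; linarith
    obtain ⟨δ, hδ, hh⟩ := Metric.eventually_nhds_iff.1 this
    refine ⟨δ/2, by positivity, fun z hz hz' => (hh ?_).le⟩
    rw [Real.dist_eq, abs_lt]
    constructor <;> linarith
  obtain ⟨c, hc, hgc⟩ := H.glow η hη
  set ε := c / (2 * (m+1)) with hε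
  have hm := H.hm
  have hε0 : 0 < ε := by positivity
  have hεm : ε * m ≤ c / 2 := by
    have : ε * (m+1) = c/2 := by rw [hε]; field_simp
    nlinarith
  set ρ := min (c/2) (ε * (κ/2)) with hρ
  have hρ0 : 0 < ρ := lt_min (by positivity) (by positivity)
  have hW : ∀ t, HasDerivAt (fun t => ε * x t + y t) (ε * (y t - F (x t)) + - g (x t)) t :=
    fun t => ((h.hx t).const_mul ε).add (h.hy t)
  have hdec : ∀ q, t2 ≤ q → _ := fun q hq => decay hW (p := t2) (c := ρ) (fun s hs => by
    have hxs := hpos s (by linarith)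
    have hys : y s ≤ -κ := by have := hya t2 s ht2.le hs; linarith
    rcases le_total (x s) η with hc1 | hc1
    · have h1 := hFη _ hxs.le hc1
      have h2 := H.gpos hxs
      have h3 : ρ ≤ ε * (κ/2) := min_le_right _ _
      have : ε * (y s - F (x s)) ≤ ε * (-(κ/2)) := by
        apply mul_le_mul_of_nonneg_left _ hε0.le; linarith
      linarith
    · have h1 := hgc _ hc1
      have h2 := H.Fm _ hxs.le
      have h3 : ρ ≤ c/2 := min_le_left _ _
      have : ε * (y s - F (x s)) ≤ ε * m := by
        apply mul_le_mul_of_nonneg_left _ hε0.le; linarith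
      linarith) hq
  set W := ε * x t2 + y t2 with hWd
  set L := (|W| + m + 1)/ρ with hL
  have hL0 : 0 ≤ L := by positivity
  have h1 := hdec (t2 + L) (by linarith)
  have h2 : ρ * (t2 + L - t2) = |W| + m + 1 := by rw [hL]; field_simp; ring
  have h3 := hpos (t2 + L) (by linarith)
  have h4 : 0 < ε * x (t2 + L) := by positivity
  apply key (t2 + L) (by linarith)
  linarith [le_abs_self W]

lemma exists_ret (h : IsSol F g x y) (H : LH F g G a b m K) (hx0 : x 0 = 0) (hy0 : 0 < y 0) :
    ∃ τ, IsRet x y τ := by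
  obtain ⟨δ, hδ, hd⟩ := start_pos h H hx0 hy0
  have h1 : ∃ t, 0 < t ∧ x t ≤ 0 := by
    by_contra hcon
    push Not at hcon
    exact not_forever h H hcon
  obtain ⟨T, hT, hxT⟩ := h1
  have hδT : δ < T := by
    by_contra hcon
    push Not at hcon
    linarith [hd T ⟨hT, hcon⟩]
  have hc : IsCompact (Icc δ T ∩ {t | x t ≤ 0}) :=
    isCompact_Icc.inter_right (isClosed_le h.xc continuous_const)
  obtain ⟨τ, ⟨hs, hs'⟩, hgr⟩ := hc.exists_isLeast ⟨T, ⟨hδT.le, le_rfl⟩, hxT⟩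
  have hτ : 0 < τ := hδ.trans_le hs.1
  have hpos : ∀ t ∈ Ioo 0 τ, 0 < x t := by
    intro t ht
    by_contra hcon
    push Not at hcon
    rcases le_total t δ with h2 | h2
    · linarith [hd t ⟨ht.1, h2⟩]
    · have := hgr ⟨⟨h2, ht.2.le.trans hs.2⟩, hcon⟩
      linarith [ht.2]
  have hx : x τ = 0 := by
    apply le_antisymm hs'
    have hcl : τ ∈ closure (Ioo 0 τ) := by
      rw [closure_Ioo hτ.ne]; exact ⟨hτ.le, le_rfl⟩
    exact closure_minimal (s := Ioo 0 τ) (t := {t | 0 ≤ x t}) (fun t ht => (hpos t ht).le)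
      (isClosed_le continuous_const h.xc) hcl
  refine ⟨τ, hτ, hpos, hx, ?_⟩
  by_contra hcon
  push Not at hcon
  have hev : ∀ᶠ t in 𝓝 τ, x t < a := by
    apply h.xc.continuousAt.eventually_lt_const
    rw [hx]; exact H.ha
  obtain ⟨r, hr, hh⟩ := Metric.eventually_nhds_iff.1 hev
  set p := max (τ/2) (τ - r/2) with hp
  have hp1 : τ/2 ≤ p := le_max_left _ _
  have hp2 : τ - r/2 ≤ p := le_max_right _ _
  have hp3 : p < τ := max_lt (by linarith) (by linarith)
  have hya := h.y_anti H hpos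
  have : StrictMonoOn x (Icc p τ) := by
    apply strictMonoOn_of_deriv_pos (convex_Icc _ _) h.xc.continuousOn
    intro s hs
    rw [interior_Icc] at hs
    rw [(h.hx s).deriv]
    have e1 : x s < a := by
      apply hh
      rw [Real.dist_eq, abs_lt]
      constructor <;> linarith [hs.1, hs.2]
    have e0 : 0 < s := by linarith [hs.1]
    have e2 := H.Fneg _ (hpos s ⟨e0, hs.2⟩) e1
    have e3 := hya ⟨e0.le, hs.2.le⟩ ⟨hτ.le, le_rfl⟩ hs.2
    linarith
  have h5 := this ⟨le_rfl, hp3.le⟩ ⟨hp3.le, le_rfl⟩ hp3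
  have h6 := hpos p ⟨by linarith, hp3⟩
  linarith

lemma IsRet.xnn {τ : ℝ} (hr : IsRet x y τ) (hx0 : x 0 = 0) {t : ℝ} (ht : t ∈ Icc 0 τ) : 0 ≤ x t := by
  rcases ht.1.eq_or_lt with e | e
  · rw [← e, hx0]
  rcases ht.2.eq_or_lt with e' | e'
  · rw [e', hr.x0]
  exact (hr.xpos t ⟨e, e'⟩).le

lemma small_case {τ : ℝ} (h : IsSol F g x y) (H : LH F g G a b m K) (hr : IsRet x y τ)
    (hx0 : x 0 = 0) (hy0 : 0 < y 0) (hsm : (y 0)^2/2 + m * y 0 < G a) : y 0 ≤ - y τ := by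
  have hτ := hr.pos
  have hya := h.y_anti H hr.xpos
  have hxa : ∀ t ∈ Icc 0 τ, x t ≤ a := by
    have c1 : ∀ t ∈ Icc 0 τ, 0 ≤ y t → x t < a := by
      intro t ht hyt
      have h1 := h.E_anti H (k := -m) (s := 0) (t := t) ht.1 (fun u hu => by
        have := hr.xnn hx0 ⟨hu.1, hu.2.trans ht.2⟩
        exact ⟨this, H.Fm _ this⟩)
      rw [hx0, H.G0] at h1
      have h2 : G (x t) < G a := by nlinarith [mul_nonneg H.hm hyt]
      exact (H.Gmono.lt_iff_lt (hr.xnn hx0 ht) H.ha.le).1 h2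
    intro t ht
    by_contra hcon
    push Not at hcon
    obtain ⟨s, hs, hsa, hsl⟩ := first_ge h.xc ht.1 (p := 0) (η := a) (by rw [hx0]; exact H.ha.le)
      hcon.le
    have hs0 : 0 < s := by
      rcases hs.1.eq_or_lt with e | e
      · rw [← e, hx0] at hsa; linarith [H.ha]
      · exact e
    have hys : y s < 0 := by
      by_contra hc
      push Not at hc
      linarith [c1 s ⟨hs.1, hs.2.trans ht.2⟩ hc]
    have hev : ∀ᶠ t in 𝓝 s, y t - F (x t) < 0 := by
      have hc : Continuous fun t => y t - F (x t) := h.yc.sub (H.Fc.comp h.xc)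
      apply hc.continuousAt.eventually_lt_const
      simp only [hsa, H.Fa]; linarith
    obtain ⟨r, hr, hh⟩ := Metric.eventually_nhds_iff.1 hev
    set p := max (s/2) (s - r/2) with hp
    have hp1 : s/2 ≤ p := le_max_left _ _
    have hp2 : s - r/2 ≤ p := le_max_right _ _
    have hp3 : p < s := max_lt (by linarith) (by linarith)
    have : StrictAntiOn x (Icc p s) := by
      apply strictAntiOn_of_deriv_neg (convex_Icc _ _) h.xc.continuousOn
      intro u hu
      rw [interior_Icc] at hu
      rw [(h.hx u).deriv]
      apply hh
      rw [Real.dist_eq, abs_lt]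
      constructor <;> linarith [hu.1, hu.2]
    have h5 := this ⟨le_rfl, hp3.le⟩ ⟨hp3.le, le_rfl⟩ hp3
    have h6 := hsl p ⟨by linarith, hp3.le⟩
    linarith
  have h1 := h.E_mono H (k := 0) (s := 0) (t := τ) hτ.le (fun u hu => by
    have h2 := hr.xnn hx0 hu
    refine ⟨h2, ?_⟩
    rcases h2.eq_or_lt with e | e
    · rw [← e, H.F0]
    rcases (hxa u hu).eq_or_lt with e' | e'
    · rw [e', H.Fa]
    exact (H.Fneg _ e e').le)
  rw [hx0, hr.x0] at h1
  have := hr.yneg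
  nlinarith

lemma large_case {τ : ℝ} (h : IsSol F g x y) (H : LH F g G a b m K) (hr : IsRet x y τ)
    (hx0 : x 0 = 0) (hy0 : K < y 0) (h1 : 2 * G b < (y 0 - K)^2) (h2 : 2 * K + m ≤ y 0)
    (h3 : (y 0 - 2 * K - m)^2 + 2 * G b ≤ (y 0 - m)^2)
    (h4 : (K + m)^2 + 2 * G b ≤ (y 0 - m)^2) : - y τ ≤ y 0 := by
  have hτ := hr.pos
  have hya := h.y_anti H hr.xpos
  have hb : 0 ≤ b := H.ha.le.trans H.hab
  have hKp := H.hK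
  have hm := H.hm
  obtain ⟨s, hs, hys⟩ := intermediate_value_Icc' hτ.le h.yc.continuousOn
    (show K ∈ Icc (y τ) (y 0) from ⟨by linarith [hr.yneg], hy0.le⟩)
  have hxs : b ≤ x s := by
    by_contra hcon
    push Not at hcon
    by_cases hex : ∃ p ∈ Icc 0 s, b ≤ x p
    · obtain ⟨p, hp, hbp⟩ := hex
      obtain ⟨t', ht', e1, e2⟩ := last_ge h.xc hp.2 hbp hcon.le
      have ht0 : 0 ≤ t' := hp.1.trans ht'.1
      have e3 := h.E_mono H (k := K) ht'.2 (fun u hu => by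
        have := hr.xnn hx0 ⟨ht0.trans hu.1, hu.2.trans hs.2⟩
        exact ⟨this, H.FK1 _ this (e2 u hu)⟩)
      have e4 := H.Gmono (hr.xnn hx0 hs) hb hcon
      rw [hys, e1] at e3
      nlinarith [sq_nonneg (y t' - K)]
    · push Not at hex
      have e3 := h.E_mono H (k := K) hs.1 (fun u hu => by
        have := hr.xnn hx0 ⟨hu.1, hu.2.trans hs.2⟩
        exact ⟨this, H.FK1 _ this (hex u hu).le⟩)
      have e4 := H.Gmono (hr.xnn hx0 hs) hb hcon
      rw [hys, hx0, H.G0] at e3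
      nlinarith
  obtain ⟨t1, ht1, e1, f1⟩ := last_ge (u := fun t => - x t) h.xc.neg (p := 0) (q := s) (η := -b)
    hs.1 (by simp [hx0, hb]) (by linarith)
  obtain ⟨t2, ht2, e2, f2⟩ := first_ge (u := fun t => - x t) h.xc.neg (p := s) (q := τ) (η := -b)
    hs.2 (by linarith) (by simp [hr.x0, hb])
  simp only [neg_inj] at e1 e2
  have t12 : t1 ≤ t2 := ht1.2.trans ht2.1
  have t20 : 0 ≤ t2 := ht1.1.trans t12
  have mid := h.E_anti H (k := K) t12 (fun u hu => by
    have hbu : b ≤ x u := by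
      rcases le_total u s with hh | hh
      · have := f1 u ⟨hu.1, hh⟩; linarith
      · have := f2 u ⟨hh, hu.2⟩; linarith
    exact ⟨hb.trans hbu, H.FK2 _ hbu⟩)
  rw [e1, e2] at mid
  have leg3 := h.E_anti H (k := -m) ht2.2 (fun u hu => by
    have := hr.xnn hx0 ⟨t20.trans hu.1, hu.2⟩
    exact ⟨this, H.Fm _ this⟩)
  rw [e2, hr.x0, H.G0] at leg3
  have y1 : y t1 ≤ y 0 := hya.antitoneOn ⟨le_rfl, hτ.le⟩ ⟨ht1.1, ht1.2.trans hs.2⟩ ht1.1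
  have y1' : K ≤ y t1 := by
    rw [← hys]; exact hya.antitoneOn ⟨ht1.1, ht1.2.trans hs.2⟩ hs ht1.2
  have y2 : y t2 ≤ K := by
    rw [← hys]; exact hya.antitoneOn hs ⟨t20, ht2.2⟩ ht2.1
  have y2' : K - y t2 ≤ y t1 - K := by
    apply le_of_sq_le_sq _ (by linarith) |> fun h => h
    nlinarith
  have fin : (y τ + m)^2 ≤ (y 0 - m)^2 := by
    rcases le_total (y t2 + m) 0 with hc | hc
    · have : (y t2 + m)^2 ≤ (y 0 - 2*K - m)^2 := by
        apply sq_le_sq'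
        · linarith
        · linarith
      nlinarith
    · have : (y t2 + m)^2 ≤ (K + m)^2 := by
        apply sq_le_sq' <;> linarith
      nlinarith
  have := abs_le_of_sq_le_sq' fin (by linarith)
  linarith [this.1]

end PartA

section PartB
open Set Filter Topology

lemma V_lip {F g : ℝ → ℝ} {k : NNReal} (hF : LipschitzWith k F) (hg : LipschitzWith k g) :
    LipschitzWith (1 + k) (fun z : ℝ × ℝ => ((z.2 - F z.1, -g z.1) : ℝ × ℝ)) := by
  apply LipschitzWith.of_dist_le_mul
  intro z w
  have h1 := hF.dist_le_mul z.1 w.1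
  have h2 := hg.dist_le_mul z.1 w.1
  have d1 : dist z.1 w.1 ≤ dist z w := le_max_left _ _
  have d2 : dist z.2 w.2 ≤ dist z w := le_max_right _ _
  have hk : (0:ℝ) ≤ k := k.2
  have d3 := mul_le_mul_of_nonneg_left d1 hk
  have d0 : 0 ≤ dist z w := dist_nonneg
  rw [Prod.dist_eq (x := (z.2 - F z.1, -g z.1))]
  push_cast
  apply max_le
  · have := dist_sub_sub_le z.2 (F z.1) w.2 (F w.1)
    linarith
  · simp only [dist_neg_neg]
    linarith

lemma pair_deriv {x y : ℝ → ℝ} {x' y' t : ℝ} (hx : HasDerivAt x x' t) (hy : HasDerivAt y y' t) :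
    HasDerivAt (fun s => ((x s, y s) : ℝ × ℝ)) (x', y') t := hx.prodMk hy

lemma fst_deriv {z : ℝ → ℝ × ℝ} {z' : ℝ × ℝ} {t : ℝ} (h : HasDerivAt z z' t) :
    HasDerivAt (fun s => (z s).1) z'.1 t :=
  ((ContinuousLinearMap.fst ℝ ℝ ℝ).hasFDerivAt.comp_hasDerivAt t h)

lemma snd_deriv {z : ℝ → ℝ × ℝ} {z' : ℝ × ℝ} {t : ℝ} (h : HasDerivAt z z' t) :
    HasDerivAt (fun s => (z s).2) z'.2 t :=
  ((ContinuousLinearMap.snd ℝ ℝ ℝ).hasFDerivAt.comp_hasDerivAt t h)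

lemma exist_T {F g : ℝ → ℝ} {k B : NNReal} (hF : LipschitzWith k F) (hg : LipschitzWith k g)
    (bF : ∀ x, |F x| ≤ B) (bg : ∀ x, |g x| ≤ B) (T : NNReal) (p q : ℝ) :
    ∃ z : ℝ → ℝ × ℝ, z 0 = (p, q) ∧ ∀ t ∈ Ioo (-(T:ℝ)) T,
      HasDerivAt z ((z t).2 - F (z t).1, -g (z t).1) t := by
  set v : ℝ → ℝ × ℝ → ℝ × ℝ := fun t z => (-F (z.1 + t * z.2) + t * g (z.1 + t * z.2),
    -g (z.1 + t * z.2)) with hv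
  have hT : (0:ℝ) ≤ T := T.2
  have hB : (0:ℝ) ≤ B := B.2
  have hk : (0:ℝ) ≤ k := k.2
  have h0 : (0:ℝ) ∈ Icc (-(T:ℝ)) T := ⟨by linarith, hT⟩
  have hPL : IsPicardLindelof v (tmin := -(T:ℝ)) (tmax := T) ⟨0, h0⟩ ((p, q) : ℝ × ℝ)
      ((1 + T) * B * T) 0 ((1 + T) * B) ((1 + T) * k * (1 + T)) := by
    constructor
    · intro t ht
      apply LipschitzOnWith.of_dist_le_mul
      intro z _ w _
      have ht' : |t| ≤ T := abs_le.2 ht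
      have d1 : |z.1 - w.1| ≤ dist z w := le_max_left _ _
      have d2 : |z.2 - w.2| ≤ dist z w := le_max_right _ _
      have d0 : 0 ≤ dist z w := dist_nonneg
      set D := dist z w
      set s := z.1 + t * z.2 with hs
      set s' := w.1 + t * w.2 with hs'
      have d3 : |s - s'| ≤ (1 + T) * D := by
        have : s - s' = (z.1 - w.1) + t * (z.2 - w.2) := by rw [hs, hs']; ring
        rw [this]
        refine (abs_add_le _ _).trans ?_
        rw [abs_mul]
        have := mul_le_mul ht' d2 (abs_nonneg _) hT
        linarith
      have h1 := hF.dist_le_mul s s'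
      have h2 := hg.dist_le_mul s s'
      rw [Real.dist_eq, Real.dist_eq] at h1 h2
      have d4 := mul_le_mul_of_nonneg_left d3 hk
      have d5 : |t * (g s - g s')| ≤ T * (k * ((1+T) * D)) := by
        rw [abs_mul]
        exact mul_le_mul ht' (h2.trans d4) (abs_nonneg _) hT
      have d6 : 0 ≤ T * (k * ((1+T) * D)) := by positivity
      rw [Prod.dist_eq]
      push_cast
      apply max_le
      · simp only [hv, Real.dist_eq]
        have e : -F s + t * g s - (-F s' + t * g s') = -(F s - F s') + t * (g s - g s') := by ring
        rw [e]
        refine (abs_add_le _ _).trans ?_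
        rw [abs_neg]
        linarith
      · simp only [hv, dist_neg_neg, Real.dist_eq]
        linarith
    · intro z _
      have := hF.continuous
      have := hg.continuous
      apply Continuous.continuousOn
      simp only [hv]
      fun_prop
    · intro t ht z _
      have ht' : |t| ≤ T := abs_le.2 ht
      rw [Prod.norm_def]
      push_cast
      apply max_le
      · simp only [hv, Real.norm_eq_abs]
        refine (abs_add_le _ _).trans ?_
        rw [abs_neg, abs_mul]
        have := mul_le_mul ht' (bg (z.1 + t * z.2)) (abs_nonneg _) hT
        linarith [bF (z.1 + t * z.2)]
      · simp only [hv, Real.norm_eq_abs, abs_neg]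
        have := mul_nonneg hT hB
        linarith [bg (z.1 + t * z.2)]
    · simp
  obtain ⟨α, hα0, hα⟩ := hPL.exists_eq_forall_mem_Icc_hasDerivWithinAt₀
  refine ⟨fun t => ((α t).1 + t * (α t).2, (α t).2), ?_, ?_⟩
  · simp only at hα0
    simp [hα0]
  · intro t ht
    have hd := (hα t ⟨ht.1.le, ht.2.le⟩).hasDerivAt (Icc_mem_nhds ht.1 ht.2)
    have h1 := fst_deriv hd
    have h2 := snd_deriv hd
    have h3 := h1.add ((hasDerivAt_id' t).mul h2)
    refine pair_deriv ?_ h2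
    have e : (α t).2 - F ((α t).1 + t * (α t).2) = (v t (α t)).1 + (1 * (α t).2
      + t * (v t (α t)).2) := by
      simp only [hv]; ring
    simp only
    rw [e]
    exact h3

lemma exist_global {F g : ℝ → ℝ} {k B : NNReal} (hF : LipschitzWith k F) (hg : LipschitzWith k g)
    (bF : ∀ x, |F x| ≤ B) (bg : ∀ x, |g x| ≤ B) (p q : ℝ) :
    ∃ x y, IsSol F g x y ∧ x 0 = p ∧ y 0 = q := by
  have := fun n : ℕ => exist_T hF hg bF bg (n + 1) p q
  choose z hz0 hz using this
  have hcons : ∀ n m : ℕ, n ≤ m → ∀ t ∈ Ioo (-((n:ℝ)+1)) (n+1), z n t = z m t := by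
    intro n m hnm t ht
    have hn : (0:ℝ) ≤ n := n.cast_nonneg
    have hnm' : (n:ℝ) ≤ m := by exact_mod_cast hnm
    refine ODE_solution_unique_of_mem_Ioo (v := fun _ z => ((z.2 - F z.1, -g z.1) : ℝ × ℝ))
      (s := fun _ => univ) (K := 1 + k) (t₀ := 0) (fun _ _ => (V_lip hF hg).lipschitzOnWith)
      ⟨by linarith, by linarith⟩ ?_ ?_ ?_ ht
    · intro s hs
      exact ⟨hz n s (by push_cast; exact hs), trivial⟩
    · intro s hs
      exact ⟨hz m s (by push_cast; exact ⟨by linarith [hs.1], by linarith [hs.2]⟩), trivial⟩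
    · rw [hz0, hz0]
  set Z : ℝ → ℝ × ℝ := fun t => z ⌈|t|⌉₊ t with hZ
  have hZn : ∀ n : ℕ, ∀ t ∈ Ioo (-((n:ℝ)+1)) (n+1), Z t = z n t := by
    intro n t ht
    rcases le_total n ⌈|t|⌉₊ with h | h
    · exact (hcons n _ h t ht).symm
    · apply hcons _ _ h
      have := abs_le.1 (Nat.le_ceil |t|)
      exact ⟨by linarith [this.1], by linarith [this.2]⟩
  have hZd : ∀ t, HasDerivAt Z ((Z t).2 - F (Z t).1, -g (Z t).1) t := by
    intro t
    set n := ⌈|t|⌉₊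
    have := abs_le.1 (Nat.le_ceil |t|)
    have hmem : t ∈ Ioo (-((n:ℝ)+1)) (n+1) := ⟨by linarith [this.1], by linarith [this.2]⟩
    have h1 := hz n t (by push_cast; exact hmem)
    rw [← hZn n t hmem] at h1
    refine h1.congr_of_eventuallyEq ?_
    filter_upwards [Ioo_mem_nhds hmem.1 hmem.2] with s hs
    exact hZn n s hs
  refine ⟨fun t => (Z t).1, fun t => (Z t).2, ⟨fun t => fst_deriv (hZd t),
    fun t => snd_deriv (hZd t)⟩, ?_, ?_⟩ <;> simp [hZ, hz0]

lemma sol_unique {F g : ℝ → ℝ} {k : NNReal} (hF : LipschitzWith k F) (hg : LipschitzWith k g)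
    {x y x' y' : ℝ → ℝ} (h : IsSol F g x y) (h' : IsSol F g x' y') (hx : x 0 = x' 0)
    (hy : y 0 = y' 0) : x = x' ∧ y = y' := by
  have : ∀ t, (x t, y t) = (x' t, y' t) := by
    intro t
    have hab := abs_nonneg t
    refine ODE_solution_unique_of_mem_Ioo (f := fun t => (x t, y t)) (g := fun t => (x' t, y' t))
      (v := fun _ z => ((z.2 - F z.1, -g z.1) : ℝ × ℝ))
      (a := -(|t| + 1)) (b := |t| + 1)
      (s := fun _ => univ) (K := 1 + k) (t₀ := 0) (fun _ _ => (V_lip hF hg).lipschitzOnWith)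
      ⟨by linarith, by linarith⟩ ?_ ?_ ?_ ⟨by linarith [neg_abs_le t], by linarith [le_abs_self t]⟩
    · intro s hs
      exact ⟨pair_deriv (h.hx s) (h.hy s), trivial⟩
    · intro s hs
      exact ⟨pair_deriv (h'.hx s) (h'.hy s), trivial⟩
    · simp [hx, hy]
  exact ⟨funext fun t => congrArg Prod.fst (this t), funext fun t => congrArg Prod.snd (this t)⟩

lemma sol_dep {F g : ℝ → ℝ} {k : NNReal} (hF : LipschitzWith k F) (hg : LipschitzWith k g)
    (T : ℝ) : ∃ C > 0, ∀ x y x' y', IsSol F g x y → IsSol F g x' y' → x 0 = x' 0 →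
      ∀ t ∈ Icc 0 T, |x t - x' t| ≤ C * |y 0 - y' 0| ∧ |y t - y' t| ≤ C * |y 0 - y' 0| := by
  refine ⟨Real.exp ((1 + k : NNReal) * T), Real.exp_pos _, ?_⟩
  intro x y x' y' h h' h0 t ht
  have key := dist_le_of_trajectories_ODE (f := fun t => (x t, y t)) (g := fun t => (x' t, y' t))
    (v := fun _ z => ((z.2 - F z.1, -g z.1) : ℝ × ℝ)) (K := 1 + k) (a := 0) (b := T)
    (δ := |y 0 - y' 0|) (fun _ => V_lip hF hg)
    ((h.xc.prodMk h.yc).continuousOn) (fun s _ => (pair_deriv (h.hx s) (h.hy s)).hasDerivWithinAt)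
    ((h'.xc.prodMk h'.yc).continuousOn)
    (fun s _ => (pair_deriv (h'.hx s) (h'.hy s)).hasDerivWithinAt)
    (by rw [Prod.dist_eq]; simp [h0, Real.dist_eq]) t ht
  have hle : |y 0 - y' 0| * Real.exp ((1 + k : NNReal) * (t - 0)) ≤
      Real.exp ((1 + k : NNReal) * T) * |y 0 - y' 0| := by
    rw [mul_comm, sub_zero]
    have := ht.2
    gcongr
  have key2 := key.trans hle
  rw [Prod.dist_eq] at key2
  exact ⟨(le_max_left _ _).trans key2, (le_max_right _ _).trans key2⟩

end PartB

section PartC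
open Set Filter Topology

variable {F g G x y : ℝ → ℝ} {a b m K : ℝ}

lemma ret_cont {k : NNReal} (hF : LipschitzWith k F) (hg : LipschitzWith k g)
    (H : LH F g G a b m K) {x₀ y₀ : ℝ → ℝ} {τ₀ : ℝ} (h₀ : IsSol F g x₀ y₀) (hx₀ : x₀ 0 = 0)
    (hy₀ : 0 < y₀ 0) (hr₀ : IsRet x₀ y₀ τ₀) {ε : ℝ} (hε : 0 < ε) :
    ∃ δ > 0, ∀ x y τ, IsSol F g x y → x 0 = 0 → IsRet x y τ → |y 0 - y₀ 0| < δ →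
      |τ - τ₀| ≤ ε := by
  have hτ := hr₀.pos
  set ε' := min ε (τ₀/2) with hε'
  have hε'0 : 0 < ε' := lt_min hε (by linarith)
  have hε'1 : ε' ≤ ε := min_le_left _ _
  have hε'2 : ε' ≤ τ₀/2 := min_le_right _ _
  -- crossing
  obtain ⟨r, hr, hrε, hxr⟩ : ∃ r, 0 < r ∧ r ≤ ε' ∧ x₀ (τ₀ + r) < 0 := by
    have hev : ∀ᶠ t in 𝓝 τ₀, y₀ t - F (x₀ t) < 0 := by
      have hc : Continuous fun t => y₀ t - F (x₀ t) := h₀.yc.sub (H.Fc.comp h₀.xc)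
      apply hc.continuousAt.eventually_lt_const
      simp only [hr₀.x0, H.F0]; linarith [hr₀.yneg]
    obtain ⟨ρ, hρ, hh⟩ := Metric.eventually_nhds_iff.1 hev
    have hm0 : 0 < min ε' (ρ/2) := lt_min hε'0 (by linarith)
    refine ⟨min ε' (ρ/2), hm0, min_le_left _ _, ?_⟩
    have hm2 : min ε' (ρ/2) ≤ ρ/2 := min_le_right _ _
    set r := min ε' (ρ/2)
    have : StrictAntiOn x₀ (Icc τ₀ (τ₀ + r)) := by
      apply strictAntiOn_of_deriv_neg (convex_Icc _ _) h₀.xc.continuousOn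
      intro u hu
      rw [interior_Icc] at hu
      rw [(h₀.hx u).deriv]
      apply hh
      rw [Real.dist_eq, abs_lt]
      constructor <;> linarith [hu.1, hu.2]
    have h5 := this ⟨le_rfl, by linarith⟩ ⟨by linarith, le_rfl⟩ (by linarith)
    rw [hr₀.x0] at h5
    exact h5
  -- beginning
  obtain ⟨d, hd, hyd⟩ : ∃ d > 0, ∀ t ∈ Icc 0 d, y₀ 0 / 2 < y₀ t := by
    have hev : ∀ᶠ t in 𝓝 (0:ℝ), y₀ 0 / 2 < y₀ t :=
      h₀.yc.continuousAt.eventually_const_lt (by linarith)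
    obtain ⟨ρ, hρ, hh⟩ := Metric.eventually_nhds_iff.1 hev
    refine ⟨ρ/2, by linarith, fun t ht => hh ?_⟩
    rw [Real.dist_eq, abs_lt]
    constructor <;> linarith [ht.1, ht.2]
  -- middle
  obtain ⟨μ, hμ, hxμ⟩ : ∃ μ > 0, ∀ t ∈ Icc d (τ₀ - ε'), μ ≤ x₀ t := by
    rcases (Icc d (τ₀ - ε')).eq_empty_or_nonempty with he | hne
    · exact ⟨1, one_pos, by simp [he]⟩
    · obtain ⟨s, hs, hmin⟩ := isCompact_Icc.exists_isMinOn hne h₀.xc.continuousOn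
      exact ⟨x₀ s, hr₀.xpos s ⟨by linarith [hs.1], by linarith [hs.2]⟩, fun t ht => hmin ht⟩
  obtain ⟨C, hC, hdep⟩ := sol_dep hF hg (τ₀ + ε')
  set ν := min (min μ (-x₀ (τ₀ + r))) (y₀ 0 / 2) with hν
  have hν0 : 0 < ν := lt_min (lt_min hμ (by linarith)) (by linarith)
  have hν1 : ν ≤ μ := (min_le_left _ _).trans (min_le_left _ _)
  have hν2 : ν ≤ -x₀ (τ₀ + r) := (min_le_left _ _).trans (min_le_right _ _)
  have hν3 : ν ≤ y₀ 0 / 2 := min_le_right _ _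
  refine ⟨ν / C, by positivity, ?_⟩
  intro x y τ h hx hret hclose
  have hclose' : C * |y 0 - y₀ 0| < ν := by
    rw [lt_div_iff₀ hC] at hclose
    linarith
  have hd1 : ∀ t ∈ Icc 0 (τ₀ + ε'), |x t - x₀ t| < ν ∧ |y t - y₀ t| < ν := by
    intro t ht
    obtain ⟨p, q⟩ := hdep x y x₀ y₀ h h₀ (by rw [hx, hx₀]) t ht
    exact ⟨p.trans_lt hclose', q.trans_lt hclose'⟩
  have lower : τ₀ - ε' < τ := by
    by_contra hcon
    push Not at hcon
    obtain ⟨p, q⟩ := hd1 τ ⟨hret.pos.le, by linarith⟩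
    rw [abs_lt] at p q
    rcases le_total τ d with hle | hle
    · have := hyd τ ⟨hret.pos.le, hle⟩
      linarith [hret.yneg, q.1]
    · have := hxμ τ ⟨hle, hcon⟩
      rw [hret.x0] at p
      linarith [p.1]
  have upper : τ < τ₀ + r := by
    by_contra hcon
    push Not at hcon
    have h1 := hret.xnn hx (t := τ₀ + r) ⟨by linarith, hcon⟩
    obtain ⟨p, q⟩ := hd1 (τ₀ + r) ⟨by linarith, by linarith⟩
    rw [abs_lt] at p
    linarith [p.2]
  rw [abs_le]
  constructor <;> linarith

lemma fixed_point {k B : NNReal} (hF : LipschitzWith k F) (hg : LipschitzWith k g)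
    (bF : ∀ x, |F x| ≤ B) (bg : ∀ x, |g x| ≤ B) (H : LH F g G a b m K) {Y : ℝ}
    (hY0 : K < Y) (h1 : 2 * G b < (Y - K)^2) (h2 : 2 * K + m ≤ Y)
    (h3 : (Y - 2 * K - m)^2 + 2 * G b ≤ (Y - m)^2)
    (h4 : (K + m)^2 + 2 * G b ≤ (Y - m)^2) :
    ∃ x y τ, IsSol F g x y ∧ x 0 = 0 ∧ 0 < y 0 ∧ y 0 ≤ Y ∧ IsRet x y τ ∧ y τ = - y 0 := by
  have := fun c : ℝ => exist_global hF hg bF bg 0 c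
  choose X Z hsol hX0 hZ0 using this
  have hret : ∀ c : ℝ, ∃ τ, 0 < c → IsRet (X c) (Z c) τ := by
    intro c
    by_cases hc : 0 < c
    · obtain ⟨τ, hτ⟩ := exists_ret (hsol c) H (hX0 c) (by rw [hZ0]; exact hc)
      exact ⟨τ, fun _ => hτ⟩
    · exact ⟨0, fun h => absurd h hc⟩
  choose τ hτ using hret
  have hYp : 0 < Y := H.hK.trans hY0
  -- small value
  obtain ⟨s, hs0, hsY, hsG⟩ : ∃ s, 0 < s ∧ s ≤ Y ∧ s^2/2 + m * s < G a := by
    have hGa : 0 < G a := by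
      have := H.Gmono (by simp : (0:ℝ) ∈ Ici 0) H.ha.le H.ha
      rwa [H.G0] at this
    have hc : Continuous fun s : ℝ => s^2/2 + m * s := by fun_prop
    have hev : ∀ᶠ s in 𝓝 (0:ℝ), s^2/2 + m * s < G a :=
      hc.continuousAt.eventually_lt_const (by simpa using hGa)
    obtain ⟨ρ, hρ, hh⟩ := Metric.eventually_nhds_iff.1 hev
    refine ⟨min (ρ/2) Y, lt_min (by linarith) hYp, min_le_right _ _, hh ?_⟩
    have := lt_min (a := 0) (b := ρ/2) (c := Y) (by linarith) hYp
    have := min_le_left (ρ/2) Y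
    rw [Real.dist_eq, abs_lt]
    constructor <;> linarith
  have hcont : ContinuousOn (fun c => c + Z c (τ c)) (Icc s Y) := by
    apply continuousOn_id.add
    intro c hc
    have hc0 : 0 < c := hs0.trans_le hc.1
    rw [Metric.continuousWithinAt_iff]
    intro ε hε
    obtain ⟨ρ, hρ, hh⟩ := Metric.continuousAt_iff.1 ((hsol c).yc.continuousAt (x := τ c)) (ε/2)
      (by linarith)
    obtain ⟨δ, hδ, hd⟩ := ret_cont hF hg H (hsol c) (hX0 c) (by rw [hZ0]; exact hc0) (hτ c hc0)
      (ε := min (ρ/2) 1) (lt_min (by linarith) one_pos)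
    obtain ⟨C, hC, hdep⟩ := sol_dep hF hg (τ c + 1)
    refine ⟨min δ (ε/2/C), lt_min hδ (by positivity), ?_⟩
    intro e he hec
    have he0 : 0 < e := hs0.trans_le he.1
    rw [Real.dist_eq] at hec
    have hec1 := hec.trans_le (min_le_left _ _)
    have hec2 := hec.trans_le (min_le_right _ _)
    have q1 := hd (X e) (Z e) (τ e) (hsol e) (hX0 e) (hτ e he0) (by rw [hZ0, hZ0]; exact hec1)
    have q2 := q1.trans (min_le_left _ _)
    have q3 := abs_le.1 (q1.trans (min_le_right _ _))
    have q4 := (hdep _ _ _ _ (hsol e) (hsol c) (by rw [hX0, hX0]) (τ e)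
      ⟨(hτ e he0).pos.le, by linarith [q3.2]⟩).2
    rw [hZ0, hZ0] at q4
    have q5 : C * |e - c| < ε/2 := by
      rw [lt_div_iff₀ hC] at hec2
      linarith
    have q6 := hh (x := τ e) (by rw [Real.dist_eq]; linarith)
    rw [Real.dist_eq] at q6
    rw [Real.dist_eq]
    have := abs_sub_le (Z e (τ e)) (Z c (τ e)) (Z c (τ c))
    linarith
  have hlow := small_case (hsol s) H (hτ s hs0) (hX0 s) (by rw [hZ0]; exact hs0)
    (by rw [hZ0]; exact hsG)
  have hhigh := large_case (hsol Y) H (hτ Y hYp) (hX0 Y) (by rw [hZ0]; exact hY0)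
    (by rw [hZ0]; exact h1) (by rw [hZ0]; exact h2) (by rw [hZ0]; exact h3) (by rw [hZ0]; exact h4)
  rw [hZ0] at hlow hhigh
  obtain ⟨c, hc, hce⟩ := intermediate_value_Icc hsY hcont
    (show (0:ℝ) ∈ Icc _ _ from ⟨by linarith, by linarith⟩)
  have hc0 : 0 < c := hs0.trans_le hc.1
  refine ⟨X c, Z c, τ c, hsol c, hX0 c, by rw [hZ0]; exact hc0, by rw [hZ0]; exact hc.2,
    hτ c hc0, ?_⟩
  rw [hZ0]
  linarith

lemma antiperiodic {k : NNReal} (hF : LipschitzWith k F) (hg : LipschitzWith k g)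
    (oF : ∀ x, F (-x) = -F x) (og : ∀ x, g (-x) = - g x) {τ : ℝ} (h : IsSol F g x y)
    (hx0 : x 0 = 0) (hr : IsRet x y τ) (hy : y τ = - y 0) : ∀ t, x (t + τ) = - x t := by
  have h' : IsSol F g (fun t => - x (t + τ)) (fun t => - y (t + τ)) := by
    constructor
    · intro t
      have := ((h.hx (t + τ)).comp_add_const t τ).neg
      have e : -y (t + τ) - F (-x (t + τ)) = -(y (t + τ) - F (x (t + τ))) := by rw [oF]; ring
      rw [e]
      exact this
    · intro t
      have := ((h.hy (t + τ)).comp_add_const t τ).neg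
      rw [og]
      exact this
  obtain ⟨e1, -⟩ := sol_unique hF hg h h' (by simp [hx0, hr.x0]) (by simp [hy])
  intro t
  have := congrFun e1 t
  linarith

end PartC

open Set Filter Topology

/-- clamp to `[-M, M]` -/
def cl (M x : ℝ) : ℝ := max (-M) (min M x)

lemma cl_nonneg {M x : ℝ} (hM : 0 ≤ M) (hx : 0 ≤ x) : cl M x = min M x :=
  max_eq_right (by have := le_min hM hx; linarith)

lemma cl_of_abs {M x : ℝ} (h : |x| ≤ M) : cl M x = x := by
  rw [abs_le] at h
  rw [cl, min_eq_right h.2, max_eq_right h.1]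

lemma cl_neg (M x : ℝ) (hM : 0 ≤ M) : cl M (-x) = - cl M x := by
  simp only [cl]
  rcases le_total M x with h | h <;> rcases le_total (-M) x with h' | h'
  · rw [min_eq_left h, min_eq_right (by linarith), max_eq_left (by linarith),
      max_eq_right (by linarith)]
  · rw [min_eq_left h, min_eq_right (by linarith), max_eq_left (by linarith),
      max_eq_right (by linarith)]
  · rw [min_eq_right h, min_eq_right (by linarith), max_eq_right (by linarith),
      max_eq_right (by linarith)]
  · rw [min_eq_right h, min_eq_left (by linarith), max_eq_right (by linarith),
      max_eq_left (by linarith), neg_neg]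

lemma cl_mem {M : ℝ} (hM : 0 ≤ M) (x : ℝ) : cl M x ∈ Icc (-M) M :=
  ⟨le_max_left _ _, max_le (by linarith) (min_le_left _ _)⟩

lemma cl_lip (M : ℝ) : LipschitzWith 1 (cl M) :=
  (LipschitzWith.id.const_min M).const_max (-M)

lemma clamp_reg {h h' : ℝ → ℝ} (hd : ∀ x, HasDerivAt h (h' x) x) (hc : Continuous h') {M : ℝ}
    (hM : 0 ≤ M) : ∃ k B : NNReal, LipschitzWith k (fun x => h (cl M x)) ∧
      ∀ x, |h (cl M x)| ≤ B := by
  have hhc : Continuous h := continuous_iff_continuousAt.2 fun t => (hd t).continuousAt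
  obtain ⟨B, hB⟩ := isCompact_Icc.exists_bound_of_continuousOn (hhc.continuousOn (s := Icc (-M) M))
  obtain ⟨k, hk⟩ := isCompact_Icc.exists_bound_of_continuousOn (hc.continuousOn (s := Icc (-M) M))
  have hl : LipschitzOnWith k.toNNReal h (Icc (-M) M) := by
    apply (convex_Icc _ _).lipschitzOnWith_of_nnnorm_hasDerivWithin_le (f' := h')
    · intro x hx
      exact (hd x).hasDerivWithinAt
    · intro x hx
      rw [← NNReal.coe_le_coe, coe_nnnorm]
      exact (hk x hx).trans (Real.le_coe_toNNReal k)
  refine ⟨k.toNNReal, B.toNNReal, ?_, fun x => ?_⟩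
  · apply LipschitzWith.of_dist_le_mul
    intro x y
    refine (hl.dist_le_mul _ (cl_mem hM x) _ (cl_mem hM y)).trans ?_
    have := (cl_lip M).dist_le_mul x y
    simp only [NNReal.coe_one, one_mul] at this
    exact mul_le_mul_of_nonneg_left this k.toNNReal.2
  · exact (hB _ (cl_mem hM x)).trans (Real.le_coe_toNNReal B)

theorem lienard_existence
    (f g F : ℝ → ℝ) (a : ℝ)
    (hf : ContDiff ℝ 1 f) (hg : ContDiff ℝ 1 g)
    (hgodd : ∀ x, g (-x) = -g x)
    (hgpos : ∀ x : ℝ, x ≠ 0 → x * g x > 0)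
    (hF : ∀ x, F x = ∫ s in (0:ℝ)..x, f s)
    (hFodd : ∀ x, F (-x) = -F x)
    (hF0 : F 0 = 0)
    (hF'0 : deriv F 0 < 0)
    (ha : 0 < a) (hFa : F a = 0)
    (hauniq : ∀ x : ℝ, 0 < x → F x = 0 → x = a)
    (hmono : StrictMonoOn F (Set.Ici a))
    (hinf : Filter.Tendsto F Filter.atTop Filter.atTop) :
    ∃ T > (0:ℝ), ∃ x : ℝ → ℝ, ContDiff ℝ 2 x ∧ ¬ (∃ c, ∀ t, x t = c) ∧
      (∀ t, x (t + T) = x t) ∧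
      (∀ t, deriv (deriv x) t + f (x t) * deriv x t + g (x t) = 0) := by
  have hfc : Continuous f := hf.continuous
  have hgc : Continuous g := hg.continuous
  have hFd : ∀ x, HasDerivAt F (f x) x := by
    intro x
    have e : F = fun x => ∫ s in (0:ℝ)..x, f s := funext hF
    rw [e]
    exact intervalIntegral.integral_hasDerivAt_right (hfc.intervalIntegrable _ _)
      (hfc.stronglyMeasurableAtFilter _ _) hfc.continuousAt
  have hFc : Continuous F := continuous_iff_continuousAt.2 fun t => (hFd t).continuousAt
  have hgd : ∀ x, HasDerivAt g (deriv g x) x := fun x =>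
    (hg.differentiable (by norm_num) x).hasDerivAt
  have hgdc : Continuous (deriv g) := hg.continuous_deriv (by norm_num)
  have hgp : ∀ x, 0 < x → 0 < g x := fun x hx => by
    have := hgpos x hx.ne'
    exact (pos_iff_pos_of_mul_pos this).1 hx
  have hg0 : g 0 = 0 := by
    have := hgodd 0
    rw [neg_zero] at this
    linarith
  -- sign of F on (0,a)
  have hFneg : ∀ z, 0 < z → z < a → F z < 0 := by
    intro z hz hza
    by_contra hcon
    push Not at hcon
    obtain ⟨w, hw0, hwz, hFw⟩ : ∃ w, 0 < w ∧ w ≤ z ∧ F w < 0 := by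
      have hf0 : f 0 < 0 := by rw [← (hFd 0).deriv]; exact hF'0
      have hev : ∀ᶠ s in 𝓝 (0:ℝ), f s < 0 := hfc.continuousAt.eventually_lt_const hf0
      obtain ⟨ρ, hρ, hh⟩ := Metric.eventually_nhds_iff.1 hev
      have hr0 : 0 < min (ρ/2) z := lt_min (by linarith) hz
      have hr1 := min_le_left (ρ/2) z
      refine ⟨min (ρ/2) z, hr0, min_le_right _ _, ?_⟩
      have : StrictAntiOn F (Icc 0 (min (ρ/2) z)) := by
        apply strictAntiOn_of_deriv_neg (convex_Icc _ _) hFc.continuousOn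
        intro u hu
        rw [interior_Icc] at hu
        rw [(hFd u).deriv]
        apply hh
        rw [Real.dist_eq, abs_lt]
        constructor <;> linarith [hu.1, hu.2]
      have := this ⟨le_rfl, hr0.le⟩ ⟨hr0.le, le_rfl⟩ hr0
      rwa [hF0] at this
    obtain ⟨u, hu, hFu⟩ := intermediate_value_Icc hwz hFc.continuousOn ⟨hFw.le, hcon⟩
    have := hauniq u (hw0.trans_le hu.1) hFu
    linarith [hu.2]
  have hFnn : ∀ z, a ≤ z → 0 ≤ F z := fun z hz => by
    rw [← hFa]; exact hmono.monotoneOn (by simp) hz hz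
  obtain ⟨m, hm0, hm⟩ : ∃ m, 0 ≤ m ∧ ∀ z, 0 ≤ z → -m ≤ F z := by
    obtain ⟨s, hs, hmin⟩ := isCompact_Icc.exists_isMinOn (nonempty_Icc.2 ha.le) hFc.continuousOn
    have h0 : F s ≤ F 0 := hmin ⟨le_rfl, ha.le⟩
    refine ⟨-F s, by linarith, fun z hz => ?_⟩
    rcases le_total z a with h | h
    · have : F s ≤ F z := hmin ⟨hz, h⟩
      linarith
    · linarith [hFnn z h]
  set b := a + 1 with hb
  set K := F b with hK
  have hab : a ≤ b := by linarith
  have hb0 : 0 < b := by linarith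
  have hKpos : 0 < K := by
    have := hmono (by simp : a ∈ Ici a) (by simpa using hab : b ∈ Ici a) (by linarith)
    linarith
  have hFK1 : ∀ z, 0 ≤ z → z ≤ b → F z ≤ K := by
    intro z hz hzb
    rcases le_total a z with h | h
    · exact hmono.monotoneOn h (by simpa using hab) hzb
    · rcases hz.eq_or_lt with e | e
      · rw [← e, hF0]; exact hKpos.le
      rcases h.eq_or_lt with e' | e'
      · rw [e', hFa]; exact hKpos.le
      · linarith [hFneg z e e']
  have hFK2 : ∀ z, b ≤ z → K ≤ F z := fun z hz =>
    hmono.monotoneOn (by simpa using hab) (by simpa using hab.trans hz) hz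
  set γ := ∫ s in (0:ℝ)..b, g s with hγ
  set Y := 2*K + 2*m + 1 + 2*|γ| + |γ|/(2*K) with hY
  have hq0 : 0 ≤ |γ|/(2*K) := by positivity
  have hγ0 := abs_nonneg γ
  have hγ1 := le_abs_self γ
  have hq1 : K * (|γ|/(2*K)) = |γ|/2 := by field_simp
  have y0 : K < Y := by linarith
  have y1 : 2 * γ < (Y - K)^2 := by nlinarith
  have y2 : 2 * K + m ≤ Y := by linarith
  have y3 : (Y - 2 * K - m)^2 + 2 * γ ≤ (Y - m)^2 := by
    have e : (Y - m)^2 - (Y - 2 * K - m)^2 = 4 * (K * (Y - K - m)) := by ring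
    have : K * (|γ|/(2*K)) ≤ K * (Y - K - m) := by
      apply mul_le_mul_of_nonneg_left _ hKpos.le; linarith
    linarith
  have y4 : (K + m)^2 + 2 * γ ≤ (Y - m)^2 := by
    have : (K + m + (1 + 2*|γ|))^2 ≤ (Y - m)^2 := by
      apply pow_le_pow_left₀ (by positivity); linarith
    nlinarith [mul_nonneg (add_nonneg hKpos.le hm0) hγ0]
  obtain ⟨M, hMb, hMY⟩ := ((eventually_ge_atTop b).and (hinf.eventually_ge_atTop Y)).exists
  have hM0 : 0 ≤ M := hb0.le.trans hMb
  obtain ⟨k1, B1, hl1, hB1⟩ := clamp_reg hFd hfc hM0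
  obtain ⟨k2, B2, hl2, hB2⟩ := clamp_reg hgd hgdc hM0
  replace hl1 := hl1.weaken (le_max_left k1 k2)
  replace hl2 := hl2.weaken (le_max_right k1 k2)
  have hB1' : ∀ x, |F (cl M x)| ≤ (max B1 B2 : NNReal) := fun x =>
    (hB1 x).trans (by exact_mod_cast le_max_left B1 B2)
  have hB2' : ∀ x, |g (cl M x)| ≤ (max B1 B2 : NNReal) := fun x =>
    (hB2 x).trans (by exact_mod_cast le_max_right B1 B2)
  have hGb : ∫ s in (0:ℝ)..b, g (cl M s) = γ := by
    apply intervalIntegral.integral_congr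
    intro s hs
    rw [uIcc_of_le hb0.le] at hs
    beta_reduce
    rw [cl_of_abs (abs_le.2 ⟨by linarith [hs.1], hs.2.trans hMb⟩)]
  have H : LH (fun x => F (cl M x)) (fun x => g (cl M x))
      (fun x => ∫ s in (0:ℝ)..x, g (cl M s)) a b m K := by
    have small : ∀ z, 0 ≤ z → z ≤ b → cl M z = z := fun z hz hzb =>
      cl_of_abs (abs_le.2 ⟨by linarith, hzb.trans hMb⟩)
    constructor
    · exact ha
    · exact hab
    · exact hm0
    · exact hKpos
    · exact hl1.continuous
    · exact hl2.continuous
    · rw [small 0 le_rfl hb0.le, hF0]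
    · rw [small a ha.le hab, hFa]
    · intro z hz hza
      rw [small z hz.le (by linarith)]
      exact hFneg z hz hza
    · intro z hz
      rw [cl_nonneg hM0 hz]
      exact hm _ (le_min hM0 hz)
    · intro z hz hzb
      rw [small z hz hzb]
      exact hFK1 z hz hzb
    · intro z hz
      rw [cl_nonneg hM0 (hb0.le.trans hz)]
      exact hFK2 _ (le_min hMb hz)
    · rw [small 0 le_rfl hb0.le, hg0]
    · intro η hη
      have hM' : 0 < M := hb0.trans_le hMb
      obtain ⟨s, hs, hmin⟩ := isCompact_Icc.exists_isMinOn
        (nonempty_Icc.2 (min_le_left M η)) hgc.continuousOn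
      refine ⟨g s, hgp s ((lt_min hM' hη).trans_le hs.1), fun z hz => ?_⟩
      rw [cl_nonneg hM0 (hη.le.trans hz)]
      exact hmin ⟨min_le_min_left M hz, min_le_left _ _⟩
    · simp
    · intro z
      have hc := hl2.continuous
      exact intervalIntegral.integral_hasDerivAt_right (hc.intervalIntegrable _ _)
        (hc.stronglyMeasurableAtFilter _ _) hc.continuousAt
  obtain ⟨x, y, τ, hsol, hx0, hy0, hyY, hret, hyτ⟩ := fixed_point hl1 hl2 hB1' hB2' H y0
    (by rw [hGb]; exact y1) y2 (by rw [hGb]; exact y3) (by rw [hGb]; exact y4)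
  have hanti := antiperiodic hl1 hl2 (fun z => by rw [cl_neg M z hM0, hFodd])
    (fun z => by rw [cl_neg M z hM0, hgodd]) hsol hx0 hret hyτ
  have hτ := hret.pos
  have hxM : ∀ t ∈ Icc 0 τ, x t ≤ M := by
    intro t ht
    have := barrier (u := fun t => - x t) (fun s => (hsol.hx s).neg) ht.1 (η := -M)
      (by simp [hx0, hM0]) (fun s hs hxs => by
        have h1 : y s ≤ y 0 := (hsol.y_anti H hret.xpos).antitoneOn ⟨le_rfl, hτ.le⟩
          ⟨hs.1, hs.2.trans ht.2⟩ hs.1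
        have h2 : M ≤ x s := by linarith
        rw [cl_nonneg hM0 (hM0.trans h2), min_eq_left h2]
        linarith)
    linarith
  have hxabs : ∀ t, |x t| ≤ M := by
    have hper : Function.Periodic (fun t => |x t|) τ := fun t => by
      simp only [hanti, abs_neg]
    intro t
    obtain ⟨s, hs, e⟩ := hper.exists_mem_Ico₀ hτ t
    rw [e, abs_of_nonneg (hret.xnn hx0 ⟨hs.1, hs.2.le⟩)]
    exact hxM s ⟨hs.1, hs.2.le⟩
  have hx : ∀ t, HasDerivAt x (y t - F (x t)) t := fun t => by
    have := hsol.hx t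
    simp only [cl_of_abs (hxabs t)] at this
    exact this
  have hy : ∀ t, HasDerivAt y (-g (x t)) t := fun t => by
    have := hsol.hy t
    simp only [cl_of_abs (hxabs t)] at this
    exact this
  have hdx : deriv x = fun t => y t - F (x t) := funext fun t => (hx t).deriv
  have hxx : ∀ t, HasDerivAt (deriv x) (-g (x t) - f (x t) * (y t - F (x t))) t := fun t => by
    rw [hdx]
    exact (hy t).sub ((hFd (x t)).comp t (hx t))
  have hxc := hsol.xc
  have hyc := hsol.yc
  refine ⟨2 * τ, by linarith, x, ?_, ?_, ?_, ?_⟩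
  · have h1 : ContDiff ℝ 1 (deriv x) := by
      rw [contDiff_one_iff_deriv]
      refine ⟨fun t => (hxx t).differentiableAt, ?_⟩
      have : deriv (deriv x) = fun t => -g (x t) - f (x t) * (y t - F (x t)) :=
        funext fun t => (hxx t).deriv
      rw [this]
      fun_prop
    rw [show (2 : WithTop ℕ∞) = 1 + 1 by norm_num, contDiff_succ_iff_deriv]
    exact ⟨fun t => (hx t).differentiableAt, by simp, h1⟩
  · rintro ⟨c, hc⟩
    have h1 := hret.xpos (τ/2) ⟨by linarith, by linarith⟩
    rw [hc, ← hc 0, hx0] at h1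
    exact lt_irrefl _ h1
  · intro t
    rw [show t + 2 * τ = (t + τ) + τ by ring, hanti, hanti, neg_neg]
  · intro t
    rw [(hxx t).deriv, hdx]
    ring
end

section
/- Let f, g : ℝ → ℝ be continuously differentiable, with g odd, x·g(x) > 0 for all x ≠ 0, and let F(x) = ∫₀^x f(s) ds. Assume F is odd, F(0) = 0, F'(0) < 0, F has a unique positive zero at some a > 0, and F is strictly monotonically increasing and tends to +∞ on [a, ∞). Then the nonconstant periodic orbit of x'' + f(x)·x' + g(x) = 0 is unique: if x₁ and x₂ are two nonconstant periodic solutions, then the curves {(x₁(t), x₁'(t)) : t ∈ ℝ} and {(x₂(t), x₂'(t)) : t ∈ ℝ} coincide as subsets of the plane. -/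
namespace Lienard

open Set Filter Topology

lemma pos_of_ne {d : ℝ → ℝ} {s e c : ℝ} (hd : ContinuousOn d (Icc s e))
    (hne : ∀ t ∈ Icc s e, d t ≠ 0) (hc : c ∈ Icc s e) (hpos : 0 < d c) :
    ∀ t ∈ Icc s e, 0 < d t := by
  intro t ht
  by_contra hcon
  have hle : d t ≤ 0 := not_lt.mp hcon
  have hsub : uIcc t c ⊆ Icc s e := by
    intro r hr
    rw [mem_uIcc] at hr
    rcases hr with h | h
    · exact ⟨ht.1.trans h.1, h.2.trans hc.2⟩
    · exact ⟨hc.1.trans h.1, h.2.trans ht.2⟩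
  have := intermediate_value_uIcc (hd.mono hsub)
  obtain ⟨r, hr, hr0⟩ := this (show (0:ℝ) ∈ uIcc (d t) (d c) from by
    rw [mem_uIcc]; exact Or.inl ⟨hle, hpos.le⟩)
  exact hne r (hsub hr) hr0

lemma inv_exists {u : ℝ → ℝ} {s e : ℝ} (hse : s ≤ e) (hu : ContinuousOn u (Icc s e))
    (hm : StrictMonoOn u (Icc s e)) :
    ∃ τ : ℝ → ℝ, ContinuousOn τ (Icc (u s) (u e)) ∧
      (∀ y ∈ Icc (u s) (u e), τ y ∈ Icc s e ∧ u (τ y) = y) := by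
  have hex : ∀ y : Icc (u s) (u e), ∃ r : Icc s e, u r = y := by
    intro y
    obtain ⟨r, hr, hry⟩ := intermediate_value_Icc hse hu y.2
    exact ⟨⟨r, hr⟩, hry⟩
  choose τ hτ using hex
  have hmono : Monotone τ := by
    intro y₁ y₂ h
    by_contra hlt
    have := hm (τ y₂).2 (τ y₁).2 (not_le.mp hlt)
    rw [hτ, hτ] at this
    exact absurd (Subtype.coe_le_coe.mpr h) (not_le.mpr this)
  have hsurj : Function.Surjective τ := by
    intro r
    refine ⟨⟨u r, hm.monotoneOn (left_mem_Icc.mpr hse) r.2 r.2.1,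
      hm.monotoneOn r.2 (right_mem_Icc.mpr hse) r.2.2⟩, ?_⟩
    apply Subtype.ext
    apply hm.injOn (τ _).2 r.2
    rw [hτ]
  have hcont : Continuous τ := hmono.continuous_of_surjective hsurj
  have hue : u s ≤ u e := hm.monotoneOn (left_mem_Icc.mpr hse) (right_mem_Icc.mpr hse) hse
  refine ⟨fun y => (τ (projIcc (u s) (u e) hue y) : ℝ), ?_, ?_⟩
  · exact (continuous_subtype_val.comp (hcont.comp continuous_projIcc)).continuousOn
  · intro y hy
    refine ⟨(τ _).2, ?_⟩
    rw [hτ, projIcc_of_mem _ hy]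

/-- Matching map between two strictly increasing parametrizations. -/
lemma match_exists {u₁ u₂ : ℝ → ℝ} {s₁ e₁ s₂ e₂ : ℝ} (h₁ : s₁ ≤ e₁) (h₂ : s₂ ≤ e₂)
    (hc₁ : ContinuousOn u₁ (Icc s₁ e₁)) (hm₁ : StrictMonoOn u₁ (Icc s₁ e₁))
    (hc₂ : ContinuousOn u₂ (Icc s₂ e₂)) (hm₂ : StrictMonoOn u₂ (Icc s₂ e₂))
    (hs : u₁ s₁ = u₂ s₂) (he : u₁ e₁ = u₂ e₂) :
    ∃ φ : ℝ → ℝ, ContinuousOn φ (Icc s₁ e₁) ∧ (∀ t ∈ Icc s₁ e₁, φ t ∈ Icc s₂ e₂) ∧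
      (∀ t ∈ Icc s₁ e₁, u₂ (φ t) = u₁ t) ∧ φ s₁ = s₂ ∧ φ e₁ = e₂ ∧
      (∀ t ∈ Ioo s₁ e₁, φ t ∈ Ioo s₂ e₂) ∧
      (∀ t ∈ Ioo s₁ e₁, ∀ d₁ d₂ : ℝ, HasDerivAt u₁ d₁ t → HasDerivAt u₂ d₂ (φ t) → d₂ ≠ 0 →
        HasDerivAt φ (d₂⁻¹ * d₁) t) := by
  obtain ⟨τ, hτc, hτ⟩ := inv_exists h₂ hc₂ hm₂
  have hl₁ := left_mem_Icc.mpr h₁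
  have hr₁ := right_mem_Icc.mpr h₁
  have hl₂ := left_mem_Icc.mpr h₂
  have hr₂ := right_mem_Icc.mpr h₂
  have hmaps : ∀ t ∈ Icc s₁ e₁, u₁ t ∈ Icc (u₂ s₂) (u₂ e₂) := by
    intro t ht
    rw [← hs, ← he]
    exact ⟨hm₁.monotoneOn hl₁ ht ht.1, hm₁.monotoneOn ht hr₁ ht.2⟩
  have hmaps' : ∀ t ∈ Ioo s₁ e₁, u₁ t ∈ Ioo (u₂ s₂) (u₂ e₂) := by
    intro t ht
    rw [← hs, ← he]
    have ht' := Ioo_subset_Icc_self ht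
    exact ⟨hm₁ hl₁ ht' ht.1, hm₁ ht' hr₁ ht.2⟩
  have A : ∀ t ∈ Icc s₁ e₁, τ (u₁ t) ∈ Icc s₂ e₂ := fun t ht => (hτ _ (hmaps t ht)).1
  have B : ∀ t ∈ Icc s₁ e₁, u₂ (τ (u₁ t)) = u₁ t := fun t ht => (hτ _ (hmaps t ht)).2
  have C : τ (u₁ s₁) = s₂ := hm₂.injOn (A _ hl₁) hl₂ (by rw [B _ hl₁, hs])
  have D : τ (u₁ e₁) = e₂ := hm₂.injOn (A _ hr₁) hr₂ (by rw [B _ hr₁, he])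
  refine ⟨fun t => τ (u₁ t), hτc.comp hc₁ hmaps, A, B, C, D, ?_, ?_⟩
  · intro t ht
    have ht' := Ioo_subset_Icc_self ht
    refine ⟨lt_of_le_of_ne (A t ht').1 ?_, lt_of_le_of_ne (A t ht').2 ?_⟩
    · intro h
      have := B t ht'
      change s₂ = τ (u₁ t) at h
      rw [← h] at this
      exact absurd (hmaps' t ht).1 (by rw [this]; exact lt_irrefl _)
    · intro h
      have := B t ht'
      change τ (u₁ t) = e₂ at h
      rw [h] at this
      exact absurd (hmaps' t ht).2 (by rw [this]; exact lt_irrefl _)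
  · intro t ht d₁ d₂ hd₁ hd₂ hne
    have hn : Icc (u₂ s₂) (u₂ e₂) ∈ 𝓝 (u₁ t) := Icc_mem_nhds (hmaps' t ht).1 (hmaps' t ht).2
    have hinv : HasDerivAt τ d₂⁻¹ (u₁ t) :=
      HasDerivAt.of_local_left_inverse (hτc.continuousAt hn) hd₂ hne
        (by filter_upwards [hn] with y hy using (hτ y hy).2)
    exact hinv.comp t hd₁

lemma strictMono_of_hasDeriv {u u' : ℝ → ℝ} {s e : ℝ} (hd : ∀ t, HasDerivAt u (u' t) t)
    (hp : ∀ t ∈ Ioo s e, 0 < u' t) : StrictMonoOn u (Icc s e) := by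
  apply strictMonoOn_of_deriv_pos (convex_Icc s e)
  · exact fun t _ => (hd t).continuousAt.continuousWithinAt
  · intro t ht
    rw [interior_Icc] at ht
    rw [(hd t).deriv]; exact hp t ht

/-- Comparison of the variation of `E₁` and `E₂` along matched parametrizations. -/
lemma compare {u₁ u₂ u₁' u₂' E₁ E₂ E₁' E₂' : ℝ → ℝ} {s₁ e₁ s₂ e₂ : ℝ}
    (h₁ : s₁ ≤ e₁) (h₂ : s₂ ≤ e₂)
    (hu₁ : ∀ t, HasDerivAt u₁ (u₁' t) t) (hu₂ : ∀ t, HasDerivAt u₂ (u₂' t) t)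
    (hE₁ : ∀ t, HasDerivAt E₁ (E₁' t) t) (hE₂ : ∀ t, HasDerivAt E₂ (E₂' t) t)
    (hp₁ : ∀ t ∈ Ioo s₁ e₁, 0 < u₁' t) (hp₂ : ∀ t ∈ Ioo s₂ e₂, 0 < u₂' t)
    (hs : u₁ s₁ = u₂ s₂) (he : u₁ e₁ = u₂ e₂)
    (hcmp : ∀ t₁ ∈ Ioo s₁ e₁, ∀ t₂ ∈ Ioo s₂ e₂, u₁ t₁ = u₂ t₂ →
      E₂' t₂ * u₁' t₁ ≤ E₁' t₁ * u₂' t₂) :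
    E₂ e₂ - E₁ e₁ ≤ E₂ s₂ - E₁ s₁ := by
  have hm₁ := strictMono_of_hasDeriv hu₁ hp₁
  have hm₂ := strictMono_of_hasDeriv hu₂ hp₂
  obtain ⟨φ, hφc, hφm, hφe, hφs, hφe', hφo, hφd⟩ := match_exists h₁ h₂
    (fun t _ => (hu₁ t).continuousAt.continuousWithinAt) hm₁
    (fun t _ => (hu₂ t).continuousAt.continuousWithinAt) hm₂ hs he
  have hE₂c : Continuous E₂ := continuous_iff_continuousAt.mpr fun t => (hE₂ t).continuousAt
  have hE₁c : Continuous E₁ := continuous_iff_continuousAt.mpr fun t => (hE₁ t).continuousAt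
  have hder : ∀ t ∈ Ioo s₁ e₁, HasDerivAt (fun t => E₂ (φ t) - E₁ t)
      (E₂' (φ t) * ((u₂' (φ t))⁻¹ * u₁' t) - E₁' t) t := by
    intro t ht
    have := hφd t ht _ _ (hu₁ t) (hu₂ _) (hp₂ _ (hφo t ht)).ne'
    exact ((hE₂ (φ t)).comp t this).sub (hE₁ t)
  have hanti : AntitoneOn (fun t => E₂ (φ t) - E₁ t) (Icc s₁ e₁) := by
    apply antitoneOn_of_deriv_nonpos (convex_Icc _ _)
    · exact (hE₂c.comp_continuousOn hφc).sub hE₁c.continuousOn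
    · rw [interior_Icc]
      exact fun t ht => (hder t ht).differentiableAt.differentiableWithinAt
    · rw [interior_Icc]
      intro t ht
      rw [(hder t ht).deriv]
      have hpos := hp₂ _ (hφo t ht)
      have := hcmp t ht _ (hφo t ht) (hφe t (Ioo_subset_Icc_self ht)).symm
      have h2 : E₂' (φ t) * ((u₂' (φ t))⁻¹ * u₁' t) = (E₂' (φ t) * u₁' t) / u₂' (φ t) := by
        field_simp
      rw [h2, sub_nonpos, div_le_iff₀ hpos]
      exact this
  have := hanti (left_mem_Icc.mpr h₁) (right_mem_Icc.mpr h₁) h₁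
  simpa [hφs, hφe'] using this

/-- Order is preserved along matched parametrizations if the curves do not meet. -/
lemma order_of_ne {u₁ u₂ u₁' u₂' v₁ v₂ : ℝ → ℝ} {s₁ e₁ s₂ e₂ c₁ c₂ : ℝ}
    (h₁ : s₁ ≤ e₁) (h₂ : s₂ ≤ e₂)
    (hu₁ : ∀ t, HasDerivAt u₁ (u₁' t) t) (hu₂ : ∀ t, HasDerivAt u₂ (u₂' t) t)
    (hv₁ : Continuous v₁) (hv₂ : Continuous v₂)
    (hp₁ : ∀ t ∈ Ioo s₁ e₁, 0 < u₁' t) (hp₂ : ∀ t ∈ Ioo s₂ e₂, 0 < u₂' t)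
    (hs : u₁ s₁ = u₂ s₂) (he : u₁ e₁ = u₂ e₂)
    (hne : ∀ t₁ ∈ Icc s₁ e₁, ∀ t₂ ∈ Icc s₂ e₂, u₁ t₁ = u₂ t₂ → v₁ t₁ ≠ v₂ t₂)
    (hc₁ : c₁ ∈ Icc s₁ e₁) (hc₂ : c₂ ∈ Icc s₂ e₂) (hc : u₁ c₁ = u₂ c₂) (hlt : v₁ c₁ < v₂ c₂) :
    ∀ t₁ ∈ Icc s₁ e₁, ∀ t₂ ∈ Icc s₂ e₂, u₁ t₁ = u₂ t₂ → v₁ t₁ < v₂ t₂ := by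
  have hm₁ := strictMono_of_hasDeriv hu₁ hp₁
  have hm₂ := strictMono_of_hasDeriv hu₂ hp₂
  obtain ⟨φ, hφc, hφm, hφe, hφs, hφe', hφo, hφd⟩ := match_exists h₁ h₂
    (fun t _ => (hu₁ t).continuousAt.continuousWithinAt) hm₁
    (fun t _ => (hu₂ t).continuousAt.continuousWithinAt) hm₂ hs he
  have key : ∀ t₁ ∈ Icc s₁ e₁, ∀ t₂ ∈ Icc s₂ e₂, u₁ t₁ = u₂ t₂ → φ t₁ = t₂ := by
    intro t₁ ht₁ t₂ ht₂ h
    exact hm₂.injOn (hφm _ ht₁) ht₂ (by rw [hφe _ ht₁, h])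
  have := pos_of_ne (d := fun t => v₂ (φ t) - v₁ t)
    ((hv₂.comp_continuousOn hφc).sub hv₁.continuousOn)
    (fun t ht => sub_ne_zero.mpr (hne t ht _ (hφm t ht) (hφe t ht).symm).symm)
    hc₁ (by rw [key _ hc₁ _ hc₂ hc]; linarith)
  intro t₁ ht₁ t₂ ht₂ h
  have h3 := this t₁ ht₁
  simp only [key _ ht₁ _ ht₂ h] at h3
  linarith

/-- Standing assumptions, in a convenient form. -/
structure Hyp (f F g G : ℝ → ℝ) (a : ℝ) : Prop where
  dF : ∀ x, HasDerivAt F (f x) x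
  dG : ∀ x, HasDerivAt G (g x) x
  cf : Continuous f
  cF : ContDiff ℝ 1 F
  cg : ContDiff ℝ 1 g
  Fodd : ∀ x, F (-x) = -F x
  godd : ∀ x, g (-x) = -g x
  gpos : ∀ x, 0 < x → 0 < g x
  Fneg : ∀ x, 0 < x → x < a → F x < 0
  mono : StrictMonoOn F (Ici a)
  apos : 0 < a
  Fa : F a = 0

/-- Periodic solutions in the Liénard plane. -/
structure PS (F g x z : ℝ → ℝ) : Prop where
  dx : ∀ t, HasDerivAt x (z t - F (x t)) t
  dz : ∀ t, HasDerivAt z (-g (x t)) t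
  per : ∃ T, 0 < T ∧ (∀ t, x (t + T) = x t) ∧ (∀ t, z (t + T) = z t)

/-- An arc in the right half plane. -/
structure Arc (x z : ℝ → ℝ) (s e : ℝ) : Prop where
  lt : s < e
  xs : x s = 0
  xe : x e = 0
  pos : ∀ t ∈ Ioo s e, 0 < x t
  zs : 0 < z s
  ze : z e < 0

variable {f F g G x z x₁ z₁ x₂ z₂ : ℝ → ℝ} {a : ℝ}

lemma Hyp.F0 (H : Hyp f F g G a) : F 0 = 0 := by
  have := H.Fodd 0
  simp at this; linarith

lemma Hyp.g0 (H : Hyp f F g G a) : g 0 = 0 := by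
  have := H.godd 0
  simp at this; linarith

lemma Hyp.Fpos (H : Hyp f F g G a) {y : ℝ} (hy : a < y) : 0 < F y := by
  have := H.mono (show a ∈ Ici a from le_refl a) (show y ∈ Ici a from hy.le) hy
  rwa [H.Fa] at this

lemma PS.cx (S : PS F g x z) : Continuous x :=
  continuous_iff_continuousAt.mpr fun t => (S.dx t).continuousAt

lemma PS.cz (S : PS F g x z) : Continuous z :=
  continuous_iff_continuousAt.mpr fun t => (S.dz t).continuousAt

lemma PS.neg (H : Hyp f F g G a) (S : PS F g x z) :
    PS F g (fun t => -x t) (fun t => -z t) where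
  dx t := by
    have := (S.dx t).neg
    rw [H.Fodd]
    have e : -z t - -F (x t) = -(z t - F (x t)) := by ring
    rw [e]
    exact this
  dz t := by
    have := (S.dz t).neg
    rw [H.godd]
    exact this
  per := by
    obtain ⟨T, hT, h1, h2⟩ := S.per
    exact ⟨T, hT, fun t => by rw [h1], fun t => by rw [h2]⟩

lemma bounded_of_periodic {y : ℝ → ℝ} {T : ℝ} (hT : 0 < T) (hc : Continuous y)
    (hp : ∀ t, y (t + T) = y t) : ∃ R, ∀ t, |y t| ≤ R := by
  obtain ⟨R, hR⟩ := isCompact_Icc.exists_bound_of_continuousOn (s := Icc 0 (0 + T))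
    hc.continuousOn
  refine ⟨R, fun t => ?_⟩
  have hper : Function.Periodic y T := hp
  obtain ⟨r, hr, hrt⟩ := hper.exists_mem_Ico₀ hT t
  rw [hrt]
  exact hR r ⟨hr.1, by linarith [hr.2]⟩

lemma PS.bdd (S : PS F g x z) : ∃ R, ∀ t, |x t| ≤ R ∧ |z t| ≤ R := by
  obtain ⟨T, hT, h1, h2⟩ := S.per
  obtain ⟨R₁, hR₁⟩ := bounded_of_periodic hT S.cx h1
  obtain ⟨R₂, hR₂⟩ := bounded_of_periodic hT S.cz h2
  exact ⟨max R₁ R₂, fun t => ⟨(hR₁ t).trans (le_max_left _ _), (hR₂ t).trans (le_max_right _ _)⟩⟩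

lemma PS.unique (H : Hyp f F g G a) (S₁ : PS F g x₁ z₁) (S₂ : PS F g x₂ z₂) {s₁ s₂ : ℝ}
    (hx : x₁ s₁ = x₂ s₂) (hz : z₁ s₁ = z₂ s₂) :
    ∀ t, x₁ (t + s₁) = x₂ (t + s₂) ∧ z₁ (t + s₁) = z₂ (t + s₂) := by
  obtain ⟨R₁, hR₁⟩ := S₁.bdd
  obtain ⟨R₂, hR₂⟩ := S₂.bdd
  let R := max R₁ R₂
  let v : ℝ → ℝ × ℝ → ℝ × ℝ := fun _ p => (p.2 - F p.1, -g p.1)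
  let K : Set (ℝ × ℝ) := Icc (-R) R ×ˢ Icc (-R) R
  have hv : ContDiff ℝ 1 (fun p : ℝ × ℝ => (p.2 - F p.1, -g p.1)) :=
    (contDiff_snd.sub (H.cF.comp contDiff_fst)).prodMk (H.cg.comp contDiff_fst).neg
  obtain ⟨L, hL⟩ := LocallyLipschitzOn.exists_lipschitzOnWith_of_compact
    (s := K) (isCompact_Icc.prod isCompact_Icc) (hv.locallyLipschitz.locallyLipschitzOn)
  have key : (fun t => (x₁ (t + s₁), z₁ (t + s₁))) = (fun t => (x₂ (t + s₂), z₂ (t + s₂))) := by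
    apply ODE_solution_unique_univ (v := v) (s := fun _ => K) (K := L) (t₀ := 0)
    · intro t; exact hL
    · intro t
      refine ⟨((S₁.dx (t + s₁)).comp_add_const t s₁).prodMk
        ((S₁.dz (t + s₁)).comp_add_const t s₁), ?_, ?_⟩
      · exact abs_le.mp ((hR₁ _).1.trans (le_max_left _ _))
      · exact abs_le.mp ((hR₁ _).2.trans (le_max_left _ _))
    · intro t
      refine ⟨((S₂.dx (t + s₂)).comp_add_const t s₂).prodMk
        ((S₂.dz (t + s₂)).comp_add_const t s₂), ?_, ?_⟩
      · exact abs_le.mp ((hR₂ _).1.trans (le_max_right _ _))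
      · exact abs_le.mp ((hR₂ _).2.trans (le_max_right _ _))
    · simp [hx, hz]
  intro t
  have := congrFun key t
  simpa using this

/-- Two arcs which meet have the same starting point. -/
lemma nocross (H : Hyp f F g G a) (S₁ : PS F g x₁ z₁) (S₂ : PS F g x₂ z₂) {s₁ e₁ s₂ e₂ : ℝ}
    (A₁ : Arc x₁ z₁ s₁ e₁) (A₂ : Arc x₂ z₂ s₂ e₂) {t₁ t₂ : ℝ} (h₁ : t₁ ∈ Ioc s₁ e₁)
    (h₂ : t₂ ∈ Ioc s₂ e₂) (hx : x₁ t₁ = x₂ t₂) (hz : z₁ t₁ = z₂ t₂) : z₁ s₁ = z₂ s₂ := by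
  have U := S₁.unique H S₂ hx hz
  have heq : s₁ - t₁ = s₂ - t₂ := by
    rcases lt_trichotomy (s₁ - t₁) (s₂ - t₂) with h | h | h
    · exfalso
      have h3 := (U (s₂ - t₂)).1
      have h4 := A₁.pos (s₂ - t₂ + t₁) ⟨by linarith, by linarith [h₁.2, h₂.1]⟩
      rw [h3, sub_add_cancel, A₂.xs] at h4
      exact lt_irrefl _ h4
    · exact h
    · exfalso
      have h3 := (U (s₁ - t₁)).1
      have h4 := A₂.pos (s₁ - t₁ + t₂) ⟨by linarith, by linarith [h₂.2, h₁.1]⟩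
      rw [← h3, sub_add_cancel, A₁.xs] at h4
      exact lt_irrefl _ h4
  have := (U (s₁ - t₁)).2
  rw [sub_add_cancel, heq, sub_add_cancel] at this
  exact this

lemma Arc.nonneg {s e : ℝ} (A : Arc x z s e) {t : ℝ} (ht : t ∈ Icc s e) : 0 ≤ x t := by
  rcases eq_or_lt_of_le ht.1 with h | h
  · rw [← h, A.xs]
  · rcases eq_or_lt_of_le ht.2 with h' | h'
    · rw [h', A.xe]
    · exact (A.pos t ⟨h, h'⟩).le

lemma PS.dnz (S : PS F g x z) (t : ℝ) : HasDerivAt (fun t => -z t) (g (x t)) t := by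
  have := (S.dz t).neg
  rw [neg_neg] at this
  exact this

lemma Arc.antiz (H : Hyp f F g G a) (S : PS F g x z) {s e : ℝ} (A : Arc x z s e) :
    StrictAntiOn z (Icc s e) := by
  have := strictMono_of_hasDeriv S.dnz (fun t ht => H.gpos _ (A.pos t ht))
  intro r hr t ht h
  have := this hr ht h
  simp only at this
  linarith

/-- Arcs are nested. -/
lemma nested (H : Hyp f F g G a) (S₁ : PS F g x₁ z₁) (S₂ : PS F g x₂ z₂) {s₁ e₁ s₂ e₂ : ℝ}
    (A₁ : Arc x₁ z₁ s₁ e₁) (A₂ : Arc x₂ z₂ s₂ e₂) (hlt : z₁ s₁ < z₂ s₂) : z₂ e₂ < z₁ e₁ := by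
  by_contra hcon
  push Not at hcon
  obtain ⟨c, hc, hcz⟩ := intermediate_value_Icc' A₂.lt.le S₂.cz.continuousOn
    (show z₁ s₁ ∈ Icc (z₂ e₂) (z₂ s₂) from ⟨by linarith [A₂.ze, A₁.zs], hlt.le⟩)
  obtain ⟨d, hd, hdz⟩ := intermediate_value_Icc' A₁.lt.le S₁.cz.continuousOn
    (show z₂ e₂ ∈ Icc (z₁ e₁) (z₁ s₁) from ⟨hcon, by linarith [A₂.ze, A₁.zs]⟩)
  have hc1 : s₂ < c := lt_of_le_of_ne hc.1 (by rintro rfl; linarith)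
  have hc2 : c < e₂ := lt_of_le_of_ne hc.2 (by rintro rfl; linarith [A₂.ze, A₁.zs])
  have := order_of_ne (v₁ := x₁) (v₂ := x₂) hd.1 hc.2 S₁.dnz S₂.dnz S₁.cx S₂.cx
    (fun t ht => H.gpos _ (A₁.pos t ⟨ht.1, ht.2.trans_le hd.2⟩))
    (fun t ht => H.gpos _ (A₂.pos t ⟨hc1.trans ht.1, ht.2⟩))
    (by simp [hcz]) (by simp [hdz])
    (by
      intro t₁ ht₁ t₂ ht₂ hz hx
      have hz' : z₁ t₁ = z₂ t₂ := by linarith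
      rcases eq_or_lt_of_le ht₁.1 with h | h
      · subst h
        rw [A₁.xs] at hx
        rcases eq_or_lt_of_le ht₂.2 with h' | h'
        · subst h'
          linarith [A₂.ze, A₁.zs]
        · have := A₂.pos t₂ ⟨hc1.trans_le ht₂.1, h'⟩
          linarith
      · have := nocross H S₁ S₂ A₁ A₂ ⟨h, ht₁.2.trans hd.2⟩ ⟨hc1.trans_le ht₂.1, ht₂.2⟩ hx hz'
        linarith)
    (left_mem_Icc.mpr hd.1) (left_mem_Icc.mpr hc.2) (by simp [hcz])
    (by rw [A₁.xs]; exact A₂.pos c ⟨hc1, hc2⟩)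
    d (right_mem_Icc.mpr hd.1) e₂ (right_mem_Icc.mpr hc.2) (by simp [hdz])
  rw [A₂.xe] at this
  linarith [A₁.nonneg hd]

/-- First return to zero of a periodic function. -/
lemma next_zero {y : ℝ → ℝ} {T d s : ℝ} (hT : 0 < T) (hc : Continuous y)
    (hp : ∀ t, y (t + T) = y t) (hs : y s = 0) (hd : HasDerivAt y d s) (hdp : 0 < d) :
    ∃ e, s < e ∧ y e = 0 ∧ ∀ t ∈ Ioo s e, 0 < y t := by
  have hev : ∀ᶠ t in 𝓝[>] s, 0 < y t := by
    have h1 := (hasDerivAt_iff_tendsto_slope.mp hd).eventually (lt_mem_nhds hdp)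
    have h2 : ∀ᶠ t in 𝓝[>] s, 0 < slope y s t :=
      h1.filter_mono (nhdsWithin_mono _ (fun t ht => ne_of_gt ht))
    filter_upwards [h2, self_mem_nhdsWithin] with t ht hts
    rw [slope_def_field, hs, sub_zero] at ht
    have hts' : 0 < t - s := sub_pos.mpr hts
    exact (div_pos_iff_of_pos_right hts').mp ht
  obtain ⟨r, hr, hrpos⟩ := mem_nhdsGT_iff_exists_Ioo_subset.mp hev
  have hr : s < r := hr
  let Z : Set ℝ := {t | r ≤ t ∧ y t = 0}
  have hrT : r ≤ s + T := by
    by_contra h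
    have := hrpos (show s + T ∈ Ioo s r from ⟨by linarith, not_le.mp h⟩)
    change 0 < y (s + T) at this
    rw [hp, hs] at this
    exact lt_irrefl _ this
  have hZne : Z.Nonempty := ⟨s + T, hrT, by rw [hp, hs]⟩
  have hZc : IsClosed Z :=
    (isClosed_le continuous_const continuous_id).inter (isClosed_eq hc continuous_const)
  have hZb : BddBelow Z := ⟨r, fun t ht => ht.1⟩
  have hmem := hZc.csInf_mem hZne hZb
  refine ⟨sInf Z, hr.trans_le hmem.1, hmem.2, ?_⟩
  have hno : ∀ t ∈ Ioo s (sInf Z), y t ≠ 0 := by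
    intro t ht h0
    rcases lt_or_ge t r with h | h
    · have : 0 < y t := hrpos ⟨ht.1, h⟩
      linarith
    · exact absurd (csInf_le hZb ⟨h, h0⟩) (not_le.mpr ht.2)
  intro t ht
  let c := (s + min r t) / 2
  have hc1 : s < c := by
    have : s < min r t := lt_min hr ht.1
    simp only [c]; linarith
  have hc2 : c < r := by
    have : min r t ≤ r := min_le_left _ _
    simp only [c]; linarith
  have hc3 : c < t := by
    have : min r t ≤ t := min_le_right _ _
    simp only [c]; linarith [ht.1]
  exact pos_of_ne (s := c) (e := t) hc.continuousOn
    (fun w hw => hno w ⟨hc1.trans_le hw.1, hw.2.trans_lt ht.2⟩)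
    (left_mem_Icc.mpr hc3.le) (hrpos ⟨hc1, hc2⟩) t (right_mem_Icc.mpr hc3.le)

/-- An excursion in the right half plane is unimodal in `x`. -/
lemma unimodal (H : Hyp f F g G a) (S : PS F g x z) {s e : ℝ} (hse : s < e) (hs : x s = 0)
    (he : x e = 0) (hpos : ∀ t ∈ Ioo s e, 0 < x t) :
    ∃ m ∈ Ioo s e, (∀ t ∈ Ico s m, 0 < z t - F (x t)) ∧ (∀ t ∈ Ioc m e, z t - F (x t) < 0) := by
  have hcont : Continuous (fun t => f (x t)) := H.cf.comp S.cx
  let Φ : ℝ → ℝ := fun t => ∫ r in (0:ℝ)..t, f (x r)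
  have hΦ : ∀ t, HasDerivAt Φ (f (x t)) t := fun t =>
    intervalIntegral.integral_hasDerivAt_right (hcont.intervalIntegrable _ _)
      (hcont.stronglyMeasurableAtFilter _ _) hcont.continuousAt
  have hw : ∀ t, HasDerivAt (fun t => -((z t - F (x t)) * Real.exp (Φ t)))
      (g (x t) * Real.exp (Φ t)) t := by
    intro t
    have h1 := ((S.dz t).sub ((H.dF (x t)).comp t (S.dx t))).mul (hΦ t).exp
    have h2 := h1.neg
    have e : -((-g (x t) - f (x t) * (z t - F (x t))) * Real.exp (Φ t) +
        (z t - F (x t)) * (Real.exp (Φ t) * f (x t))) = g (x t) * Real.exp (Φ t) := by ring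
    rw [← e]
    exact h2
  have hmono := strictMono_of_hasDeriv (s := s) (e := e) hw
    (fun t ht => mul_pos (H.gpos _ (hpos t ht)) (Real.exp_pos _))
  obtain ⟨m, hm, hm0⟩ := exists_hasDerivAt_eq_zero hse S.cx.continuousOn (hs.trans he.symm)
    (fun t _ => S.dx t)
  refine ⟨m, hm, ?_, ?_⟩
  · intro t ht
    have := hmono ⟨ht.1, ht.2.le.trans hm.2.le⟩ (Ioo_subset_Icc_self hm) ht.2
    simp only [hm0, zero_mul, neg_zero] at this
    have h3 : 0 < (z t - F (x t)) * Real.exp (Φ t) := by linarith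
    exact (mul_pos_iff_of_pos_right (Real.exp_pos _)).mp h3
  · intro t ht
    have := hmono (Ioo_subset_Icc_self hm) ⟨hm.1.le.trans ht.1.le, ht.2⟩ ht.1
    simp only [hm0, zero_mul, neg_zero] at this
    by_contra hcon
    have h3 := mul_nonneg (not_lt.mp hcon) (Real.exp_pos (Φ t)).le
    linarith

lemma mkArc (H : Hyp f F g G a) (S : PS F g x z) {s e : ℝ} (hse : s < e) (hs : x s = 0)
    (he : x e = 0) (hpos : ∀ t ∈ Ioo s e, 0 < x t) : Arc x z s e := by
  obtain ⟨m, hm, h1, h2⟩ := unimodal H S hse hs he hpos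
  refine ⟨hse, hs, he, hpos, ?_, ?_⟩
  · have := h1 s ⟨le_refl _, hm.1⟩
    rwa [hs, H.F0, sub_zero] at this
  · have := h2 e ⟨hm.2, le_refl _⟩
    rwa [he, H.F0, sub_zero] at this

lemma core (H : Hyp f F g G a) (S : PS F g x z) {c : ℝ} (hc : x c = 0) (hz : z c < 0)
    (hmax : ∀ t, x t = 0 → |z t| ≤ -z c) : ∃ s, Arc x z s c ∧ z s = -z c := by
  obtain ⟨T, hT, hp, -⟩ := S.per
  have hxc : HasDerivAt x (z c) c := by
    have := S.dx c
    rwa [hc, H.F0, sub_zero] at this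
  -- backward
  obtain ⟨s', hs', hs0, hspos⟩ := next_zero (y := fun t => x (-t)) (s := -c) (d := -z c) hT
    (S.cx.comp continuous_neg)
    (fun t => by
      have := hp (-(t + T))
      rw [← this]; congr 1; ring)
    (by simp [hc])
    (by
      have h1 : HasDerivAt x (z c) (- -c) := by rwa [neg_neg]
      have := h1.comp (-c) (hasDerivAt_neg (-c))
      rw [mul_neg_one] at this
      exact this)
    (by linarith)
  have A₁ : Arc x z (-s') c := by
    apply mkArc H S (by linarith) hs0 hc
    intro t ht
    have := hspos (-t) ⟨by linarith [ht.2], by linarith [ht.1]⟩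
    simpa using this
  -- forward
  have S' := S.neg H
  obtain ⟨e, hce, he0, hepos⟩ := next_zero (y := fun t => -x t) (s := c) (d := -z c) hT
    S.cx.neg (fun t => by rw [hp]) (by simp [hc]) hxc.neg (by linarith)
  have A₂ := mkArc H S' hce (by simp [hc]) he0 hepos
  refine ⟨-s', A₁, ?_⟩
  have h1 := (le_abs_self _).trans (hmax (-s') A₁.xs)
  rcases eq_or_lt_of_le h1 with h | h
  · exact h
  · exfalso
    have h2 := nested H S S' A₁ A₂ h
    have h3 := (le_abs_self _).trans (hmax e (by simpa using he0))
    linarith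

lemma not_pos (H : Hyp f F g G a) (S : PS F g x z) : ¬ ∀ t, 0 < x t := by
  intro h
  obtain ⟨T, hT, -, hp⟩ := S.per
  have := strictMono_of_hasDeriv (s := 0) (e := T) S.dnz (fun t _ => H.gpos _ (h t))
    (left_mem_Icc.mpr hT.le) (right_mem_Icc.mpr hT.le) hT
  have h2 := hp 0
  rw [zero_add] at h2
  simp only [h2] at this
  exact lt_irrefl _ this

lemma exists_zero (H : Hyp f F g G a) (S : PS F g x z) : ∃ t, x t = 0 := by
  by_contra hcon
  push Not at hcon
  have key : ∀ y : ℝ → ℝ, Continuous y → (∀ t, y t ≠ 0) → 0 < y 0 → ∀ t, 0 < y t := by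
    intro y hy hne h0 t
    exact pos_of_ne (s := min 0 t) (e := max 0 t) hy.continuousOn (fun t _ => hne t)
      ⟨min_le_left _ _, le_max_left _ _⟩ h0 t ⟨min_le_right _ _, le_max_right _ _⟩
  rcases lt_or_gt_of_ne (hcon 0) with h | h
  · exact not_pos H (S.neg H) (key _ S.cx.neg (fun t => neg_ne_zero.mpr (hcon t)) (by simpa using h))
  · exact not_pos H S (key _ S.cx hcon h)

lemma exists_sym (H : Hyp f F g G a) (S : PS F g x z) (nz : ∀ t, x t = 0 → z t ≠ 0) :
    ∃ M, (∃ t, x t = 0 ∧ z t = M) ∧ ∃ (x' z' : ℝ → ℝ) (s e : ℝ), PS F g x' z' ∧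
      Arc x' z' s e ∧ z' s = M ∧ z' e = -M := by
  obtain ⟨T, hT, hp1, hp2⟩ := S.per
  have hper : Function.Periodic (fun t => (x t, z t)) T := fun t => by simp [hp1, hp2]
  obtain ⟨t₀, ht₀⟩ := exists_zero H S
  let K : Set ℝ := Icc 0 T ∩ {t | x t = 0}
  have hK : IsCompact K := isCompact_Icc.inter_right (isClosed_eq S.cx continuous_const)
  have hred : ∀ t, ∃ r ∈ Icc 0 T, x t = x r ∧ z t = z r := by
    intro t
    obtain ⟨r, hr, hrt⟩ := hper.exists_mem_Ico₀ hT t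
    simp only [Prod.mk.injEq] at hrt
    exact ⟨r, Ico_subset_Icc_self hr, hrt⟩
  have hKne : K.Nonempty := by
    obtain ⟨r, hr, h1, h2⟩ := hred t₀
    exact ⟨r, hr, by rw [mem_ofPred_eq, ← h1, ht₀]⟩
  obtain ⟨c, hcK, hcmax⟩ := hK.exists_isMaxOn hKne (S.cz.abs.continuousOn)
  have hc0 : x c = 0 := hcK.2
  have hmax : ∀ t, x t = 0 → |z t| ≤ |z c| := by
    intro t ht
    obtain ⟨r, hr, h1, h2⟩ := hred t
    rw [h2]
    exact hcmax ⟨hr, by rw [mem_ofPred_eq, ← h1, ht]⟩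
  rcases lt_or_gt_of_ne (nz c hc0) with h | h
  · rw [abs_of_neg h] at hmax
    obtain ⟨s, A, hs⟩ := core H S hc0 h hmax
    exact ⟨-z c, ⟨s, A.xs, hs⟩, x, z, s, c, S, A, hs, by ring⟩
  · rw [abs_of_pos h] at hmax
    obtain ⟨s, A, hs⟩ := core H (S.neg H) (c := c) (by simp [hc0]) (by simpa using h)
      (fun t ht => by simpa using hmax t (by simpa using ht))
    exact ⟨z c, ⟨c, hc0, rfl⟩, _, _, s, c, S.neg H, A, by simpa using hs, rfl⟩

lemma PS.dE (H : Hyp f F g G a) (S : PS F g x z) (t : ℝ) :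
    HasDerivAt (fun t => z t ^ 2 / 2 + G (x t)) (-(g (x t) * F (x t))) t := by
  have h1 := (((S.dz t).pow 2).div_const 2).add ((H.dG (x t)).comp t (S.dx t))
  refine h1.congr_deriv ?_
  simp
  ring

lemma big (H : Hyp f F g G a) (S : PS F g x z) {s e : ℝ} (A : Arc x z s e) (hz : z e = -z s) :
    ∃ p q, s < p ∧ p < q ∧ q < e ∧ x p = a ∧ x q = a ∧ (∀ t ∈ Icc s p, 0 < z t - F (x t)) ∧
      (∀ t ∈ Icc q e, z t - F (x t) < 0) ∧ (∀ t ∈ Ioo p q, a < x t) ∧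
      (∀ t ∈ Ioo s p, x t < a) ∧ (∀ t ∈ Ioo q e, x t < a) := by
  obtain ⟨m, hm, h1, h2⟩ := unimodal H S A.lt A.xs A.xe A.pos
  have inc : StrictMonoOn x (Icc s m) :=
    strictMono_of_hasDeriv S.dx (fun t ht => h1 t (Ioo_subset_Ico_self ht))
  have dec' : StrictMonoOn (fun t => -x t) (Icc m e) :=
    strictMono_of_hasDeriv (fun t => (S.dx t).neg) (fun t ht => by
      have := h2 t (Ioo_subset_Ioc_self ht)
      linarith)
  have dec : StrictAntiOn x (Icc m e) := fun r hr t ht h => by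
    have := dec' hr ht h
    simp only at this; linarith
  have hsm := left_mem_Icc.mpr hm.1.le
  have hms := right_mem_Icc.mpr hm.1.le
  have hme := left_mem_Icc.mpr hm.2.le
  have hem := right_mem_Icc.mpr hm.2.le
  have hbig : a < x m := by
    by_contra hcon
    push Not at hcon
    have hlt : ∀ t ∈ Ioo s m, x t < a := fun t ht =>
      (inc (Ioo_subset_Icc_self ht) hms ht.2).trans_le hcon
    have hlt' : ∀ t ∈ Ioo m e, x t < a := fun t ht =>
      (dec hme (Ioo_subset_Icc_self ht) ht.1).trans_le hcon
    have m1 := strictMono_of_hasDeriv (s := s) (e := m) (S.dE H) (fun t ht => by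
      have hp := A.pos t ⟨ht.1, ht.2.trans hm.2⟩
      have := mul_neg_of_pos_of_neg (H.gpos _ hp) (H.Fneg _ hp (hlt t ht))
      linarith) hsm hms hm.1
    have m2 := strictMono_of_hasDeriv (s := m) (e := e) (S.dE H) (fun t ht => by
      have hp := A.pos t ⟨hm.1.trans ht.1, ht.2⟩
      have := mul_neg_of_pos_of_neg (H.gpos _ hp) (H.Fneg _ hp (hlt' t ht))
      linarith) hme hem hm.2
    simp only [A.xs, A.xe, hz] at m1 m2
    nlinarith
  obtain ⟨p, hp, hpa⟩ := intermediate_value_Icc hm.1.le S.cx.continuousOn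
    (show a ∈ Icc (x s) (x m) from ⟨by rw [A.xs]; exact H.apos.le, hbig.le⟩)
  obtain ⟨q, hq, hqa⟩ := intermediate_value_Icc' hm.2.le S.cx.continuousOn
    (show a ∈ Icc (x e) (x m) from ⟨by rw [A.xe]; exact H.apos.le, hbig.le⟩)
  have hpm : p < m := lt_of_le_of_ne hp.2 (by rintro rfl; linarith)
  have hmq : m < q := lt_of_le_of_ne hq.1 (by rintro rfl; linarith)
  have hsp : s < p := lt_of_le_of_ne hp.1 (by rintro rfl; linarith [A.xs, H.apos])
  have hqe : q < e := lt_of_le_of_ne hq.2 (by rintro rfl; linarith [A.xe, H.apos])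
  refine ⟨p, q, hsp, hpm.trans hmq, hqe, hpa, hqa, ?_, ?_, ?_, ?_, ?_⟩
  · exact fun t ht => h1 t ⟨ht.1, ht.2.trans_lt hpm⟩
  · exact fun t ht => h2 t ⟨hmq.trans_le ht.1, ht.2⟩
  · intro t ht
    rcases le_total t m with h | h
    · rw [← hpa]; exact inc hp ⟨hsp.le.trans ht.1.le, h⟩ ht.1
    · rw [← hqa]; exact dec ⟨h, ht.2.le.trans hqe.le⟩ hq ht.2
  · intro t ht
    rw [← hpa]; exact inc ⟨ht.1.le, ht.2.le.trans hpm.le⟩ hp ht.2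
  · intro t ht
    rw [← hqa]; exact dec hq ⟨hmq.le.trans ht.1.le, ht.2.le⟩ ht.1

/-- Two symmetric arcs cannot have different amplitudes. -/
lemma key (H : Hyp f F g G a) (S₁ : PS F g x₁ z₁) (S₂ : PS F g x₂ z₂) {s₁ e₁ s₂ e₂ : ℝ}
    (A₁ : Arc x₁ z₁ s₁ e₁) (A₂ : Arc x₂ z₂ s₂ e₂) (hz₁ : z₁ e₁ = -z₁ s₁) (hz₂ : z₂ e₂ = -z₂ s₂)
    (hlt : z₁ s₁ < z₂ s₂) : False := by
  obtain ⟨p₁, q₁, sp₁, pq₁, qe₁, xp₁, xq₁, up₁, lo₁, mid₁, l₁, r₁⟩ := big H S₁ A₁ hz₁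
  obtain ⟨p₂, q₂, sp₂, pq₂, qe₂, xp₂, xq₂, up₂, lo₂, mid₂, l₂, r₂⟩ := big H S₂ A₂ hz₂
  have NC : ∀ t₁ ∈ Ioo s₁ e₁, ∀ t₂ ∈ Ioo s₂ e₂, x₁ t₁ = x₂ t₂ → z₁ t₁ ≠ z₂ t₂ := by
    intro t₁ h₁ t₂ h₂ hx hz
    have := nocross H S₁ S₂ A₁ A₂ (Ioo_subset_Ioc_self h₁) (Ioo_subset_Ioc_self h₂) hx hz
    linarith
  -- upper part
  have O1 := order_of_ne (v₁ := z₁) (v₂ := z₂) sp₁.le sp₂.le S₁.dx S₂.dx S₁.cz S₂.cz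
    (fun t ht => up₁ t (Ioo_subset_Icc_self ht)) (fun t ht => up₂ t (Ioo_subset_Icc_self ht))
    (by rw [A₁.xs, A₂.xs]) (by rw [xp₁, xp₂])
    (by
      intro t₁ ht₁ t₂ ht₂ hx
      rcases eq_or_lt_of_le ht₁.1 with h | h
      · subst h
        rcases eq_or_lt_of_le ht₂.1 with h' | h'
        · subst h'; exact hlt.ne
        · have := A₂.pos t₂ ⟨h', by linarith [ht₂.2]⟩
          rw [A₁.xs] at hx; linarith
      · rcases eq_or_lt_of_le ht₂.1 with h' | h'
        · subst h'
          have := A₁.pos t₁ ⟨h, by linarith [ht₁.2]⟩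
          rw [A₂.xs] at hx; linarith
        · exact NC t₁ ⟨h, by linarith [ht₁.2]⟩ t₂ ⟨h', by linarith [ht₂.2]⟩ hx)
    (left_mem_Icc.mpr sp₁.le) (left_mem_Icc.mpr sp₂.le) (by rw [A₁.xs, A₂.xs]) hlt
  have C1 := compare sp₁.le sp₂.le S₁.dx S₂.dx (S₁.dE H) (S₂.dE H)
    (fun t ht => up₁ t (Ioo_subset_Icc_self ht)) (fun t ht => up₂ t (Ioo_subset_Icc_self ht))
    (by rw [A₁.xs, A₂.xs]) (by rw [xp₁, xp₂])
    (by
      intro t₁ ht₁ t₂ ht₂ hx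
      have hz := O1 t₁ (Ioo_subset_Icc_self ht₁) t₂ (Ioo_subset_Icc_self ht₂) hx
      have hp := A₁.pos t₁ ⟨ht₁.1, by linarith [ht₁.2]⟩
      have := mul_neg_of_pos_of_neg (H.gpos _ hp) (H.Fneg _ hp (l₁ t₁ ht₁))
      rw [← hx]
      nlinarith)
  -- lower part
  have N : ∀ y : ℝ → ℝ, Continuous y → Continuous (fun t => -y t) := fun y hy => hy.neg
  have O3 := order_of_ne (v₁ := fun t => -z₁ t) (v₂ := fun t => -z₂ t) qe₁.le qe₂.le
    (fun t => (S₁.dx t).neg) (fun t => (S₂.dx t).neg) (N _ S₁.cz) (N _ S₂.cz)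
    (fun t ht => by have := lo₁ t (Ioo_subset_Icc_self ht); linarith)
    (fun t ht => by have := lo₂ t (Ioo_subset_Icc_self ht); linarith)
    (by simp [xq₁, xq₂]) (by simp [A₁.xe, A₂.xe])
    (by
      intro t₁ ht₁ t₂ ht₂ hx hz
      have hx : x₁ t₁ = x₂ t₂ := neg_injective hx
      have hz : z₁ t₁ = z₂ t₂ := neg_injective hz
      rcases eq_or_lt_of_le ht₁.2 with h | h
      · subst h
        rcases eq_or_lt_of_le ht₂.2 with h' | h'
        · subst h'; linarith
        · have := A₂.pos t₂ ⟨by linarith [ht₂.1], h'⟩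
          rw [A₁.xe] at hx; linarith
      · rcases eq_or_lt_of_le ht₂.2 with h' | h'
        · subst h'
          have := A₁.pos t₁ ⟨by linarith [ht₁.1], h⟩
          rw [A₂.xe] at hx; linarith
        · exact NC t₁ ⟨by linarith [ht₁.1], h⟩ t₂ ⟨by linarith [ht₂.1], h'⟩ hx hz)
    (right_mem_Icc.mpr qe₁.le) (right_mem_Icc.mpr qe₂.le) (by simp [A₁.xe, A₂.xe])
    (by linarith)
  have C3 := compare qe₁.le qe₂.le (fun t => (S₁.dx t).neg) (fun t => (S₂.dx t).neg)
    (S₁.dE H) (S₂.dE H)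
    (fun t ht => by have := lo₁ t (Ioo_subset_Icc_self ht); linarith)
    (fun t ht => by have := lo₂ t (Ioo_subset_Icc_self ht); linarith)
    (by simp [xq₁, xq₂]) (by simp [A₁.xe, A₂.xe])
    (by
      intro t₁ ht₁ t₂ ht₂ hx
      have hz := O3 t₁ (Ioo_subset_Icc_self ht₁) t₂ (Ioo_subset_Icc_self ht₂) hx
      have hx : x₁ t₁ = x₂ t₂ := neg_injective hx
      have hp := A₁.pos t₁ ⟨by linarith [ht₁.1], ht₁.2⟩
      have := mul_neg_of_pos_of_neg (H.gpos _ hp) (H.Fneg _ hp (r₁ t₁ ht₁))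
      rw [← hx]
      nlinarith)
  -- middle part
  have hzp : z₁ p₁ < z₂ p₂ := O1 _ (right_mem_Icc.mpr sp₁.le) _ (right_mem_Icc.mpr sp₂.le)
    (by rw [xp₁, xp₂])
  have hzq : z₂ q₂ < z₁ q₁ := by
    have := O3 _ (left_mem_Icc.mpr qe₁.le) _ (left_mem_Icc.mpr qe₂.le) (by simp [xq₁, xq₂])
    linarith
  have hz1 : z₁ q₁ < z₁ p₁ := A₁.antiz H S₁ ⟨sp₁.le, (pq₁.trans qe₁).le⟩
    ⟨(sp₁.trans pq₁).le, qe₁.le⟩ pq₁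
  obtain ⟨c, hc, hcz⟩ := intermediate_value_Icc' pq₂.le S₂.cz.continuousOn
    (show z₁ p₁ ∈ Icc (z₂ q₂) (z₂ p₂) from ⟨by linarith, hzp.le⟩)
  obtain ⟨d, hd, hdz⟩ := intermediate_value_Icc' pq₂.le S₂.cz.continuousOn
    (show z₁ q₁ ∈ Icc (z₂ q₂) (z₂ p₂) from ⟨hzq.le, by linarith⟩)
  have hpc : p₂ < c := lt_of_le_of_ne hc.1 (by rintro rfl; linarith)
  have hdq : d < q₂ := lt_of_le_of_ne hd.2 (by rintro rfl; linarith)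
  have hcd : c < d := by
    by_contra hcon
    have := (A₂.antiz H S₂).antitoneOn (a := d) (b := c) ⟨by linarith [hd.1], by linarith [hd.2]⟩
      ⟨by linarith, by linarith [hc.2]⟩ (not_lt.mp hcon)
    linarith
  have O2 := order_of_ne (v₁ := x₁) (v₂ := x₂) pq₁.le hcd.le S₁.dnz S₂.dnz S₁.cx S₂.cx
    (fun t ht => H.gpos _ (H.apos.trans (mid₁ t ht)))
    (fun t ht => H.gpos _ (H.apos.trans (mid₂ t ⟨hpc.trans ht.1, ht.2.trans hdq⟩)))
    (by simp [hcz]) (by simp [hdz])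
    (fun t₁ ht₁ t₂ ht₂ hz hx => NC t₁ ⟨by linarith [ht₁.1], by linarith [ht₁.2]⟩ t₂
      ⟨by linarith [ht₂.1], by linarith [ht₂.2]⟩ hx (neg_injective hz))
    (left_mem_Icc.mpr pq₁.le) (left_mem_Icc.mpr hcd.le) (by simp [hcz])
    (by rw [xp₁]; exact mid₂ c ⟨hpc, hcd.trans hdq⟩)
  have C2 := compare pq₁.le hcd.le S₁.dnz S₂.dnz (S₁.dE H) (S₂.dE H)
    (fun t ht => H.gpos _ (H.apos.trans (mid₁ t ht)))
    (fun t ht => H.gpos _ (H.apos.trans (mid₂ t ⟨hpc.trans ht.1, ht.2.trans hdq⟩)))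
    (by simp [hcz]) (by simp [hdz])
    (by
      intro t₁ ht₁ t₂ ht₂ hz
      have hx := O2 t₁ (Ioo_subset_Icc_self ht₁) t₂ (Ioo_subset_Icc_self ht₂) hz
      have m1 := mid₁ t₁ ht₁
      have hF := H.mono (show x₁ t₁ ∈ Ici a from m1.le)
        (show x₂ t₂ ∈ Ici a from (m1.trans hx).le) hx
      have g1 := H.gpos _ (H.apos.trans m1)
      have g2 := H.gpos _ (H.apos.trans (m1.trans hx))
      nlinarith [mul_pos g1 g2])
  -- the energy decreases strictly on the extra pieces
  have mE := strictMono_of_hasDeriv (s := p₂) (e := q₂) (fun t => (S₂.dE H t).neg)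
    (fun t ht => by
      have m2 := mid₂ t ht
      have := mul_pos (H.gpos _ (H.apos.trans m2)) (H.Fpos m2)
      linarith)
  have e1 := mE (left_mem_Icc.mpr pq₂.le) hc hpc
  have e2 := mE hd (right_mem_Icc.mpr pq₂.le) hdq
  simp only [Pi.neg_apply] at e1 e2
  simp only [A₁.xs, A₂.xs, A₁.xe, A₂.xe, hz₁, hz₂] at C1 C3
  linarith

lemma range_subset (H : Hyp f F g G a) (S₁ : PS F g x₁ z₁) (S₂ : PS F g x₂ z₂)
    (nz₁ : ∀ t, x₁ t = 0 → z₁ t ≠ 0) (nz₂ : ∀ t, x₂ t = 0 → z₂ t ≠ 0) :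
    ∃ c, ∀ t, x₁ t = x₂ (t + c) ∧ z₁ t = z₂ (t + c) := by
  obtain ⟨M₁, ⟨t₁, hx₁, hz₁⟩, x₁', z₁', s₁, e₁, S₁', A₁, hs₁, he₁⟩ := exists_sym H S₁ nz₁
  obtain ⟨M₂, ⟨t₂, hx₂, hz₂⟩, x₂', z₂', s₂, e₂, S₂', A₂, hs₂, he₂⟩ := exists_sym H S₂ nz₂
  have hM : M₁ = M₂ := by
    rcases lt_trichotomy M₁ M₂ with h | h | h
    · exact (key H S₁' S₂' A₁ A₂ (by rw [he₁, hs₁]) (by rw [he₂, hs₂]) (by rwa [hs₁, hs₂])).elim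
    · exact h
    · exact (key H S₂' S₁' A₂ A₁ (by rw [he₂, hs₂]) (by rw [he₁, hs₁]) (by rwa [hs₁, hs₂])).elim
  have U := S₁.unique H S₂ (hx₁.trans hx₂.symm) (by rw [hz₁, hz₂, hM])
  refine ⟨t₂ - t₁, fun t => ?_⟩
  have := U (t - t₁)
  rw [sub_add_cancel] at this
  rw [show t + (t₂ - t₁) = t - t₁ + t₂ by ring]
  exact this

lemma toPS (H : Hyp f F g G a) {T : ℝ} (hx : ContDiff ℝ 2 x) (hT : 0 < T)
    (hper : ∀ t, x (t + T) = x t) (hnc : ¬ ∃ c, ∀ t, x t = c)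
    (heq : ∀ t, deriv (deriv x) t + f (x t) * deriv x t + g (x t) = 0) :
    PS F g x (fun t => deriv x t + F (x t)) ∧
      ∀ t, x t = 0 → deriv x t + F (x t) ≠ 0 := by
  have hd : ∀ t, HasDerivAt x (deriv x t) t := fun t =>
    (hx.differentiable (by norm_num) t).hasDerivAt
  have hx' : ContDiff ℝ 1 (deriv x) := by
    have : ContDiff ℝ (1 + 1) x := by
      rw [one_add_one_eq_two]; exact hx
    exact (contDiff_succ_iff_deriv.mp this).2.2
  have hdd : ∀ t, HasDerivAt (deriv x) (deriv (deriv x) t) t := fun t =>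
    (hx'.differentiable (by norm_num) t).hasDerivAt
  have hdper : ∀ t, deriv x (t + T) = deriv x t := by
    intro t
    have h1 : (fun t => x (t + T)) = x := funext hper
    rw [← deriv_comp_add_const, h1]
  have S : PS F g x (fun t => deriv x t + F (x t)) := by
    refine ⟨fun t => ?_, fun t => ?_, T, hT, hper, fun t => ?_⟩
    · simpa using hd t
    · have := (hdd t).add ((H.dF (x t)).comp t (hd t))
      refine this.congr_deriv ?_
      linarith [heq t]
    · simp only [hper, hdper]
  refine ⟨S, fun t ht h0 => hnc ⟨0, fun r => ?_⟩⟩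
  have Z : PS F g (fun _ => (0:ℝ)) (fun _ => (0:ℝ)) := by
    refine ⟨fun t => ?_, fun t => ?_, 1, one_pos, fun _ => rfl, fun _ => rfl⟩
    · simpa [H.F0] using hasDerivAt_const t (0:ℝ)
    · simpa [H.g0] using hasDerivAt_const t (0:ℝ)
  have := (S.unique H Z (s₁ := t) (s₂ := t) ht h0 (r - t)).1
  rwa [sub_add_cancel] at this

lemma mkHyp (f g F : ℝ → ℝ) (a : ℝ)
    (hf : ContDiff ℝ 1 f) (hg : ContDiff ℝ 1 g)
    (hgodd : ∀ x, g (-x) = -g x)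
    (hgpos : ∀ x : ℝ, x ≠ 0 → x * g x > 0)
    (hF : ∀ x, F x = ∫ s in (0:ℝ)..x, f s)
    (hFodd : ∀ x, F (-x) = -F x)
    (hF0 : F 0 = 0)
    (hF'0 : deriv F 0 < 0)
    (ha : 0 < a) (hFa : F a = 0)
    (hauniq : ∀ x : ℝ, 0 < x → F x = 0 → x = a)
    (hmono : StrictMonoOn F (Set.Ici a)) :
    Hyp f F g (fun x => ∫ s in (0:ℝ)..x, g s) a := by
  have prim : ∀ h : ℝ → ℝ, Continuous h → ∀ x,
      HasDerivAt (fun x => ∫ s in (0:ℝ)..x, h s) (h x) x := fun h hc x =>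
    intervalIntegral.integral_hasDerivAt_right (hc.intervalIntegrable _ _)
      (hc.stronglyMeasurableAtFilter _ _) hc.continuousAt
  have hF' : F = fun x => ∫ s in (0:ℝ)..x, f s := funext hF
  have dF : ∀ x, HasDerivAt F (f x) x := by
    rw [hF']; exact prim f hf.continuous
  have hFc : Continuous F := continuous_iff_continuousAt.mpr fun t => (dF t).continuousAt
  refine ⟨dF, prim g hg.continuous, hf.continuous, ?_, hg, hFodd, hgodd, ?_, ?_, hmono, ha, hFa⟩
  · rw [contDiff_one_iff_deriv]
    refine ⟨fun x => (dF x).differentiableAt, ?_⟩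
    rw [show deriv F = f from funext fun x => (dF x).deriv]
    exact hf.continuous
  · intro x hx
    exact (mul_pos_iff_of_pos_left hx).mp (hgpos x hx.ne')
  · intro x hx hxa
    by_contra hcon
    push Not at hcon
    have hfn : f 0 < 0 := by rwa [(dF 0).deriv] at hF'0
    have h1 := (hasDerivAt_iff_tendsto_slope.mp (dF 0)).eventually (gt_mem_nhds hfn)
    have h2 : ∀ᶠ t in 𝓝[>] (0:ℝ), slope F 0 t < 0 :=
      h1.filter_mono (nhdsWithin_mono _ (fun t ht => ne_of_gt ht))
    have h3 : ∀ᶠ t in 𝓝[>] (0:ℝ), t ∈ Ioo 0 x := Ioo_mem_nhdsGT hx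
    obtain ⟨t, ht, ht'⟩ := (h2.and h3).exists
    rw [slope_def_field, hF0, sub_zero, sub_zero] at ht
    have hFt : F t < 0 := by
      by_contra hc
      have := div_nonneg (not_lt.mp hc) ht'.1.le
      linarith
    obtain ⟨r, hr, hr0⟩ := intermediate_value_Icc ht'.2.le hFc.continuousOn
      (show (0:ℝ) ∈ Icc (F t) (F x) from ⟨hFt.le, hcon⟩)
    have := hauniq r (ht'.1.trans_le hr.1) hr0
    linarith [hr.2]

end Lienard

/-- **Liénard's theorem (uniqueness part).** Under Liénard's hypotheses, any two nonconstant
periodic solutions of `x'' + f(x)·x' + g(x) = 0` trace the same orbit in the plane. -/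
theorem lienard_uniqueness
    (f g F : ℝ → ℝ) (a : ℝ)
    (hf : ContDiff ℝ 1 f) (hg : ContDiff ℝ 1 g)
    (hgodd : ∀ x, g (-x) = -g x)
    (hgpos : ∀ x : ℝ, x ≠ 0 → x * g x > 0)
    (hF : ∀ x, F x = ∫ s in (0:ℝ)..x, f s)
    (hFodd : ∀ x, F (-x) = -F x)
    (hF0 : F 0 = 0)
    (hF'0 : deriv F 0 < 0)
    (ha : 0 < a) (hFa : F a = 0)
    (hauniq : ∀ x : ℝ, 0 < x → F x = 0 → x = a)
    (hmono : StrictMonoOn F (Set.Ici a))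
    (hinf : Filter.Tendsto F Filter.atTop Filter.atTop)
    (x₁ x₂ : ℝ → ℝ) (T₁ T₂ : ℝ)
    (hx₁ : ContDiff ℝ 2 x₁) (hT₁ : 0 < T₁) (hper₁ : ∀ t, x₁ (t + T₁) = x₁ t)
    (hnc₁ : ¬ ∃ c, ∀ t, x₁ t = c)
    (heq₁ : ∀ t, deriv (deriv x₁) t + f (x₁ t) * deriv x₁ t + g (x₁ t) = 0)
    (hx₂ : ContDiff ℝ 2 x₂) (hT₂ : 0 < T₂) (hper₂ : ∀ t, x₂ (t + T₂) = x₂ t)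
    (hnc₂ : ¬ ∃ c, ∀ t, x₂ t = c)
    (heq₂ : ∀ t, deriv (deriv x₂) t + f (x₂ t) * deriv x₂ t + g (x₂ t) = 0) :
    Set.range (fun t => (x₁ t, deriv x₁ t)) = Set.range (fun t => (x₂ t, deriv x₂ t)) := by
  have H := Lienard.mkHyp f g F a hf hg hgodd hgpos hF hFodd hF0 hF'0 ha hFa hauniq hmono
  obtain ⟨S₁, nz₁⟩ := Lienard.toPS H hx₁ hT₁ hper₁ hnc₁ heq₁
  obtain ⟨S₂, nz₂⟩ := Lienard.toPS H hx₂ hT₂ hper₂ hnc₂ heq₂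
  obtain ⟨c, hc⟩ := Lienard.range_subset H S₁ S₂ nz₁ nz₂
  have hpt : ∀ t, (x₁ t, deriv x₁ t) = (x₂ (t + c), deriv x₂ (t + c)) := by
    intro t
    obtain ⟨h1, h2⟩ := hc t
    rw [h1] at h2 ⊢
    rw [Prod.mk.injEq]
    exact ⟨rfl, by linarith⟩
  apply Set.Subset.antisymm
  · rintro _ ⟨t, rfl⟩
    exact ⟨t + c, (hpt t).symm⟩
  · rintro _ ⟨t, rfl⟩
    refine ⟨t - c, ?_⟩
    have := hpt (t - c)
    rw [sub_add_cancel] at this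
    exact this
end

section
/- Let μ, k, α, τ₀, σ be real numbers with μ > 0, k > 0, α > 0, σ > 0 and α·τ₀ > μ. Let τ(x) = τ₀·exp(−x²/(2σ²)), f(x) = (μ − α·τ(x))/(1 + α·τ(x)²/2) and g(x) = (k + α)·x/(1 + α·τ(x)²/2). Then the Liénard equation x'' + f(x)·x' + g(x) = 0 associated to the retarded harmonic oscillator possesses a nonconstant periodic solution, and any two nonconstant periodic solutions trace the same orbit {(x(t), x'(t)) : t ∈ ℝ} in the plane. -/
open Set Filter Topology
open scoped NNReal

theorem lie_global_existence {E : Type*} [NormedAddCommGroup E] [NormedSpace ℝ E] [CompleteSpace E]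
    (v : E → E) (hv : ContDiff ℝ 1 v) (K : ℝ≥0) (hL : LipschitzWith K v) (x₀ : E) :
    ∃ γ : ℝ → E, γ 0 = x₀ ∧ ∀ t, HasDerivAt γ (v (γ t)) t := by
  have hK1 : (0:ℝ) < (K:ℝ) + 1 := by positivity
  set ε : ℝ := 1 / (2 * ((K:ℝ) + 1)) with hε
  have hε0 : 0 < ε := by positivity
  have hKε : ((K:ℝ)+1) * ε = 1/2 := by rw [hε]; field_simp
  have key := exists_isMIntegralCurve_of_isMIntegralCurveOn (I := modelWithCornersSelf ℝ E) (M := E)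
    (v := v) (contMDiff_vectorSpace_iff_contDiff.mpr hv) hε0 ?_ x₀
  · obtain ⟨γ, h0, h⟩ := key
    refine ⟨γ, h0, fun t => ?_⟩
    have h1 : HasFDerivAt γ ((1 : ℝ →L[ℝ] ℝ).smulRight (v (γ t))) t :=
      hasMFDerivAt_iff_hasFDerivAt.mp (h t)
    exact h1.hasDerivAt.congr_deriv (by simp)
  · intro x
    have hm : (0:ℝ) ∈ Icc (-ε) ε := ⟨by linarith, hε0.le⟩
    have pl : IsPicardLindelof (fun _ => v) (⟨0, hm⟩ : Icc (-ε) ε) x (2 * ‖v x‖₊ * ⟨ε, hε0.le⟩) 0 (2 * ‖v x‖₊) K := by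
      refine ⟨fun t _ => hL.lipschitzOnWith, fun y _ => continuousOn_const, ?_, ?_⟩
      · intro t _ y hy
        have h1 : ‖v y - v x‖ ≤ K * ‖y - x‖ := by
          have := hL.dist_le_mul y x
          rwa [dist_eq_norm, dist_eq_norm] at this
        have h2 : ‖y - x‖ ≤ 2 * ‖v x‖ * ε := by
          rw [mem_closedBall_iff_norm] at hy
          have e : ((2 * ‖v x‖₊ * ⟨ε, hε0.le⟩ : ℝ≥0) : ℝ) = 2 * ‖v x‖ * ε := by
            rfl
          rwa [e] at hy
        have h3 : ‖v y‖ ≤ ‖v y - v x‖ + ‖v x‖ := by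
          simpa using norm_add_le (v y - v x) (v x)
        have h4 : (K:ℝ) * ‖y - x‖ ≤ K * (2 * ‖v x‖ * ε) := by gcongr
        have h5 : (K:ℝ) * (2 * ‖v x‖ * ε) ≤ ‖v x‖ := by
          have : (K:ℝ) * ε ≤ 1/2 := by nlinarith
          nlinarith [norm_nonneg (v x)]
        have : ((2 * ‖v x‖₊ : ℝ≥0) : ℝ) = 2 * ‖v x‖ := by simp
        rw [this]; linarith
      · have e : ((2 * ‖v x‖₊ * ⟨ε, hε0.le⟩ : ℝ≥0) : ℝ) = 2 * ‖v x‖ * ε := by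
          rfl
        rw [e]; simp
    obtain ⟨α, h0, h⟩ := pl.exists_eq_forall_mem_Icc_hasDerivWithinAt₀
    refine ⟨α, h0, fun t ht => ?_⟩
    have h1 := (h t (Ioo_subset_Icc_self ht)).hasDerivAt (Icc_mem_nhds ht.1 ht.2)
    have h2 : HasFDerivAt α ((1 : ℝ →L[ℝ] ℝ).smulRight (v (α t))) t :=
      h1.hasFDerivAt.congr_fderiv (by ext; simp)
    exact (hasMFDerivAt_iff_hasFDerivAt.mpr h2).hasMFDerivWithinAt

namespace Lie

/-- Hypotheses of Liénard type. -/
structure LSys (f g F G : ℝ → ℝ) (xs m c L : ℝ) : Prop where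
  hF : ∀ x, HasDerivAt F (f x) x
  hG : ∀ x, HasDerivAt G (g x) x
  fc : Continuous f
  gC : ContDiff ℝ 1 g
  gL : ∃ K : ℝ≥0, LipschitzWith K g
  FL : ∃ K : ℝ≥0, LipschitzWith K F
  F0 : F 0 = 0
  G0 : G 0 = 0
  Fodd : ∀ x, F (-x) = -F x
  godd : ∀ x, g (-x) = -g x
  xs0 : 0 < xs
  m0 : 0 < m
  c0 : 0 < c
  L0 : 0 < L
  Fneg : ∀ x, 0 < x → x < xs → F x < 0
  Fxs : F xs = 0
  Fmono : StrictMonoOn F (Ici xs)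
  Flow : ∀ x, 0 ≤ x → -m ≤ F x
  Flin : ∀ x, 0 ≤ x → -(L * x) ≤ F x
  glin : ∀ x, 0 ≤ x → c * x ≤ g x

/-- Solutions in the Liénard plane. -/
def Sol (F g : ℝ → ℝ) (x y : ℝ → ℝ) : Prop :=
  ∀ t, HasDerivAt x (y t - F (x t)) t ∧ HasDerivAt y (-g (x t)) t

section
variable {f g F G : ℝ → ℝ} {xs m c L : ℝ}

theorem LSys.gpos (h : LSys f g F G xs m c L) {x : ℝ} (hx : 0 < x) : 0 < g x :=
  lt_of_lt_of_le (mul_pos h.c0 hx) (h.glin x hx.le)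

theorem LSys.g0 (h : LSys f g F G xs m c L) : g 0 = 0 := by
  have := h.godd 0
  simp at this; linarith

theorem LSys.gnonneg (h : LSys f g F G xs m c L) {x : ℝ} (hx : 0 ≤ x) : 0 ≤ g x :=
  le_trans (mul_nonneg h.c0.le hx) (h.glin x hx)

theorem LSys.FC (h : LSys f g F G xs m c L) : ContDiff ℝ 1 F := by
  rw [contDiff_one_iff_deriv]
  refine ⟨fun x => (h.hF x).differentiableAt, ?_⟩
  have : deriv F = f := funext fun x => (h.hF x).deriv
  rw [this]; exact h.fc

theorem Sol.contx {x y : ℝ → ℝ} (s : Sol F g x y) : Continuous x :=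
  continuous_iff_continuousAt.mpr fun t => (s t).1.continuousAt

theorem Sol.conty {x y : ℝ → ℝ} (s : Sol F g x y) : Continuous y :=
  continuous_iff_continuousAt.mpr fun t => (s t).2.continuousAt

theorem Sol.neg (h : LSys f g F G xs m c L) {x y : ℝ → ℝ} (s : Sol F g x y) :
    Sol F g (fun t => -x t) (fun t => -y t) := by
  intro t
  refine ⟨(s t).1.neg.congr_deriv ?_, (s t).2.neg.congr_deriv ?_⟩
  · rw [h.Fodd]; ring
  · rw [h.godd]

theorem Sol.shift {x y : ℝ → ℝ} (s : Sol F g x y) (a : ℝ) :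
    Sol F g (fun t => x (t + a)) (fun t => y (t + a)) := by
  intro t
  exact ⟨(s (t + a)).1.comp_add_const t a, (s (t + a)).2.comp_add_const t a⟩

theorem LSys.lip (h : LSys f g F G xs m c L) :
    ∃ K : ℝ≥0, LipschitzWith K (fun z : ℝ × ℝ => (z.2 - F z.1, -g z.1)) := by
  obtain ⟨K1, h1⟩ := h.gL
  obtain ⟨K2, h2⟩ := h.FL
  refine ⟨_, LipschitzWith.prodMk (LipschitzWith.prod_snd.sub
    (h2.comp LipschitzWith.prod_fst)) (h1.comp LipschitzWith.prod_fst).neg⟩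

theorem LSys.exists_sol (h : LSys f g F G xs m c L) (a b : ℝ) :
    ∃ x y : ℝ → ℝ, Sol F g x y ∧ x 0 = a ∧ y 0 = b := by
  obtain ⟨K, hK⟩ := h.lip
  have hC : ContDiff ℝ 1 (fun z : ℝ × ℝ => (z.2 - F z.1, -g z.1)) :=
    (contDiff_snd.sub (h.FC.comp contDiff_fst)).prodMk (h.gC.comp contDiff_fst).neg
  obtain ⟨γ, h0, hγ⟩ := lie_global_existence _ hC K hK (a, b)
  refine ⟨fun t => (γ t).1, fun t => (γ t).2, fun t => ⟨?_, ?_⟩, ?_, ?_⟩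
  · exact (hasFDerivAt_fst.comp_hasDerivAt t (hγ t))
  · exact (hasFDerivAt_snd.comp_hasDerivAt t (hγ t))
  · simp [h0]
  · simp [h0]

theorem LSys.unique (h : LSys f g F G xs m c L) {x y x' y' : ℝ → ℝ} (s : Sol F g x y)
    (s' : Sol F g x' y') {t₀ : ℝ} (hx : x t₀ = x' t₀) (hy : y t₀ = y' t₀) : x = x' ∧ y = y' := by
  obtain ⟨K, hK⟩ := h.lip
  have key : (fun t => (x t, y t)) = (fun t => (x' t, y' t)) := by
    refine ODE_solution_unique_univ (v := fun _ z => (z.2 - F z.1, -g z.1)) (s := fun _ => univ)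
      (K := K) (t₀ := t₀) (fun t => hK.lipschitzOnWith) ?_ ?_ ?_
    · intro t; exact ⟨(s t).1.prodMk (s t).2, mem_univ _⟩
    · intro t; exact ⟨(s' t).1.prodMk (s' t).2, mem_univ _⟩
    · simp [hx, hy]
  constructor
  · funext t; exact congrArg Prod.fst (congrFun key t)
  · funext t; exact congrArg Prod.snd (congrFun key t)

theorem LSys.unique_shift (h : LSys f g F G xs m c L) {x y x' y' : ℝ → ℝ} (s : Sol F g x y)
    (s' : Sol F g x' y') {a b : ℝ} (hx : x a = x' b) (hy : y a = y' b) (t : ℝ) :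
    x (a + t) = x' (b + t) ∧ y (a + t) = y' (b + t) := by
  have := h.unique (s.shift a) (s'.shift b) (t₀ := 0) (by simpa using hx) (by simpa using hy)
  have h1 := congrFun this.1 t
  have h2 := congrFun this.2 t
  rw [add_comm a, add_comm b]
  exact ⟨h1, h2⟩

theorem lin_bound {u u' : ℝ → ℝ} {a C : ℝ} (hu : ∀ t, HasDerivAt u (u' t) t)
    (hb : ∀ t, a < t → u' t ≤ C) {t : ℝ} (ht : a ≤ t) : u t ≤ u a + C * (t - a) := by
  have := (convex_Ici a).image_sub_le_mul_sub_of_deriv_le (f := u) (C := C)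
    (fun t _ => (hu t).continuousAt.continuousWithinAt)
    (fun t _ => (hu t).differentiableAt.differentiableWithinAt)
    (fun t ht => by rw [(hu t).deriv]; rw [interior_Ici] at ht; exact hb t ht)
    a self_mem_Ici t ht ht
  linarith

theorem LSys.no_escape (h : LSys f g F G xs m c L) {x y : ℝ → ℝ} (s : Sol F g x y)
    (hx : ∀ t, 0 < t → 0 < x t) : False := by
  have hc := h.c0
  have hL := h.L0
  have hm := h.m0
  have hanti : ∀ a t, 0 < a → a ≤ t → y t ≤ y a := by
    intro a t ha hat
    have := lin_bound (C := 0) (fun t => (s t).2)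
      (fun t ht => by have := h.gpos (hx t (ha.trans ht)); linarith) hat
    linarith
  have stage1 : ∃ t, 0 < t ∧ y t < 0 := by
    by_contra! hy
    set δ := min (x 1) (xs / 2) with hδ
    have hδ0 : 0 < δ := lt_min (hx 1 one_pos) (by linarith [h.xs0])
    have hb : ∀ t, 1 ≤ t → δ ≤ x t := by
      intro b hb
      have := image_le_of_deriv_right_lt_deriv_boundary (f := fun t => -x t) (a := 1) (b := b)
        (f' := fun t => -(y t - F (x t))) (B := fun _ => -δ) (B' := fun _ => 0)
        s.contx.neg.continuousOn (fun t _ => (s t).1.neg.hasDerivWithinAt)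
        (by simp [hδ]) (fun t => hasDerivAt_const t _) ?_ (right_mem_Icc.mpr hb)
      · linarith
      · intro t ht he
        have he' : x t = δ := by linarith
        have h1 : F (x t) < 0 := by
          apply h.Fneg _ (by rw [he']; exact hδ0)
          rw [he']; exact (min_le_right _ _).trans_lt (by linarith [h.xs0])
        have h2 := hy t (by linarith [ht.1])
        linarith
    set t := 1 + (y 1 + 1) / (c * δ) with ht
    have hy1 := hy 1 one_pos
    have hcd : 0 < c * δ := by positivity
    have ht1 : 1 ≤ t := by
      have : 0 ≤ (y 1 + 1) / (c * δ) := by positivity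
      linarith
    have := lin_bound (C := -(c * δ)) (fun t => (s t).2)
      (fun t ht => by
        have h1 := h.glin (x t) (hx t (by linarith)).le
        have h2 := hb t ht.le
        nlinarith) ht1
    have h3 : c * δ * (t - 1) = y 1 + 1 := by rw [ht]; field_simp; ring
    have h4 := hy t (by linarith)
    linarith
  obtain ⟨t₁, ht₁, hy₁⟩ := stage1
  have hV : ∀ t, HasDerivAt (fun t => c / L * x t + y t)
      (c / L * (y t - F (x t)) + -g (x t)) t :=
    fun t => ((s t).1.const_mul _).add (s t).2
  have hA : 0 < c / L := by positivity
  set η := -y t₁ with hη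
  have hη0 : 0 < η := by linarith
  have hVb : ∀ t, t₁ ≤ t → y t ≤ c / L * x t₁ + y t₁ - (c / L * η) * (t - t₁) := by
    intro t ht
    have := lin_bound (C := -(c / L * η)) hV (fun t ht => by
        have h0 := hx t (by linarith)
        have h1 := h.glin (x t) h0.le
        have h2 := h.Flin (x t) h0.le
        have h3 := hanti t₁ t ht₁ ht.le
        have h4 : c / L * (y t - F (x t)) ≤ c / L * (-η + L * x t) := by
          apply mul_le_mul_of_nonneg_left _ hA.le; linarith
        have h5 : c / L * (L * x t) = c * x t := by field_simp
        have h6 : c / L * (-η + L * x t) = -(c/L*η) + c / L * (L * x t) := by ring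
        linarith) ht
    have h0 := mul_pos hA (hx t (by linarith))
    linarith
  set q := c / L * x t₁ + y t₁ + m + 1 with hq
  set t₂ := t₁ + |q| / (c / L * η) with ht₂
  have hAη : 0 < c / L * η := by positivity
  have ht₂' : t₁ ≤ t₂ := by
    have : 0 ≤ |q| / (c / L * η) := by positivity
    linarith
  have h7 : c / L * η * (t₂ - t₁) = |q| := by rw [ht₂]; field_simp; ring
  have hy2 : y t₂ ≤ -m - 1 := by
    have := hVb t₂ ht₂'
    have := le_abs_self q
    linarith
  have hx2 := hx t₂ (by linarith)
  have h8 := lin_bound (C := -1) (fun t => (s t).1) (a := t₂) (t := t₂ + x t₂) (fun t ht => by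
    have h1 := hanti t₂ t (by linarith) ht.le
    have h2 := h.Flow (x t) (hx t (by linarith)).le
    linarith) (by linarith)
  have h9 := hx (t₂ + x t₂) (by linarith)
  linarith

/-- An arc in the right half plane from `(0, r)` to `(0, -p)`. -/
structure Arc (F g : ℝ → ℝ) (r p T : ℝ) (x y : ℝ → ℝ) : Prop where
  sol : Sol F g x y
  r0 : 0 < r
  T0 : 0 < T
  xa : x 0 = 0
  ya : y 0 = r
  xb : x T = 0
  yb : y T = -p
  pos : ∀ t, 0 < t → t < T → 0 < x t

theorem pos_right {u : ℝ → ℝ} {u' a : ℝ} (h : HasDerivAt u u' a) (h0 : u a = 0) (hu : 0 < u') :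
    ∃ ε > 0, ∀ t, a < t → t < a + ε → 0 < u t := by
  have h1 := (hasDerivAt_iff_tendsto_slope.mp h).eventually (lt_mem_nhds hu)
  rw [eventually_nhdsWithin_iff, Metric.eventually_nhds_iff] at h1
  obtain ⟨ε, hε, h2⟩ := h1
  refine ⟨ε, hε, fun t ht1 ht2 => ?_⟩
  have := h2 (y := t) (by rw [Real.dist_eq, abs_lt]; constructor <;> linarith) (ne_of_gt ht1)
  rw [slope_def_field, h0, sub_zero] at this
  have h3 : 0 < t - a := by linarith
  exact (div_pos_iff_of_pos_right h3).mp this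

theorem LSys.exists_arc (h : LSys f g F G xs m c L) {x y : ℝ → ℝ} (s : Sol F g x y)
    {r : ℝ} (hr : 0 < r) (hx : x 0 = 0) (hy : y 0 = r) : ∃ p T, Arc F g r p T x y := by
  obtain ⟨ε, hε, hpos⟩ := pos_right (s 0).1 hx (by rw [hx, h.F0, hy]; linarith)
  simp only [zero_add] at hpos
  set Z : Set ℝ := {t | ε / 2 ≤ t ∧ x t ≤ 0} with hZ
  have hZc : IsClosed Z := (isClosed_le continuous_const continuous_id).inter
    (isClosed_le s.contx continuous_const)
  have hZn : Z.Nonempty := by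
    by_contra hne
    rw [not_nonempty_iff_eq_empty] at hne
    refine h.no_escape s (fun t ht => ?_)
    by_contra hxt
    push Not at hxt
    rcases lt_or_ge t ε with h1 | h1
    · linarith [hpos t ht h1]
    · have : t ∈ Z := ⟨by linarith, hxt⟩
      rw [hne] at this; exact this
  have hZb : BddBelow Z := ⟨ε / 2, fun t ht => ht.1⟩
  have hT := hZc.csInf_mem hZn hZb
  set T := sInf Z with hTd
  have hpos' : ∀ t, 0 < t → t < T → 0 < x t := by
    intro t h1 h2
    by_contra hxt
    push Not at hxt
    rcases lt_or_ge t ε with h3 | h3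
    · linarith [hpos t h1 h3]
    · have : T ≤ t := csInf_le hZb ⟨by linarith, hxt⟩
      linarith
  have hT0 : 0 < T := by linarith [hT.1]
  refine ⟨-y T, T, s, hr, hT0, hx, hy, le_antisymm hT.2 ?_, by ring, hpos'⟩
  have hcl : T ∈ closure (Ioo 0 T) := by rw [closure_Ioo hT0.ne]; exact ⟨hT0.le, le_rfl⟩
  have hsub : closure (Ioo 0 T) ⊆ {t | 0 ≤ x t} :=
    closure_minimal (fun t ht => (hpos' t ht.1 ht.2).le) (isClosed_le continuous_const s.contx)
  exact hsub hcl

theorem strictMono_seg {u u' : ℝ → ℝ} {a b : ℝ} (hu : ∀ t, HasDerivAt u (u' t) t)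
    (hp : ∀ t, a < t → t < b → 0 < u' t) : StrictMonoOn u (Icc a b) := by
  apply strictMonoOn_of_deriv_pos (convex_Icc a b)
  · exact fun t _ => (hu t).continuousAt.continuousWithinAt
  · intro t ht
    rw [interior_Icc] at ht
    rw [(hu t).deriv]; exact hp t ht.1 ht.2

theorem strictAnti_seg {u u' : ℝ → ℝ} {a b : ℝ} (hu : ∀ t, HasDerivAt u (u' t) t)
    (hp : ∀ t, a < t → t < b → u' t < 0) : StrictAntiOn u (Icc a b) := by
  apply strictAntiOn_of_deriv_neg (convex_Icc a b)
  · exact fun t _ => (hu t).continuousAt.continuousWithinAt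
  · intro t ht
    rw [interior_Icc] at ht
    rw [(hu t).deriv]; exact hp t ht.1 ht.2

theorem anti_seg {u u' : ℝ → ℝ} {a b : ℝ} (hu : ∀ t, HasDerivAt u (u' t) t)
    (hp : ∀ t, a < t → t < b → u' t ≤ 0) : AntitoneOn u (Icc a b) := by
  apply antitoneOn_of_deriv_nonpos (convex_Icc a b)
  · exact fun t _ => (hu t).continuousAt.continuousWithinAt
  · exact fun t _ => (hu t).differentiableAt.differentiableWithinAt
  · intro t ht
    rw [interior_Icc] at ht
    rw [(hu t).deriv]; exact hp t ht.1 ht.2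

theorem inv_seg {u u' : ℝ → ℝ} {a b : ℝ} (hab : a ≤ b) (hu : ∀ t, HasDerivAt u (u' t) t)
    (hp : ∀ t, a < t → t < b → 0 < u' t) :
    ∃ s : ℝ → ℝ, ContinuousOn s (Icc (u a) (u b)) ∧
      (∀ v ∈ Icc (u a) (u b), s v ∈ Icc a b ∧ u (s v) = v) ∧
      (∀ t ∈ Icc a b, s (u t) = t) ∧
      (∀ v ∈ Ioo (u a) (u b), s v ∈ Ioo a b ∧ HasDerivAt s (u' (s v))⁻¹ v) := by
  have hm := strictMono_seg hu hp
  have huc : Continuous u := continuous_iff_continuousAt.mpr fun t => (hu t).continuousAt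
  have hsurj : ∀ v ∈ Icc (u a) (u b), ∃ t ∈ Icc a b, u t = v := fun v hv => by
    have := intermediate_value_Icc hab huc.continuousOn hv
    exact this
  choose! s hs using hsurj
  have hmaps : ∀ t ∈ Icc a b, u t ∈ Icc (u a) (u b) := fun t ht =>
    ⟨hm.monotoneOn (left_mem_Icc.mpr hab) ht ht.1, hm.monotoneOn ht (right_mem_Icc.mpr hab) ht.2⟩
  have hleft : ∀ t ∈ Icc a b, s (u t) = t := fun t ht =>
    hm.injOn (hs _ (hmaps t ht)).1 ht (hs _ (hmaps t ht)).2
  have hcont : ContinuousOn s (Icc (u a) (u b)) := by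
    rw [continuousOn_iff_isClosed]
    intro C hC
    refine ⟨u '' (Icc a b ∩ C), ((isCompact_Icc.inter_right hC).image huc).isClosed, ?_⟩
    ext v
    constructor
    · rintro ⟨h1, h2⟩
      exact ⟨⟨s v, ⟨(hs v h2).1, h1⟩, (hs v h2).2⟩, h2⟩
    · rintro ⟨⟨t, ⟨ht, htC⟩, rfl⟩, h2⟩
      refine ⟨?_, h2⟩
      rw [mem_preimage, hleft t ht]; exact htC
  refine ⟨s, hcont, hs, hleft, fun v hv => ?_⟩
  have hv' := Ioo_subset_Icc_self hv
  obtain ⟨h1, h2⟩ := hs v hv'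
  have h3 : s v ∈ Ioo a b := by
    refine ⟨lt_of_le_of_ne h1.1 ?_, lt_of_le_of_ne h1.2 ?_⟩
    · intro he; rw [← he] at h2; linarith [hv.1]
    · intro he; rw [he] at h2; linarith [hv.2]
  refine ⟨h3, ?_⟩
  exact HasDerivAt.of_local_left_inverse (hcont.continuousAt (Icc_mem_nhds hv.1 hv.2)) (hu (s v))
    (hp _ h3.1 h3.2).ne' (by
      filter_upwards [Icc_mem_nhds hv.1 hv.2] with w hw
      exact (hs w hw).2)

/-- Comparison of two increments after matching the values of `u₁` and `u₂`. -/
theorem cmp_seg {u₁ u₁' u₂ u₂' w₁ w₁' w₂ w₂' : ℝ → ℝ} {a₁ b₁ a₂ b₂ : ℝ}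
    (h1 : a₁ < b₁) (h2 : a₂ < b₂)
    (hu₁ : ∀ t, HasDerivAt u₁ (u₁' t) t) (hu₂ : ∀ t, HasDerivAt u₂ (u₂' t) t)
    (hw₁ : ∀ t, HasDerivAt w₁ (w₁' t) t) (hw₂ : ∀ t, HasDerivAt w₂ (w₂' t) t)
    (hp₁ : ∀ t, a₁ < t → t < b₁ → 0 < u₁' t) (hp₂ : ∀ t, a₂ < t → t < b₂ → 0 < u₂' t)
    (ha : u₁ a₁ = u₂ a₂) (hb : u₁ b₁ = u₂ b₂)
    (hc : ∀ t₁ t₂, a₁ < t₁ → t₁ < b₁ → a₂ < t₂ → t₂ < b₂ → u₁ t₁ = u₂ t₂ →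
      w₂' t₂ / u₂' t₂ < w₁' t₁ / u₁' t₁) :
    w₂ b₂ - w₂ a₂ < w₁ b₁ - w₁ a₁ := by
  obtain ⟨s₁, c₁, m₁, l₁, d₁⟩ := inv_seg h1.le hu₁ hp₁
  obtain ⟨s₂, c₂, m₂, l₂, d₂⟩ := inv_seg h2.le hu₂ hp₂
  rw [← ha, ← hb] at c₂ m₂ d₂
  have hlt : u₁ a₁ < u₁ b₁ :=
    strictMono_seg hu₁ hp₁ (left_mem_Icc.mpr h1.le) (right_mem_Icc.mpr h1.le) h1
  have hw₁c : Continuous w₁ := continuous_iff_continuousAt.mpr fun t => (hw₁ t).continuousAt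
  have hw₂c : Continuous w₂ := continuous_iff_continuousAt.mpr fun t => (hw₂ t).continuousAt
  have key : StrictAntiOn (fun v => w₂ (s₂ v) - w₁ (s₁ v)) (Icc (u₁ a₁) (u₁ b₁)) := by
    apply strictAntiOn_of_deriv_neg (convex_Icc _ _)
    · exact (hw₂c.comp_continuousOn c₂).sub (hw₁c.comp_continuousOn c₁)
    · intro v hv
      rw [interior_Icc] at hv
      have hv' := Ioo_subset_Icc_self hv
      have e1 := (hw₁ (s₁ v)).comp v (d₁ v hv).2
      have e2 := (hw₂ (s₂ v)).comp v (d₂ v hv).2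
      have e3 := e2.sub e1
      have e4 : deriv (fun v => w₂ (s₂ v) - w₁ (s₁ v)) v = _ := e3.deriv
      rw [e4]
      have := hc (s₁ v) (s₂ v) (d₁ v hv).1.1 (d₁ v hv).1.2 (d₂ v hv).1.1 (d₂ v hv).1.2
        ((m₁ v hv').2.trans (m₂ v hv').2.symm)
      rw [div_eq_mul_inv, div_eq_mul_inv] at this
      linarith
  have := key (left_mem_Icc.mpr hlt.le) (right_mem_Icc.mpr hlt.le) hlt
  simp only at this
  rw [l₁ _ (left_mem_Icc.mpr h1.le), l₁ _ (right_mem_Icc.mpr h1.le)] at this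
  rw [ha, hb, l₂ _ (left_mem_Icc.mpr h2.le), l₂ _ (right_mem_Icc.mpr h2.le)] at this
  linarith

variable {r p T : ℝ} {x y : ℝ → ℝ}

theorem LSys.uni (h : LSys f g F G xs m c L) (A : Arc F g r p T x y) :
    ∃ tm, 0 < tm ∧ tm < T ∧ (∀ t, 0 ≤ t → t < tm → 0 < y t - F (x t)) ∧
      (∀ t, tm < t → t ≤ T → y t - F (x t) < 0) := by
  have s := A.sol
  have hfx : Continuous (fun t => f (x t)) := h.fc.comp s.contx
  set I : ℝ → ℝ := fun t => ∫ τ in (0:ℝ)..t, f (x τ) with hI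
  have hId : ∀ t, HasDerivAt I (f (x t)) t := fun t =>
    intervalIntegral.integral_hasDerivAt_right (hfx.intervalIntegrable _ _)
      (hfx.stronglyMeasurableAtFilter _ _) hfx.continuousAt
  have hM : ∀ t, HasDerivAt (fun t => (y t - F (x t)) * Real.exp (I t))
      (-g (x t) * Real.exp (I t)) t := by
    intro t
    have e1 := ((s t).2.sub ((h.hF (x t)).comp t (s t).1)).mul (hId t).exp
    refine e1.congr_deriv ?_
    simp only [Function.comp, Pi.sub_apply]
    ring
  have hanti : StrictAntiOn (fun t => (y t - F (x t)) * Real.exp (I t)) (Icc 0 T) :=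
    strictAnti_seg hM (fun t h1 h2 => by
      have := mul_pos (h.gpos (A.pos t h1 h2)) (Real.exp_pos (I t))
      linarith)
  obtain ⟨tm, htm, hz⟩ := exists_hasDerivAt_eq_zero (f := x) (f' := fun t => y t - F (x t)) A.T0
    s.contx.continuousOn (by rw [A.xa, A.xb]) (fun t _ => (s t).1)
  refine ⟨tm, htm.1, htm.2, fun t h1 h2 => ?_, fun t h1 h2 => ?_⟩
  · have := hanti ⟨h1, by linarith [htm.2]⟩ ⟨htm.1.le, htm.2.le⟩ h2
    simp only [hz, zero_mul] at this
    exact (mul_pos_iff_of_pos_right (Real.exp_pos _)).mp this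
  · have := hanti ⟨htm.1.le, htm.2.le⟩ ⟨by linarith [htm.1], h2⟩ h1
    simp only [hz, zero_mul] at this
    by_contra hc
    push Not at hc
    have := mul_nonneg hc (Real.exp_pos (I t)).le
    linarith

theorem LSys.p0 (h : LSys f g F G xs m c L) (A : Arc F g r p T x y) : 0 < p := by
  obtain ⟨tm, _, h2, _, h4⟩ := h.uni A
  have := h4 T h2 le_rfl
  rw [A.xb, A.yb, h.F0] at this
  linarith

theorem LSys.yanti (h : LSys f g F G xs m c L) (A : Arc F g r p T x y) :
    StrictAntiOn y (Icc 0 T) :=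
  strictAnti_seg (fun t => (A.sol t).2) (fun t h1 h2 => by
    have := h.gpos (A.pos t h1 h2); linarith)

theorem Arc.nonneg (A : Arc F g r p T x y) {t : ℝ} (ht : t ∈ Icc 0 T) : 0 ≤ x t := by
  rcases eq_or_lt_of_le ht.1 with h1 | h1
  · rw [← h1, A.xa]
  · rcases eq_or_lt_of_le ht.2 with h2 | h2
    · rw [h2, A.xb]
    · exact (A.pos t h1 h2).le

theorem LSys.ylevel (_h : LSys f g F G xs m c L) (A : Arc F g r p T x y) {v a b : ℝ}
    (ha : 0 ≤ a) (hb : b ≤ T) (hab : a ≤ b) (h1 : y b ≤ v) (h2 : v ≤ y a) :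
    ∃ t ∈ Icc a b, t ∈ Icc 0 T ∧ y t = v := by
  obtain ⟨t, ht, e⟩ := intermediate_value_Icc' hab A.sol.conty.continuousOn ⟨h1, h2⟩
  exact ⟨t, ht, ⟨ha.trans ht.1, ht.2.trans hb⟩, e⟩

variable {r₁ p₁ T₁ r₂ p₂ T₂ : ℝ} {x₁ y₁ x₂ y₂ : ℝ → ℝ}

theorem LSys.disj_aux (h : LSys f g F G xs m c L) (A₁ : Arc F g r₁ p₁ T₁ x₁ y₁)
    (A₂ : Arc F g r₂ p₂ T₂ x₂ y₂) {t₁ t₂ : ℝ} (h1 : t₁ ∈ Icc 0 T₁)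
    (h2 : t₂ ∈ Icc 0 T₂) (hx : x₁ t₁ = x₂ t₂) (hy : y₁ t₁ = y₂ t₂) : t₂ ≤ t₁ := by
  by_contra hlt
  push Not at hlt
  have e := h.unique_shift A₁.sol A₂.sol hx hy (-t₁)
  rw [add_neg_cancel, A₁.xa, A₁.ya] at e
  rcases eq_or_lt_of_le (show t₂ + -t₁ ≤ T₂ by linarith [h1.1, h2.2]) with h3 | h3
  · rw [h3, A₂.yb] at e
    linarith [e.2, A₁.r0, h.p0 A₂]
  · have := A₂.pos (t₂ + -t₁) (by linarith) h3
    linarith [e.1]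

theorem LSys.disj (h : LSys f g F G xs m c L) (A₁ : Arc F g r₁ p₁ T₁ x₁ y₁)
    (A₂ : Arc F g r₂ p₂ T₂ x₂ y₂) {t₁ t₂ : ℝ} (h1 : t₁ ∈ Icc 0 T₁)
    (h2 : t₂ ∈ Icc 0 T₂) (hx : x₁ t₁ = x₂ t₂) (hy : y₁ t₁ = y₂ t₂) : r₁ = r₂ := by
  have ht : t₂ = t₁ := le_antisymm (h.disj_aux A₁ A₂ h1 h2 hx hy)
    (h.disj_aux A₂ A₁ h2 h1 hx.symm hy.symm)
  subst ht
  have e := h.unique A₁.sol A₂.sol hx hy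
  rw [← A₁.ya, ← A₂.ya, e.2]

theorem LSys.fun_arc (h : LSys f g F G xs m c L) (A₁ : Arc F g r p₁ T₁ x₁ y₁)
    (A₂ : Arc F g r p₂ T₂ x₂ y₂) : p₁ = p₂ := by
  have e := h.unique A₁.sol A₂.sol (t₀ := 0) (by rw [A₁.xa, A₂.xa]) (by rw [A₁.ya, A₂.ya])
  have hT : T₁ = T₂ := by
    rcases lt_trichotomy T₁ T₂ with h1 | h1 | h1
    · have := A₂.pos T₁ A₁.T0 h1
      rw [← e.1, A₁.xb] at this; linarith
    · exact h1
    · have := A₁.pos T₂ A₂.T0 h1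
      rw [e.1, A₂.xb] at this; linarith
  have h1 := A₁.yb
  have h2 := A₂.yb
  rw [e.2, hT] at h1
  linarith

/-- Two arcs with `r₁ < r₂` are never in the wrong order at the same level of `y`. -/
theorem LSys.nested (h : LSys f g F G xs m c L) (A₁ : Arc F g r₁ p₁ T₁ x₁ y₁)
    (A₂ : Arc F g r₂ p₂ T₂ x₂ y₂) (hr : r₁ < r₂) {t₁ t₂ : ℝ} (h1 : t₁ ∈ Icc 0 T₁)
    (h2 : t₂ ∈ Icc 0 T₂) (hy : y₁ t₁ = y₂ t₂) : x₁ t₁ < x₂ t₂ := by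
  by_contra hlt
  push Not at hlt
  obtain ⟨s₁, c₁, m₁, l₁, -⟩ := inv_seg A₁.T0.le (u := fun t => -y₁ t) (u' := fun t => g (x₁ t))
    (fun t => (A₁.sol t).2.neg.congr_deriv (neg_neg _)) (fun t h1 h2 => h.gpos (A₁.pos t h1 h2))
  obtain ⟨s₂, c₂, m₂, l₂, -⟩ := inv_seg A₂.T0.le (u := fun t => -y₂ t) (u' := fun t => g (x₂ t))
    (fun t => (A₂.sol t).2.neg.congr_deriv (neg_neg _)) (fun t h1 h2 => h.gpos (A₂.pos t h1 h2))
  simp only [A₁.ya, A₁.yb, neg_neg] at c₁ m₁ l₁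
  simp only [A₂.ya, A₂.yb, neg_neg] at c₂ m₂ l₂
  set v := -y₁ t₁ with hv
  have hv1 : v ∈ Icc (-r₁) p₁ := by
    have e1 := (h.yanti A₁).antitoneOn ⟨le_rfl, A₁.T0.le⟩ h1 h1.1
    have e2 := (h.yanti A₁).antitoneOn h1 ⟨A₁.T0.le, le_rfl⟩ h1.2
    rw [A₁.ya] at e1; rw [A₁.yb] at e2
    constructor <;> linarith
  have hv2 : v ∈ Icc (-r₂) p₂ := by
    have e1 := (h.yanti A₂).antitoneOn ⟨le_rfl, A₂.T0.le⟩ h2 h2.1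
    have e2 := (h.yanti A₂).antitoneOn h2 ⟨A₂.T0.le, le_rfl⟩ h2.2
    rw [A₂.ya] at e1; rw [A₂.yb] at e2
    constructor <;> linarith
  have hsub1 : Icc (-r₁) v ⊆ Icc (-r₁) p₁ := Icc_subset_Icc le_rfl hv1.2
  have hsub2 : Icc (-r₁) v ⊆ Icc (-r₂) p₂ := Icc_subset_Icc (by linarith) hv2.2
  have hc : ContinuousOn (fun w => x₂ (s₂ w) - x₁ (s₁ w)) (Icc (-r₁) v) :=
    (A₂.sol.contx.comp_continuousOn (c₂.mono hsub2)).sub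
      (A₁.sol.contx.comp_continuousOn (c₁.mono hsub1))
  have hl1 : s₁ (-r₁) = 0 := by
    have := l₁ 0 ⟨le_rfl, A₁.T0.le⟩
    rwa [A₁.ya] at this
  have hl2 : s₂ v = t₂ := by rw [hv, hy]; exact l₂ t₂ h2
  have hl3 : s₁ v = t₁ := l₁ t₁ h1
  have := intermediate_value_Icc' hv1.1 hc (show (0:ℝ) ∈ _ by
    constructor
    · rw [hl2, hl3]; linarith
    · rw [hl1, A₁.xa]
      have := A₂.nonneg (m₂ (-r₁) (hsub2 ⟨le_rfl, hv1.1⟩)).1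
      linarith)
  obtain ⟨w, hw, hw0⟩ := this
  have q1 := m₁ w (hsub1 hw)
  have q2 := m₂ w (hsub2 hw)
  have := h.disj A₁ A₂ q1.1 q2.1 (by simp only at hw0; linarith) (by linarith [q1.2, q2.2])
  linarith

theorem LSys.mono_arc (h : LSys f g F G xs m c L) (A₁ : Arc F g r₁ p₁ T₁ x₁ y₁)
    (A₂ : Arc F g r₂ p₂ T₂ x₂ y₂) (hr : r₁ < r₂) : p₁ < p₂ := by
  by_contra hlt
  push Not at hlt
  obtain ⟨t, ht, _, e⟩ := h.ylevel A₁ (v := -p₂) le_rfl le_rfl A₁.T0.le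
    (by rw [A₁.yb]; linarith) (by rw [A₁.ya]; linarith [A₁.r0, h.p0 A₂])
  have := h.nested A₁ A₂ hr ht ⟨A₂.T0.le, le_rfl⟩ (by rw [e, A₂.yb])
  rw [A₂.xb] at this
  linarith [A₁.nonneg ht]

/-- `tm` is the time at which the arc turns around. -/
structure Uni (F : ℝ → ℝ) (T tm : ℝ) (x y : ℝ → ℝ) : Prop where
  t0 : 0 < tm
  tT : tm < T
  up : ∀ t, 0 ≤ t → t < tm → 0 < y t - F (x t)
  down : ∀ t, tm < t → t ≤ T → y t - F (x t) < 0

theorem LSys.exists_uni (h : LSys f g F G xs m c L) (A : Arc F g r p T x y) :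
    ∃ tm, Uni F T tm x y := by
  obtain ⟨tm, h1, h2, h3, h4⟩ := h.uni A
  exact ⟨tm, h1, h2, h3, h4⟩

variable {tm : ℝ}

theorem Uni.mono (U : Uni F T tm x y) (s : Sol F g x y) : StrictMonoOn x (Icc 0 tm) :=
  strictMono_seg (fun t => (s t).1) (fun t h1 h2 => U.up t h1.le h2)

theorem Uni.anti (U : Uni F T tm x y) (s : Sol F g x y) : StrictAntiOn x (Icc tm T) :=
  strictAnti_seg (fun t => (s t).1) (fun t h1 h2 => U.down t h1 h2.le)

theorem Uni.le (U : Uni F T tm x y) (s : Sol F g x y) {t : ℝ} (ht : t ∈ Icc 0 T) : x t ≤ x tm := by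
  rcases le_total t tm with h1 | h1
  · exact (U.mono s).monotoneOn ⟨ht.1, h1⟩ ⟨U.t0.le, le_rfl⟩ h1
  · exact (U.anti s).antitoneOn ⟨le_rfl, U.tT.le⟩ ⟨h1, ht.2⟩ h1

/-- The two crossings of the level `q`. -/
structure Cross (F : ℝ → ℝ) (q T tm tA tB : ℝ) (x y : ℝ → ℝ) : Prop where
  a0 : 0 < tA
  am : tA < tm
  mb : tm < tB
  bT : tB < T
  xA : x tA = q
  xB : x tB = q
  yA : F q < y tA
  yB : y tB < F q
  left : ∀ t, 0 ≤ t → t < tA → x t < q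
  mid : ∀ t, tA < t → t < tB → q < x t
  right : ∀ t, tB < t → t ≤ T → x t < q

theorem Arc.cross (A : Arc F g r p T x y) (U : Uni F T tm x y) {q : ℝ} (h0 : 0 < q)
    (hq : q < x tm) : ∃ tA tB, Cross F q T tm tA tB x y := by
  have s := A.sol
  obtain ⟨tA, hA, eA⟩ := intermediate_value_Icc U.t0.le s.contx.continuousOn
    (show q ∈ _ from ⟨by rw [A.xa]; exact h0.le, hq.le⟩)
  obtain ⟨tB, hB, eB⟩ := intermediate_value_Icc' U.tT.le s.contx.continuousOn
    (show q ∈ _ from ⟨by rw [A.xb]; exact h0.le, hq.le⟩)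
  have a0 : 0 < tA := lt_of_le_of_ne hA.1 (fun e => by rw [← e, A.xa] at eA; linarith)
  have am : tA < tm := lt_of_le_of_ne hA.2 (fun e => by rw [e] at eA; linarith)
  have mb : tm < tB := lt_of_le_of_ne hB.1 (fun e => by rw [← e] at eB; linarith)
  have bT : tB < T := lt_of_le_of_ne hB.2 (fun e => by rw [e, A.xb] at eB; linarith)
  have hM := U.mono s
  have hN := U.anti s
  refine ⟨tA, tB, a0, am, mb, bT, eA, eB, ?_, ?_, ?_, ?_, ?_⟩
  · have := U.up tA a0.le am
    rw [eA] at this; linarith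
  · have := U.down tB mb bT.le
    rw [eB] at this; linarith
  · intro t h1 h2
    rw [← eA]; exact hM ⟨h1, by linarith⟩ hA h2
  · intro t h1 h2
    rcases le_total t tm with h3 | h3
    · rw [← eA]; exact hM hA ⟨by linarith, h3⟩ h1
    · rw [← eB]; exact hN ⟨h3, by linarith⟩ hB h2
  · intro t h1 h2
    rw [← eB]; exact hN hB ⟨by linarith, h2⟩ h1

theorem LSys.energy (h : LSys f g F G xs m c L) (s : Sol F g x y) (t : ℝ) :
    HasDerivAt (fun t => y t ^ 2 / 2 + G (x t)) (-(g (x t) * F (x t))) t := by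
  have e1 := (((s t).2.pow 2).div_const 2).add ((h.hG (x t)).comp t (s t).1)
  refine e1.congr_deriv ?_
  simp only [Nat.cast_ofNat, Nat.add_one_sub_one, pow_one]
  ring

theorem LSys.Fpos (h : LSys f g F G xs m c L) {q : ℝ} (hq : xs < q) : 0 < F q := by
  have := h.Fmono self_mem_Ici hq.le hq
  rwa [h.Fxs] at this

/-- An arc which does not go beyond `xs` gains energy. -/
theorem LSys.gain_of_le (h : LSys f g F G xs m c L) (A : Arc F g r p T x y) (U : Uni F T tm x y)
    (hle : x tm ≤ xs) : r < p := by
  have s := A.sol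
  have e1 : StrictMonoOn (fun t => y t ^ 2 / 2 + G (x t)) (Icc 0 tm) :=
    strictMono_seg (h.energy s) (fun t h1 h2 => by
      have h3 := A.pos t h1 (h2.trans U.tT)
      have h4 := U.mono s ⟨h1.le, h2.le⟩ ⟨U.t0.le, le_rfl⟩ h2
      have := mul_neg_of_pos_of_neg (h.gpos h3) (h.Fneg _ h3 (by linarith))
      linarith)
  have e2 : StrictMonoOn (fun t => y t ^ 2 / 2 + G (x t)) (Icc tm T) :=
    strictMono_seg (h.energy s) (fun t h1 h2 => by
      have h3 := A.pos t (U.t0.trans h1) h2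
      have h4 := U.anti s ⟨le_rfl, U.tT.le⟩ ⟨h1.le, h2.le⟩ h1
      have := mul_neg_of_pos_of_neg (h.gpos h3) (h.Fneg _ h3 (by linarith))
      linarith)
  have e3 := e1 ⟨le_rfl, U.t0.le⟩ ⟨U.t0.le, le_rfl⟩ U.t0
  have e4 := e2 ⟨le_rfl, U.tT.le⟩ ⟨U.tT.le, le_rfl⟩ U.tT
  simp only [A.xa, A.ya, A.xb, A.yb] at e3 e4
  have hp := h.p0 A
  have hr := A.r0
  nlinarith

/-- Small arcs gain energy. -/
theorem LSys.small (h : LSys f g F G xs m c L) (A : Arc F g r p T x y)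
    (hr : r ^ 2 ≤ 2 * G xs) : r < p := by
  obtain ⟨tm, U⟩ := h.exists_uni A
  have s := A.sol
  rcases le_or_gt (x tm) xs with h1 | h1
  · exact h.gain_of_le A U h1
  obtain ⟨tA, tB, C⟩ := A.cross U h.xs0 h1
  have e2 : StrictMonoOn (fun t => y t ^ 2 / 2 + G (x t)) (Icc tB T) :=
    strictMono_seg (h.energy s) (fun t h1 h2 => by
      have h3 := A.pos t (by linarith [U.t0, C.mb]) h2
      have h4 := C.right t h1 h2.le
      have := mul_neg_of_pos_of_neg (h.gpos h3) (h.Fneg _ h3 (by linarith))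
      linarith)
  have e4 := e2 ⟨le_rfl, C.bT.le⟩ ⟨C.bT.le, le_rfl⟩ C.bT
  simp only [A.xb, A.yb, C.xB, h.G0] at e4
  have hp := h.p0 A
  have hr := A.r0
  nlinarith [sq_nonneg (y tB)]

/-- The energy comparison. -/
theorem LSys.compare (h : LSys f g F G xs m c L) (A₁ : Arc F g r₁ p₁ T₁ x₁ y₁)
    (A₂ : Arc F g r₂ p₂ T₂ x₂ y₂) (hr : r₁ < r₂) (he : p₁ ≤ r₁) :
    p₂ ^ 2 - r₂ ^ 2 < p₁ ^ 2 - r₁ ^ 2 := by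
  obtain ⟨tm₁, U₁⟩ := h.exists_uni A₁
  obtain ⟨tm₂, U₂⟩ := h.exists_uni A₂
  have s₁ := A₁.sol
  have s₂ := A₂.sol
  have hpp := h.mono_arc A₁ A₂ hr
  have hx1 : xs < x₁ tm₁ := by
    by_contra hc
    push Not at hc
    linarith [h.gain_of_le A₁ U₁ hc]
  -- every level of `y₁` is attained by `y₂`
  have lev : ∀ t ∈ Icc 0 T₁, -p₁ ≤ y₁ t ∧ y₁ t ≤ r₁ := by
    intro t ht
    have e1 := (h.yanti A₁).antitoneOn ⟨le_rfl, A₁.T0.le⟩ ht ht.1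
    have e2 := (h.yanti A₁).antitoneOn ht ⟨A₁.T0.le, le_rfl⟩ ht.2
    rw [A₁.ya] at e1; rw [A₁.yb] at e2
    exact ⟨e2, e1⟩
  have hx2 : xs < x₂ tm₂ := by
    have ht : tm₁ ∈ Icc 0 T₁ := ⟨U₁.t0.le, U₁.tT.le⟩
    obtain ⟨t, ht', _, e⟩ := h.ylevel A₂ (v := y₁ tm₁) le_rfl le_rfl A₂.T0.le
      (by rw [A₂.yb]; linarith [lev _ ht]) (by rw [A₂.ya]; linarith [lev _ ht])
    have := h.nested A₁ A₂ hr ht ht' e.symm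
    linarith [U₂.le s₂ ht']
  obtain ⟨a₁, b₁, C₁⟩ := A₁.cross U₁ h.xs0 hx1
  obtain ⟨a₂, b₂, C₂⟩ := A₂.cross U₂ h.xs0 hx2
  have upper : ∀ t₁ t₂, 0 ≤ t₁ → t₁ ≤ tm₁ → 0 ≤ t₂ → t₂ ≤ tm₂ → x₁ t₁ = x₂ t₂ →
      y₁ t₁ < y₂ t₂ := by
    intro t₁ t₂ h1 h2 h3 h4 e
    by_contra hc
    push Not at hc
    have ht : t₁ ∈ Icc 0 T₁ := ⟨h1, by linarith [U₁.tT]⟩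
    obtain ⟨t, ht', ht'', e'⟩ := h.ylevel A₂ (v := y₁ t₁) (a := 0) (b := t₂) le_rfl
      (by linarith [U₂.tT]) h3 hc (by rw [A₂.ya]; linarith [lev _ ht])
    have := h.nested A₁ A₂ hr ht ht'' e'.symm
    have := (U₂.mono s₂).monotoneOn ⟨ht'.1, by linarith [ht'.2]⟩ ⟨h3, h4⟩ ht'.2
    linarith
  have lower : ∀ t₁ t₂, tm₁ ≤ t₁ → t₁ ≤ T₁ → tm₂ ≤ t₂ → t₂ ≤ T₂ → x₁ t₁ = x₂ t₂ →
      y₂ t₂ < y₁ t₁ := by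
    intro t₁ t₂ h1 h2 h3 h4 e
    by_contra hc
    push Not at hc
    have ht : t₁ ∈ Icc 0 T₁ := ⟨by linarith [U₁.t0], h2⟩
    obtain ⟨t, ht', ht'', e'⟩ := h.ylevel A₂ (v := y₁ t₁) (a := t₂) (b := T₂)
      (by linarith [U₂.t0]) le_rfl h4 (by rw [A₂.yb]; linarith [lev _ ht]) hc
    have := h.nested A₁ A₂ hr ht ht'' e'.symm
    have := (U₂.anti s₂).antitoneOn ⟨h3, h4⟩ ⟨by linarith [ht'.1], ht'.2⟩ ht'.1
    linarith
  have hsq : ∀ {x y : ℝ → ℝ}, Sol F g x y → ∀ t, HasDerivAt (fun t => y t ^ 2)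
      (-(2 * y t * g (x t))) t := by
    intro x y s t
    refine ((s t).2.pow 2).congr_deriv ?_
    simp only [Nat.cast_ofNat, Nat.add_one_sub_one, pow_one]
    ring
  -- first part
  have part1 : y₂ a₂ ^ 2 - y₂ 0 ^ 2 < y₁ a₁ ^ 2 - y₁ 0 ^ 2 := by
    refine cmp_seg C₁.a0 C₂.a0 (fun t => (s₁ t).1) (fun t => (s₂ t).1) (hsq s₁) (hsq s₂)
      (fun t h1 h2 => U₁.up t h1.le (h2.trans C₁.am)) (fun t h1 h2 => U₂.up t h1.le (h2.trans C₂.am))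
      (by rw [A₁.xa, A₂.xa]) (by rw [C₁.xA, C₂.xA]) ?_
    intro t₁ t₂ h1 h2 h3 h4 e
    have k1 := U₁.up t₁ h1.le (h2.trans C₁.am)
    have k2 := U₂.up t₂ h3.le (h4.trans C₂.am)
    have k3 := upper t₁ t₂ h1.le (h2.trans C₁.am).le h3.le (h4.trans C₂.am).le e
    have k4 := A₁.pos t₁ h1 (by linarith [C₁.am, U₁.tT])
    have k5 := h.Fneg _ k4 (C₁.left t₁ h1.le h2)
    have k6 := h.gpos k4
    rw [← e] at k2 ⊢
    rw [div_lt_div_iff₀ k2 k1]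
    have := mul_pos k6 (mul_pos (neg_pos.mpr k5) (sub_pos.mpr k3))
    nlinarith
  -- last part
  have part3 : y₂ T₂ ^ 2 - y₂ b₂ ^ 2 < y₁ T₁ ^ 2 - y₁ b₁ ^ 2 := by
    refine cmp_seg C₁.bT C₂.bT (fun t => (s₁ t).1.neg) (fun t => (s₂ t).1.neg) (hsq s₁) (hsq s₂)
      (fun t h1 h2 => by linarith [U₁.down t (C₁.mb.trans h1) h2.le])
      (fun t h1 h2 => by linarith [U₂.down t (C₂.mb.trans h1) h2.le])
      (by simp only [Pi.neg_apply]; rw [C₁.xB, C₂.xB])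
      (by simp only [Pi.neg_apply]; rw [A₁.xb, A₂.xb]) ?_
    intro t₁ t₂ h1 h2 h3 h4 e
    simp only [Pi.neg_apply, neg_inj] at e
    have k1 := U₁.down t₁ (C₁.mb.trans h1) h2.le
    have k2 := U₂.down t₂ (C₂.mb.trans h3) h4.le
    have k3 := lower t₁ t₂ (C₁.mb.trans h1).le h2.le (C₂.mb.trans h3).le h4.le e
    have k4 := A₁.pos t₁ (by linarith [C₁.mb, U₁.t0]) h2
    have k5 := h.Fneg _ k4 (C₁.right t₁ h1 h2.le)
    have k6 := h.gpos k4
    rw [← e] at k2 ⊢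
    rw [div_lt_div_iff₀ (by linarith) (by linarith)]
    have := mul_pos k6 (mul_pos (neg_pos.mpr k5) (sub_pos.mpr k3))
    nlinarith
  -- middle part
  have hma : a₁ ∈ Icc 0 T₁ := ⟨C₁.a0.le, by linarith [C₁.am, U₁.tT]⟩
  have hmb : b₁ ∈ Icc 0 T₁ := ⟨by linarith [C₁.mb, U₁.t0], C₁.bT.le⟩
  have hma2 : a₂ ∈ Icc 0 T₂ := ⟨C₂.a0.le, by linarith [C₂.am, U₂.tT]⟩
  have hmb2 : b₂ ∈ Icc 0 T₂ := ⟨by linarith [C₂.mb, U₂.t0], C₂.bT.le⟩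
  have hab1 : a₁ < b₁ := C₁.am.trans C₁.mb
  have hab2 : a₂ < b₂ := C₂.am.trans C₂.mb
  have hA : y₁ a₁ < y₂ a₂ := upper a₁ a₂ C₁.a0.le C₁.am.le C₂.a0.le C₂.am.le (by rw [C₁.xA, C₂.xA])
  have hB : y₂ b₂ < y₁ b₁ := lower b₁ b₂ C₁.mb.le C₁.bT.le C₂.mb.le C₂.bT.le (by rw [C₁.xB, C₂.xB])
  have hAB := h.yanti A₁ hma hmb hab1
  obtain ⟨α, hα1, hα2, hα⟩ := h.ylevel A₂ (v := y₁ a₁) hma2.1 hmb2.2 hab2.le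
    (by linarith) hA.le
  obtain ⟨β, hβ1, hβ2, hβ⟩ := h.ylevel A₂ (v := y₁ b₁) hma2.1 hmb2.2 hab2.le
    hB.le (by linarith)
  have hαβ : α < β := by
    by_contra hc
    push Not at hc
    have := (h.yanti A₂).antitoneOn hβ2 hα2 hc
    linarith
  have part2 : G (x₂ β) - G (x₂ α) < G (x₁ b₁) - G (x₁ a₁) := by
    refine cmp_seg hab1 hαβ (u₁ := fun t => -y₁ t) (u₂ := fun t => -y₂ t)
      (w₁ := fun t => G (x₁ t)) (w₂ := fun t => G (x₂ t))
      (w₁' := fun t => g (x₁ t) * (y₁ t - F (x₁ t)))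
      (w₂' := fun t => g (x₂ t) * (y₂ t - F (x₂ t)))
      (u₁' := fun t => g (x₁ t)) (u₂' := fun t => g (x₂ t))
      (fun t => (s₁ t).2.neg.congr_deriv (neg_neg _))
      (fun t => (s₂ t).2.neg.congr_deriv (neg_neg _))
      (fun t => (h.hG (x₁ t)).comp t (s₁ t).1) (fun t => (h.hG (x₂ t)).comp t (s₂ t).1)
      (fun t h1 h2 => h.gpos (A₁.pos t (by linarith [hma.1]) (by linarith [hmb.2])))
      (fun t h1 h2 => h.gpos (A₂.pos t (by linarith [hα2.1]) (by linarith [hβ2.2])))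
      (by rw [hα]) (by rw [hβ]) ?_
    intro t₁ t₂ h1 h2 h3 h4 e
    have e' : y₁ t₁ = y₂ t₂ := by linarith
    have k1 := h.gpos (A₁.pos t₁ (by linarith [hma.1]) (by linarith [hmb.2]))
    have k2 := h.gpos (A₂.pos t₂ (by linarith [hα2.1]) (by linarith [hβ2.2]))
    rw [mul_div_cancel_left₀ _ k1.ne', mul_div_cancel_left₀ _ k2.ne', e']
    have k3 := h.nested A₁ A₂ hr ⟨by linarith [hma.1], by linarith [hmb.2]⟩
      ⟨by linarith [hα2.1], by linarith [hβ2.2]⟩ e'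
    have k4 := C₁.mid t₁ h1 h2
    have := h.Fmono k4.le (k4.trans k3).le k3
    linarith
  have eanti : AntitoneOn (fun t => y₂ t ^ 2 / 2 + G (x₂ t)) (Icc a₂ b₂) :=
    anti_seg (h.energy s₂) (fun t h1 h2 => by
      have k := C₂.mid t h1 h2
      have := mul_pos (h.gpos (h.xs0.trans k)) (h.Fpos k)
      linarith)
  have q1 := eanti ⟨le_rfl, hab2.le⟩ hα1 hα1.1
  have q2 := eanti hβ1 ⟨hab2.le, le_rfl⟩ hβ1.2
  simp only [C₂.xA, C₂.xB, hα, hβ] at q1 q2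
  rw [C₁.xA, C₁.xB] at part2
  rw [A₁.ya, A₂.ya] at part1
  rw [A₁.yb, A₂.yb] at part3
  linarith

theorem LSys.Gmono (h : LSys f g F G xs m c L) : MonotoneOn G (Ici 0) := by
  apply monotoneOn_of_deriv_nonneg (convex_Ici 0)
  · exact fun t _ => (h.hG t).continuousAt.continuousWithinAt
  · exact fun t _ => (h.hG t).differentiableAt.differentiableWithinAt
  · intro t ht
    rw [interior_Ici] at ht
    rw [(h.hG t).deriv]; exact h.gnonneg (le_of_lt ht)

theorem LSys.Gxs (h : LSys f g F G xs m c L) : 0 < G xs := by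
  have : StrictMonoOn G (Icc 0 xs) := strictMono_seg h.hG (fun t h1 _ => h.gpos h1)
  have := this ⟨le_rfl, h.xs0.le⟩ ⟨h.xs0.le, le_rfl⟩ h.xs0
  rwa [h.G0] at this

theorem LSys.Fupper (h : LSys f g F G xs m c L) {q v : ℝ} (hq : xs < q) (h0 : 0 ≤ v)
    (hv : v ≤ q) : F v ≤ F q := by
  rcases lt_or_ge v xs with h1 | h1
  · rcases eq_or_lt_of_le h0 with h2 | h2
    · rw [← h2, h.F0]; exact (h.Fpos hq).le
    · linarith [h.Fneg v h2 h1, h.Fpos hq]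
  · exact h.Fmono.monotoneOn h1 hq.le hv

theorem LSys.energy_add (h : LSys f g F G xs m c L) (s : Sol F g x y) (n t : ℝ) :
    HasDerivAt (fun t => y t ^ 2 / 2 + G (x t) + n * y t) (-(g (x t) * (F (x t) + n))) t := by
  refine ((h.energy s t).add ((s t).2.const_mul n)).congr_deriv ?_
  ring

/-- Monotonicity of modified energies over a strip. -/
theorem LSys.strip (h : LSys f g F G xs m c L) (s : Sol F g x y) {n a b : ℝ} (hab : a ≤ b)
    (hx : ∀ t, a < t → t < b → 0 ≤ x t) (hu : ∀ t, a < t → t < b → F (x t) ≤ n)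
    (hl : ∀ t, a < t → t < b → -n ≤ F (x t)) :
    y b ^ 2 / 2 + G (x b) + n * y b ≤ y a ^ 2 / 2 + G (x a) + n * y a ∧
    y a ^ 2 / 2 + G (x a) - n * y a ≤ y b ^ 2 / 2 + G (x b) - n * y b := by
  constructor
  · refine anti_seg (h.energy_add s n) (fun t h1 h2 => ?_) ⟨le_rfl, hab⟩ ⟨hab, le_rfl⟩ hab
    have := mul_nonneg (h.gnonneg (hx t h1 h2)) (show 0 ≤ F (x t) + n by linarith [hl t h1 h2])
    linarith
  · have := anti_seg (fun t => (h.energy_add s (-n) t).neg) (a := a) (b := b) (fun t h1 h2 => ?_)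
      ⟨le_rfl, hab⟩ ⟨hab, le_rfl⟩ hab
    · simp only [Pi.neg_apply] at this
      linarith
    · have := mul_nonneg (h.gnonneg (hx t h1 h2)) (show 0 ≤ n - F (x t) by linarith [hu t h1 h2])
      nlinarith

/-- Large arcs lose energy. -/
theorem LSys.large (h : LSys f g F G xs m c L) : ∃ R : ℝ, ∀ r p T x y,
    Arc F g r p T x y → R ≤ r → p < r := by
  set X := xs + 1 with hX
  have hXs : xs < X := by linarith
  have hX0 : 0 < X := by linarith [h.xs0]
  have hF1 := h.Fpos hXs
  set F1 := F X
  set G1 := G X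
  have hG1 : 0 ≤ G1 := by
    have := h.Gmono (mem_Ici.mpr le_rfl) (mem_Ici.mpr hX0.le) hX0.le
    rwa [h.G0] at this
  obtain ⟨n, hn1, hn2⟩ : ∃ n, m ≤ n ∧ F1 ≤ n := ⟨max m F1, le_max_left _ _, le_max_right _ _⟩
  have hn0 : 0 < n := h.m0.trans_le hn1
  have hd : 0 < n / F1 := div_pos hn0 hF1
  refine ⟨3 * n + 2 * G1 + 2 + n / F1, fun r p T x y A hR => ?_⟩
  by_contra hpr
  push Not at hpr
  have s := A.sol
  obtain ⟨tm, U⟩ := h.exists_uni A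
  have hlow : ∀ v, 0 ≤ v → -n ≤ F v := fun v hv => by linarith [h.Flow v hv]
  have hup : ∀ v, 0 ≤ v → v ≤ X → F v ≤ n := fun v h1 h2 => (h.Fupper hXs h1 h2).trans hn2
  have hp0 := h.p0 A
  have hXm : X < x tm := by
    by_contra hc
    push Not at hc
    obtain ⟨t1, ht1, _, e⟩ := h.ylevel A (v := 0) le_rfl le_rfl A.T0.le
      (by rw [A.yb]; linarith) (by rw [A.ya]; exact A.r0.le)
    have hpos : ∀ t, 0 < t → t < t1 → 0 < x t := fun t h1 h2 => A.pos t h1 (by linarith [ht1.2])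
    have hle : ∀ t, 0 < t → t < t1 → x t ≤ X := fun t h1 h2 =>
      (U.le s ⟨h1.le, by linarith [ht1.2]⟩).trans hc
    have := (h.strip s ht1.1 (n := n) (fun t h1 h2 => (hpos t h1 h2).le)
      (fun t h1 h2 => hup _ (hpos t h1 h2).le (hle t h1 h2))
      (fun t h1 h2 => hlow _ (hpos t h1 h2).le)).2
    rw [A.ya, A.xa, e, h.G0] at this
    have h5 : G (x t1) ≤ G1 := h.Gmono (mem_Ici.mpr (A.nonneg ht1)) (mem_Ici.mpr hX0.le)
      ((U.le s ht1).trans hc)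
    nlinarith
  obtain ⟨tA, tB, C⟩ := A.cross U hX0 hXm
  have pA : ∀ t, 0 < t → t < tA → 0 ≤ x t := fun t h1 h2 =>
    (A.pos t h1 (by linarith [C.am, U.tT])).le
  have pB : ∀ t, tB < t → t < T → 0 ≤ x t := fun t h1 h2 =>
    (A.pos t (by linarith [C.mb, U.t0]) h2).le
  have SA := h.strip s C.a0.le (n := n) pA
      (fun t h1 h2 => hup _ (pA t h1 h2) (C.left t h1.le h2).le)
      (fun t h1 h2 => hlow _ (pA t h1 h2))
  have SB := h.strip s C.bT.le (n := n) pB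
      (fun t h1 h2 => hup _ (pB t h1 h2) (C.right t h1 h2.le).le)
      (fun t h1 h2 => hlow _ (pB t h1 h2))
  have hAB : tA ≤ tB := (C.am.trans C.mb).le
  have SM := anti_seg (h.energy_add s (-F1)) (a := tA) (b := tB) (fun t h1 h2 => by
      have k := C.mid t h1 h2
      have k1 := h.Fupper (hXs.trans k) hX0.le k.le
      have := mul_nonneg (h.gnonneg (hX0.trans k).le) (show 0 ≤ F (x t) + -F1 by linarith)
      linarith) ⟨le_rfl, hAB⟩ ⟨hAB, le_rfl⟩ hAB
  have yA := C.yA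
  have yB := C.yB
  have ymA := (h.yanti A) ⟨le_rfl, A.T0.le⟩ ⟨C.a0.le, by linarith [C.am, U.tT]⟩ C.a0
  have ymB := (h.yanti A) ⟨by linarith [C.mb, U.t0], C.bT.le⟩ ⟨A.T0.le, le_rfl⟩ C.bT
  simp only [A.ya, A.yb, A.xa, A.xb, C.xA, C.xB, h.G0] at SA SB SM ymA ymB
  change F1 < _ at yA
  change _ < F1 at yB
  change (_ + G1 + _ ≤ _) ∧ (_ ≤ _ + G1 - _) at SA
  change (_ ≤ _ + G1 + _) ∧ (_ + G1 - _ ≤ _) at SB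
  change (_ + G1 + _ ≤ _ + G1 + _) at SM
  generalize y tA = a at *
  obtain ⟨b, hb⟩ : ∃ b, y tB = -b := ⟨-y tB, by ring⟩
  rw [hb] at SB SM yB ymB
  obtain ⟨SA1, SA2⟩ := SA
  obtain ⟨SB1, SB2⟩ := SB
  have ra : r - a ≤ 1 := by
    by_contra hc
    push Not at hc
    have : 0 < (r - a - 1) * (r + a - 2 * n) := mul_pos (by linarith) (by linarith)
    nlinarith
  have pb : p - b ≤ 1 := by
    by_contra hc
    push Not at hc
    have : 0 < (p - b - 1) * (p + b - 2 * n) := mul_pos (by linarith) (by linarith)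
    nlinarith
  have k1 : a ^ 2 + 2 * G1 ≤ r ^ 2 + 2 * n := by nlinarith
  have k2 : p ^ 2 ≤ b ^ 2 + 2 * G1 + 2 * n := by nlinarith
  have k3 : b ^ 2 - a ^ 2 ≤ -(2 * F1 * (a + b)) := by nlinarith
  have k4 : n < F1 * (r - 1) := by
    have : n / F1 < r - 1 := by linarith
    rwa [div_lt_iff₀' hF1] at this
  nlinarith

/-- A symmetric arc exists. -/
theorem LSys.exists_cycle (h : LSys f g F G xs m c L) : ∃ r T x y, Arc F g r r T x y := by
  have hex : ∀ r : ℝ, 0 < r → ∃ p, ∃ T x y, Arc F g r p T x y := by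
    intro r hr
    obtain ⟨x, y, s, h1, h2⟩ := h.exists_sol 0 r
    obtain ⟨p, T, A⟩ := h.exists_arc s hr h1 h2
    exact ⟨p, T, x, y, A⟩
  choose! P hP using hex
  have hmono : ∀ r₁ r₂, 0 < r₁ → r₁ ≤ r₂ → P r₁ ≤ P r₂ := by
    intro r₁ r₂ h1 h2
    rcases eq_or_lt_of_le h2 with e | e
    · rw [e]
    · obtain ⟨_, _, _, A₁⟩ := hP r₁ h1
      obtain ⟨_, _, _, A₂⟩ := hP r₂ (h1.trans e)
      exact (h.mono_arc A₁ A₂ e).le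
  obtain ⟨R, hR⟩ := h.large
  set r1 := Real.sqrt (2 * G xs)
  have hr1 : 0 < r1 := Real.sqrt_pos.mpr (by linarith [h.Gxs])
  have hr1s : r1 ^ 2 ≤ 2 * G xs := (Real.sq_sqrt (by linarith [h.Gxs])).le
  set r2 := max R r1
  have h12 : r1 ≤ r2 := le_max_right _ _
  have hP1 : r1 < P r1 := by
    obtain ⟨_, _, _, A⟩ := hP r1 hr1
    exact h.small A hr1s
  have hP2 : P r2 < r2 := by
    obtain ⟨_, _, _, A⟩ := hP r2 (hr1.trans_le h12)
    exact hR _ _ _ _ _ A (le_max_left _ _)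
  set S := {r | r1 ≤ r ∧ r ≤ r2 ∧ r ≤ P r} with hS
  have hS1 : r1 ∈ S := ⟨le_rfl, h12, hP1.le⟩
  have hb : BddAbove S := ⟨r2, fun r hr => hr.2.1⟩
  set q := sSup S
  have hq1 : r1 ≤ q := le_csSup hb hS1
  have hq2 : q ≤ r2 := csSup_le ⟨_, hS1⟩ (fun r hr => hr.2.1)
  have hq0 : 0 < q := hr1.trans_le hq1
  have hqP : q ≤ P q := csSup_le ⟨_, hS1⟩ (fun r hr =>
    hr.2.2.trans (hmono r q (hr1.trans_le hr.1) (le_csSup hb hr)))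
  have hPq2 : P q ≤ r2 := (hmono q r2 hq0 hq2).trans hP2.le
  have hPq : P q ≤ q := le_csSup hb ⟨hq1.trans hqP, hPq2, hmono _ _ hq0 hqP⟩
  obtain ⟨T, x, y, A⟩ := hP q hq0
  rw [le_antisymm hPq hqP] at A
  exact ⟨q, T, x, y, A⟩

theorem LSys.cycle_anti (h : LSys f g F G xs m c L) (A : Arc F g r r T x y) (t : ℝ) :
    x (T + t) = -x t ∧ y (T + t) = -y t := by
  have := h.unique_shift A.sol (A.sol.neg h) (a := T) (b := 0)
    (by rw [A.xb, A.xa, neg_zero]) (by rw [A.yb, A.ya]) t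
  simpa using this

theorem LSys.gain_of_lt (h : LSys f g F G xs m c L) (C : Arc F g r r T x y)
    (A : Arc F g r₁ p₁ T₁ x₁ y₁) (hr : r₁ < r) : r₁ < p₁ := by
  by_contra hc
  push Not at hc
  have := h.compare A C hr hc
  have := h.p0 A
  nlinarith

theorem LSys.loss_of_gt (h : LSys f g F G xs m c L) (C : Arc F g r r T x y)
    (A : Arc F g r₁ p₁ T₁ x₁ y₁) (hr : r < r₁) : p₁ < r₁ := by
  have := h.compare C A hr le_rfl
  have := A.r0
  nlinarith

/-- Every nonconstant periodic solution is a translate of the cycle. -/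
theorem LSys.periodic_eq (h : LSys f g F G xs m c L) (C : Arc F g r r T x y)
    (s : Sol F g x₁ y₁) (hT : 0 < T₁) (px : Function.Periodic x₁ T₁)
    (py : Function.Periodic y₁ T₁) (hn : ¬ ∃ c, ∀ t, x₁ t = c) :
    ∃ a, ∀ t, x₁ (a + t) = x t ∧ y₁ (a + t) = y t := by
  set V : Set ℝ := {v | ∃ t, x₁ t = 0 ∧ |y₁ t| = v} with hV
  have Vc : IsCompact V := by
    have : V = (fun t => |y₁ t|) '' ({t | x₁ t = 0} ∩ Icc 0 T₁) := by
      ext v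
      constructor
      · rintro ⟨t, h1, h2⟩
        obtain ⟨t', ht', e1, e2⟩ : ∃ t' ∈ Ico 0 T₁, x₁ t' = x₁ t ∧ y₁ t' = y₁ t := by
          refine ⟨toIcoMod hT 0 t, by simpa using toIcoMod_mem_Ico hT 0 t, ?_, ?_⟩
          · rw [toIcoMod, px.sub_zsmul_eq]
          · rw [toIcoMod, py.sub_zsmul_eq]
        exact ⟨t', ⟨by show x₁ t' = 0; rw [e1, h1], ht'.1, ht'.2.le⟩, by simp only [e2, h2]⟩
      · rintro ⟨t, ⟨h1, _⟩, h2⟩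
        exact ⟨t, h1, h2⟩
    rw [this]
    refine IsCompact.image ?_ s.conty.abs
    exact isCompact_Icc.inter_left (isClosed_eq s.contx continuous_const)
  have Vne : V.Nonempty := by
    by_contra hc
    have hz : ∀ t, x₁ t ≠ 0 := fun t ht => hc ⟨_, t, ht, rfl⟩
    rcases lt_or_gt_of_ne (hz 0) with h0 | h0
    · refine h.no_escape (s.neg h) (fun t ht => ?_)
      by_contra hc'
      obtain ⟨u, _, hu⟩ := intermediate_value_Icc ht.le s.contx.continuousOn
        (show (0:ℝ) ∈ _ from ⟨h0.le, by linarith⟩)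
      exact hz u hu
    · refine h.no_escape s (fun t ht => ?_)
      by_contra hc'
      obtain ⟨u, _, hu⟩ := intermediate_value_Icc' ht.le s.contx.continuousOn
        (show (0:ℝ) ∈ _ from ⟨by linarith, h0.le⟩)
      exact hz u hu
  have Vpos : ∀ v ∈ V, 0 < v := by
    rintro v ⟨t, h1, h2⟩
    rw [← h2, abs_pos]
    intro h3
    have z : Sol F g (fun _ => 0) (fun _ => 0) := by
      intro t
      simp only [h.F0, h.g0, sub_zero, neg_zero]
      exact ⟨hasDerivAt_const t 0, hasDerivAt_const t 0⟩
    have := (h.unique s z (t₀ := t) h1 h3).1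
    exact hn ⟨0, fun t => by rw [this]⟩
  have step : ∀ v ∈ V, ∃ p ∈ V, ∃ T x y, Arc F g v p T x y := by
    intro v hv
    have v0 := Vpos v hv
    obtain ⟨t, h1, h2⟩ := hv
    rcases eq_or_eq_neg_of_abs_eq h2 with e | e
    · obtain ⟨p, T', A⟩ := h.exists_arc (s.shift t) v0 (by simpa using h1) (by simpa using e)
      refine ⟨p, ⟨T' + t, A.xb, ?_⟩, T', _, _, A⟩
      have : y₁ (T' + t) = -p := A.yb
      rw [this, abs_neg, abs_of_pos (h.p0 A)]
    · obtain ⟨p, T', A⟩ := h.exists_arc ((s.neg h).shift t) v0 (by simpa using h1)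
        (by simp [e])
      refine ⟨p, ⟨T' + t, neg_eq_zero.mp A.xb, ?_⟩, T', _, _, A⟩
      have : -y₁ (T' + t) = -p := A.yb
      rw [neg_inj.mp this, abs_of_pos (h.p0 A)]
  have key : r ∈ V := by
    by_contra hr
    rcases (V ∩ Ici r).eq_empty_or_nonempty with he | hne
    · obtain ⟨v, hv, hmax⟩ := Vc.exists_isMaxOn Vne continuous_id.continuousOn
      obtain ⟨p, hp, _, _, _, A⟩ := step v hv
      have hvr : v < r := by
        by_contra hc
        push Not at hc
        exact (he ▸ (⟨hv, hc⟩ : v ∈ V ∩ Ici r) : v ∈ (∅ : Set ℝ))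
      have h1 := h.gain_of_lt C A hvr
      have h2 : p ≤ v := hmax hp
      linarith
    · obtain ⟨v, ⟨hv, hvr⟩, hmin⟩ := (Vc.inter_right isClosed_Ici).exists_isMinOn hne
        continuous_id.continuousOn
      obtain ⟨p, hp, _, _, _, A⟩ := step v hv
      have hvr' : r < v := lt_of_le_of_ne hvr (fun e => hr (e ▸ hv))
      have h1 := h.loss_of_gt C A hvr'
      have h2 := h.mono_arc C A hvr'
      have h3 : v ≤ p := hmin (⟨hp, h2.le⟩ : p ∈ V ∩ Ici r)
      linarith
  obtain ⟨t, h1, h2⟩ := key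
  rcases eq_or_eq_neg_of_abs_eq h2 with e | e
  · refine ⟨t, fun u => ?_⟩
    have := h.unique_shift s C.sol (a := t) (b := 0) (by rw [h1, C.xa]) (by rw [e, C.ya]) u
    simpa using this
  · refine ⟨t - T, fun u => ?_⟩
    have := h.unique_shift s C.sol (a := t) (b := T) (by rw [h1, C.xb]) (by rw [e, C.yb]) (u - T)
    have e1 : t + (u - T) = t - T + u := by ring
    have e2 : T + (u - T) = u := by ring
    rwa [e1, e2] at this

theorem LSys.toSol (h : LSys f g F G xs m c L) (hx : ContDiff ℝ 2 x)
    (ode : ∀ t, deriv (deriv x) t + f (x t) * deriv x t + g (x t) = 0) :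
    Sol F g x (fun t => deriv x t + F (x t)) := by
  intro t
  have d1 : HasDerivAt x (deriv x t) t := (hx.differentiable (by norm_num) t).hasDerivAt
  have hx' : ContDiff ℝ 1 (deriv x) := by
    have : ContDiff ℝ (1 + 1) x := by simpa [one_add_one_eq_two] using hx
    exact (contDiff_succ_iff_deriv.mp this).2.2
  have d2 : HasDerivAt (deriv x) (deriv (deriv x) t) t :=
    (hx'.differentiable (by norm_num) t).hasDerivAt
  refine ⟨d1.congr_deriv (by ring), (d2.add ((h.hF (x t)).comp t d1)).congr_deriv ?_⟩
  linarith [ode t]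

theorem Sol.deriv_eq (s : Sol F g x y) : deriv x = fun t => y t - F (x t) :=
  funext fun t => (s t).1.deriv

theorem LSys.ofSol (h : LSys f g F G xs m c L) (s : Sol F g x y) :
    ContDiff ℝ 2 x ∧ ∀ t, deriv (deriv x) t + f (x t) * deriv x t + g (x t) = 0 := by
  have dd : ∀ t, HasDerivAt (deriv x) (-g (x t) - f (x t) * (y t - F (x t))) t := by
    intro t
    rw [s.deriv_eq]
    exact (s t).2.sub ((h.hF (x t)).comp t (s t).1)
  constructor
  · have : ContDiff ℝ (1 + 1) x := by
      rw [contDiff_succ_iff_deriv]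
      refine ⟨fun t => (s t).1.differentiableAt, by simp, ?_⟩
      rw [contDiff_one_iff_deriv]
      refine ⟨fun t => (dd t).differentiableAt, ?_⟩
      rw [funext fun t => (dd t).deriv]
      have hg := h.gC.continuous.comp s.contx
      have hf := h.fc.comp s.contx
      have hF := h.FC.continuous.comp s.contx
      exact hg.neg.sub (hf.mul (s.conty.sub hF))
    simpa [one_add_one_eq_two] using this
  · intro t
    rw [(dd t).deriv, s.deriv_eq]
    ring

/-- The Liénard theorem. -/
theorem LSys.main (h : LSys f g F G xs m c L) :
    (∃ T > (0:ℝ), ∃ x : ℝ → ℝ, ContDiff ℝ 2 x ∧ ¬ (∃ c, ∀ t, x t = c) ∧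
      (∀ t, x (t + T) = x t) ∧
      (∀ t, deriv (deriv x) t + f (x t) * deriv x t + g (x t) = 0)) ∧
    (∀ x₁ x₂ : ℝ → ℝ, ∀ T₁ T₂ : ℝ,
      ContDiff ℝ 2 x₁ → 0 < T₁ → (∀ t, x₁ (t + T₁) = x₁ t) → ¬ (∃ c, ∀ t, x₁ t = c) →
      (∀ t, deriv (deriv x₁) t + f (x₁ t) * deriv x₁ t + g (x₁ t) = 0) →
      ContDiff ℝ 2 x₂ → 0 < T₂ → (∀ t, x₂ (t + T₂) = x₂ t) → ¬ (∃ c, ∀ t, x₂ t = c) →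
      (∀ t, deriv (deriv x₂) t + f (x₂ t) * deriv x₂ t + g (x₂ t) = 0) →
      Set.range (fun t => (x₁ t, deriv x₁ t)) = Set.range (fun t => (x₂ t, deriv x₂ t))) := by
  obtain ⟨r, T, x, y, C⟩ := h.exists_cycle
  constructor
  · obtain ⟨h1, h2⟩ := h.ofSol C.sol
    refine ⟨T + T, by linarith [C.T0], x, h1, ?_, ?_, h2⟩
    · rintro ⟨c, hc⟩
      have := C.pos (T / 2) (by linarith [C.T0]) (by linarith [C.T0])
      rw [hc, ← hc 0, C.xa] at this
      exact lt_irrefl _ this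
    · intro t
      rw [show t + (T + T) = T + (T + t) by ring, (h.cycle_anti C _).1, (h.cycle_anti C _).1,
        neg_neg]
  · have key : ∀ z : ℝ → ℝ, ∀ T₁ : ℝ, ContDiff ℝ 2 z → 0 < T₁ → (∀ t, z (t + T₁) = z t) →
        ¬ (∃ c, ∀ t, z t = c) →
        (∀ t, deriv (deriv z) t + f (z t) * deriv z t + g (z t) = 0) →
        Set.range (fun t => (z t, deriv z t)) = Set.range (fun t => (x t, y t - F (x t))) := by
      intro z T₁ hz hT hp hn ode
      have s := h.toSol hz ode
      have pd : ∀ t, deriv z (t + T₁) = deriv z t := by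
        intro t
        have : (fun t => z (t + T₁)) = z := funext hp
        rw [← deriv_comp_add_const, this]
      obtain ⟨a, ha⟩ := h.periodic_eq C s hT hp (fun t => by simp only [hp, pd]) hn
      have e : ∀ t, (z (a + t), deriv z (a + t)) = (x t, y t - F (x t)) := by
        intro t
        obtain ⟨e1, e2⟩ := ha t
        rw [← e2, ← e1]
        simp
      ext w
      constructor
      · rintro ⟨t, rfl⟩
        exact ⟨t - a, by simp only [← e, add_sub_cancel]⟩
      · rintro ⟨t, rfl⟩
        exact ⟨a + t, e t⟩
    intro x₁ x₂ T₁ T₂ a1 a2 a3 a4 a5 b1 b2 b3 b4 b5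
    rw [key x₁ T₁ a1 a2 a3 a4 a5, key x₂ T₂ b1 b2 b3 b4 b5]

theorem inst {μ k α τ₀ σ : ℝ} (hμ : 0 < μ) (hk : 0 < k) (hα : 0 < α) (hσ : 0 < σ)
    (hcrit : μ < α * τ₀) {τ f g : ℝ → ℝ}
    (hτ : ∀ x, τ x = τ₀ * Real.exp (-x ^ 2 / (2 * σ ^ 2)))
    (hf : ∀ x, f x = (μ - α * τ x) / (1 + α * τ x ^ 2 / 2))
    (hg : ∀ x, g x = (k + α) * x / (1 + α * τ x ^ 2 / 2)) :
    ∃ F G xs m c L, LSys f g F G xs m c L := by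
  have hτ0 : 0 < τ₀ := by
    by_contra hc
    push Not at hc
    nlinarith [mul_nonneg hα.le (neg_nonneg.mpr hc)]
  have hτpos : ∀ x, 0 < τ x := fun x => by rw [hτ]; positivity
  have hτle : ∀ x, τ x ≤ τ₀ := fun x => by
    rw [hτ]
    have : Real.exp (-x ^ 2 / (2 * σ ^ 2)) ≤ 1 := by
      rw [Real.exp_le_one_iff, neg_div]
      have : 0 ≤ x ^ 2 / (2 * σ ^ 2) := by positivity
      linarith
    nlinarith
  have hτsq : ∀ x, τ x ^ 2 ≤ τ₀ ^ 2 := fun x => by nlinarith [hτpos x, hτle x]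
  have hτneg : ∀ x, τ (-x) = τ x := fun x => by rw [hτ, hτ]; simp
  have hτanti : ∀ u v, 0 ≤ u → u < v → τ v < τ u := by
    intro u v h1 h2
    rw [hτ, hτ]
    refine mul_lt_mul_of_pos_left (Real.exp_lt_exp.mpr ?_) hτ0
    have : 0 < 2 * σ ^ 2 := by positivity
    refine div_lt_div_of_pos_right ?_ this
    nlinarith
  have hD1 : ∀ x, 1 ≤ 1 + α * τ x ^ 2 / 2 := fun x => by
    have := hτpos x
    have : 0 ≤ α * τ x ^ 2 / 2 := by positivity
    linarith
  have hD0 : ∀ x, 0 < 1 + α * τ x ^ 2 / 2 := fun x => by linarith [hD1 x]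
  set D0 := 1 + α * τ₀ ^ 2 / 2 with hD0def
  have hD2 : ∀ x, 1 + α * τ x ^ 2 / 2 ≤ D0 := fun x => by
    have := mul_le_mul_of_nonneg_left (hτsq x) hα.le
    linarith
  have hD0pos : 0 < D0 := by positivity
  have τC : ContDiff ℝ 1 τ := by
    rw [funext hτ]; fun_prop
  have DC : ContDiff ℝ 1 (fun x => 1 + α * τ x ^ 2 / 2) := by fun_prop
  have fC : Continuous f := by
    rw [funext hf]
    exact (by fun_prop : Continuous fun x => μ - α * τ x).div DC.continuous (fun x => (hD0 x).ne')
  have gC : ContDiff ℝ 1 g := by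
    rw [funext hg]
    exact (by fun_prop : ContDiff ℝ 1 fun x => (k + α) * x).div DC (fun x => (hD0 x).ne')
  set F : ℝ → ℝ := fun x => ∫ t in (0:ℝ)..x, f t with hFdef
  set G : ℝ → ℝ := fun x => ∫ t in (0:ℝ)..x, g t with hGdef
  have hF : ∀ x, HasDerivAt F (f x) x := fun x => (fC.integral_hasStrictDerivAt 0 x).hasDerivAt
  have hG : ∀ x, HasDerivAt G (g x) x := fun x =>
    (gC.continuous.integral_hasStrictDerivAt 0 x).hasDerivAt
  have F0 : F 0 = 0 := by simp [hFdef]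
  have G0 : G 0 = 0 := by simp [hGdef]
  have feven : ∀ x, f (-x) = f x := fun x => by rw [hf, hf, hτneg]
  have Fodd : ∀ x, F (-x) = -F x := by
    intro x
    have : ∫ t in (0:ℝ)..x, f (-t) = ∫ t in (-x)..(-0), f t := intervalIntegral.integral_comp_neg f
    simp only [feven, neg_zero] at this
    simp only [hFdef]
    rw [this, intervalIntegral.integral_symm]
  have godd : ∀ x, g (-x) = -g x := fun x => by rw [hg, hg, hτneg]; ring
  set L := μ + α * τ₀ with hL
  have L0 : 0 < L := by positivity
  have fb : ∀ x, |f x| ≤ L := by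
    intro x
    rw [hf, abs_div, abs_of_pos (hD0 x), div_le_iff₀ (hD0 x)]
    have h1 := mul_le_mul_of_nonneg_left (hτle x) hα.le
    have h2 := mul_pos hα (hτpos x)
    have h3 : |μ - α * τ x| ≤ L := by rw [abs_le]; constructor <;> linarith
    nlinarith [hD1 x]
  have FL : LipschitzWith ⟨L, L0.le⟩ F := by
    refine lipschitzWith_of_nnnorm_deriv_le (fun x => (hF x).differentiableAt) (fun x => ?_)
    rw [(hF x).deriv]
    exact fb x
  have Flin : ∀ x, 0 ≤ x → -(L * x) ≤ F x := by
    intro x hx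
    have := FL.dist_le_mul x 0
    rw [Real.dist_eq, Real.dist_eq, F0, sub_zero, sub_zero, abs_of_nonneg hx] at this
    exact (abs_le.mp this).1
  have gL : ∃ K : ℝ≥0, LipschitzWith K g := by
    set K := (k + α) * (1 + 2 * α * τ₀ ^ 2)
    have K0 : 0 ≤ K := by positivity
    refine ⟨⟨K, K0⟩, ?_⟩
    have τd : ∀ x, HasDerivAt τ (-(τ x * (x / σ ^ 2))) x := by
      intro x
      have e : HasDerivAt (fun x : ℝ => -x ^ 2 / (2 * σ ^ 2)) (-(x / σ ^ 2)) x := by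
        refine (((hasDerivAt_id x).pow 2).neg.div_const (2 * σ ^ 2)).congr_deriv ?_
        simp
        field_simp
      have e2 := e.exp.const_mul τ₀
      rw [← funext hτ] at e2
      refine e2.congr_deriv ?_
      rw [hτ]; ring
    have Dd : ∀ x, HasDerivAt (fun x => 1 + α * τ x ^ 2 / 2) (-(α * τ x ^ 2 * (x / σ ^ 2))) x := by
      intro x
      refine (((((τd x).pow 2).const_mul α).div_const 2).const_add 1).congr_deriv ?_
      simp
      ring
    have gd : ∀ x, HasDerivAt g ((k + α) * (1 + α * τ x ^ 2 / 2 + α * τ x ^ 2 * (x ^ 2 / σ ^ 2)) /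
        (1 + α * τ x ^ 2 / 2) ^ 2) x := by
      intro x
      have e := (((hasDerivAt_id x).const_mul (k + α))).div (Dd x) (hD0 x).ne'
      have e' : g = (fun x => (k + α) * id x) / (fun x => 1 + α * τ x ^ 2 / 2) := by
        funext x
        simp [hg]
      rw [e']
      refine e.congr_deriv ?_
      simp only [id]
      ring
    refine lipschitzWith_of_nnnorm_deriv_le (fun x => (gd x).differentiableAt) (fun x => ?_)
    rw [(gd x).deriv]
    have hb : τ x ^ 2 * (x ^ 2 / σ ^ 2) ≤ τ₀ ^ 2 := by
      have e1 : τ x ^ 2 = τ₀ ^ 2 * Real.exp (-(x ^ 2 / σ ^ 2)) := by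
        rw [hτ, mul_pow, ← Real.exp_nat_mul]
        congr 2
        push_cast
        field_simp
      have e2 : x ^ 2 / σ ^ 2 ≤ Real.exp (x ^ 2 / σ ^ 2) := by
        linarith [Real.add_one_le_exp (x ^ 2 / σ ^ 2)]
      have e3 : Real.exp (-(x ^ 2 / σ ^ 2)) * (x ^ 2 / σ ^ 2) ≤ 1 := by
        rw [Real.exp_neg, inv_mul_le_iff₀ (Real.exp_pos _)]
        linarith
      rw [e1, mul_assoc]
      have : 0 ≤ τ₀ ^ 2 := by positivity
      nlinarith
    have hb0 : 0 ≤ α * τ x ^ 2 * (x ^ 2 / σ ^ 2) := by positivity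
    change ‖_‖ ≤ K
    have hN : 0 ≤ 1 + α * τ x ^ 2 / 2 + α * τ x ^ 2 * (x ^ 2 / σ ^ 2) := by linarith [hD0 x]
    rw [Real.norm_eq_abs, abs_of_nonneg (by positivity), div_le_iff₀ (by have := hD0 x; positivity)]
    have h1 : (1:ℝ) ≤ (1 + α * τ x ^ 2 / 2) ^ 2 := by nlinarith [hD1 x]
    have h2 : 1 + α * τ x ^ 2 / 2 + α * τ x ^ 2 * (x ^ 2 / σ ^ 2) ≤ 1 + 2 * α * τ₀ ^ 2 := by
      have h3 := mul_le_mul_of_nonneg_left hb hα.le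
      have h4 := hD2 x
      have h5 : 0 ≤ α * τ₀ ^ 2 := by positivity
      rw [hD0def] at h4
      linarith
    have h6 : (k + α) * (1 + α * τ x ^ 2 / 2 + α * τ x ^ 2 * (x ^ 2 / σ ^ 2)) ≤ K :=
      mul_le_mul_of_nonneg_left h2 (by linarith)
    nlinarith
  -- the zero of `f`
  set l := Real.log (α * τ₀ / μ) with hl
  have hq : 1 < α * τ₀ / μ := by rw [lt_div_iff₀ hμ]; linarith
  have l0 : 0 < l := Real.log_pos hq
  set a := σ * Real.sqrt (2 * l) with ha
  have a0 : 0 < a := mul_pos hσ (Real.sqrt_pos.mpr (by linarith))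
  have hτa : α * τ a = μ := by
    have e : -a ^ 2 / (2 * σ ^ 2) = -l := by
      rw [ha, mul_pow, Real.sq_sqrt (by linarith)]
      field_simp
    rw [hτ, e, Real.exp_neg, hl, Real.exp_log (by linarith)]
    field_simp
  have fneg : ∀ x, 0 ≤ x → x < a → f x < 0 := by
    intro x h1 h2
    rw [hf]
    have := mul_lt_mul_of_pos_left (hτanti x a h1 h2) hα
    exact div_neg_of_neg_of_pos (by linarith) (hD0 x)
  have fpos : ∀ x, a < x → 0 < f x := by
    intro x h1
    rw [hf]
    have := mul_lt_mul_of_pos_left (hτanti a x a0.le h1) hα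
    exact div_pos (by linarith) (hD0 x)
  have Fanti : StrictAntiOn F (Icc 0 a) := strictAnti_seg hF (fun t h1 h2 => fneg t h1.le h2)
  have Fmono : StrictMonoOn F (Ici a) := by
    apply strictMonoOn_of_deriv_pos (convex_Ici a)
    · exact fun t _ => (hF t).continuousAt.continuousWithinAt
    · intro t ht
      rw [interior_Ici] at ht
      rw [(hF t).deriv]; exact fpos t ht
  have Fa : F a < 0 := by
    have := Fanti ⟨le_rfl, a0.le⟩ ⟨a0.le, le_rfl⟩ a0
    rwa [F0] at this
  obtain ⟨b, hab, Fb⟩ : ∃ b, a < b ∧ 0 < F b := by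
    set δ := (μ - α * τ (a + 1)) / D0 with hδ
    have hδ' : 0 < μ - α * τ (a + 1) := by
      have := mul_lt_mul_of_pos_left (hτanti a (a + 1) a0.le (by linarith)) hα
      linarith
    have δ0 : 0 < δ := div_pos hδ' hD0pos
    have fδ : ∀ x, a + 1 < x → δ ≤ f x := by
      intro x hx
      rw [hf, hδ]
      have := mul_lt_mul_of_pos_left (hτanti (a + 1) x (by linarith) hx) hα
      exact div_le_div₀ (by linarith) (by linarith) (hD0 x) (hD2 x)
    set w := (|F (a + 1)| + 1) / δ with hw
    have w0 : 0 < w := by positivity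
    refine ⟨a + 1 + w, by linarith, ?_⟩
    have e : ∀ t, HasDerivAt (fun t => δ * t - F t) (δ - f t) t := fun t =>
      (((hasDerivAt_id t).const_mul δ).sub (hF t)).congr_deriv (by ring)
    have := anti_seg e (a := a + 1) (b := a + 1 + w) (fun t h1 _ => by linarith [fδ t h1])
      ⟨le_rfl, by linarith⟩ ⟨by linarith, le_rfl⟩ (by linarith)
    simp only at this
    have hδw : δ * w = |F (a + 1)| + 1 := by rw [hw]; field_simp
    have := neg_abs_le (F (a + 1))
    nlinarith
  obtain ⟨xs, hxs, Fxs⟩ := intermediate_value_Icc hab.le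
    (fun t _ => (hF t).continuousAt.continuousWithinAt) (show (0:ℝ) ∈ Icc (F a) (F b) from ⟨Fa.le, Fb.le⟩)
  have hax : a < xs := lt_of_le_of_ne hxs.1 (fun e => by rw [e] at Fa; linarith)
  have xs0 : 0 < xs := a0.trans hax
  have FmonoS : StrictMonoOn F (Ici xs) := Fmono.mono (fun t ht => hax.le.trans ht)
  refine ⟨F, G, xs, L * xs, (k + α) / D0, L, ⟨hF, hG, fC, gC, gL, ⟨_, FL⟩, F0, G0, Fodd, godd, xs0,
    mul_pos L0 xs0, div_pos (by linarith) hD0pos, L0, ?_, Fxs, FmonoS, ?_, Flin, ?_⟩⟩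
  · intro x h1 h2
    rcases le_total x a with h3 | h3
    · have := Fanti ⟨le_rfl, a0.le⟩ ⟨h1.le, h3⟩ h1
      rwa [F0] at this
    · have := Fmono h3 hax.le h2
      rwa [Fxs] at this
  · intro x hx
    rcases le_total x xs with h1 | h1
    · have := Flin x hx
      nlinarith
    · have := FmonoS.monotoneOn (mem_Ici.mpr le_rfl) h1 h1
      have := mul_pos L0 xs0
      linarith
  · intro x hx
    rw [hg, div_mul_eq_mul_div]
    have := mul_nonneg (show 0 ≤ k + α by linarith) hx
    exact div_le_div_of_nonneg_left this (hD0 x) (hD2 x)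

end
end Lie


/-- **Self-oscillation of the retarded harmonic oscillator.** For `α·τ₀ > μ` (beyond the Hopf
bifurcation), the Liénard system associated to the retarded harmonic oscillator has a
nonconstant periodic solution, and all nonconstant periodic solutions trace the same planar
orbit. -/
theorem retarded_oscillator_self_oscillation
    (μ k α τ₀ σ : ℝ) (hμ : 0 < μ) (hk : 0 < k) (hα : 0 < α) (hσ : 0 < σ)
    (hcrit : α * τ₀ > μ)
    (τ f g : ℝ → ℝ)
    (hτ : ∀ x, τ x = τ₀ * Real.exp (-x ^ 2 / (2 * σ ^ 2)))
    (hf : ∀ x, f x = (μ - α * τ x) / (1 + α * τ x ^ 2 / 2))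
    (hg : ∀ x, g x = (k + α) * x / (1 + α * τ x ^ 2 / 2)) :
    (∃ T > (0:ℝ), ∃ x : ℝ → ℝ, ContDiff ℝ 2 x ∧ ¬ (∃ c, ∀ t, x t = c) ∧
      (∀ t, x (t + T) = x t) ∧
      (∀ t, deriv (deriv x) t + f (x t) * deriv x t + g (x t) = 0)) ∧
    (∀ x₁ x₂ : ℝ → ℝ, ∀ T₁ T₂ : ℝ,
      ContDiff ℝ 2 x₁ → 0 < T₁ → (∀ t, x₁ (t + T₁) = x₁ t) → ¬ (∃ c, ∀ t, x₁ t = c) →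
      (∀ t, deriv (deriv x₁) t + f (x₁ t) * deriv x₁ t + g (x₁ t) = 0) →
      ContDiff ℝ 2 x₂ → 0 < T₂ → (∀ t, x₂ (t + T₂) = x₂ t) → ¬ (∃ c, ∀ t, x₂ t = c) →
      (∀ t, deriv (deriv x₂) t + f (x₂ t) * deriv x₂ t + g (x₂ t) = 0) →
      Set.range (fun t => (x₁ t, deriv x₁ t)) = Set.range (fun t => (x₂ t, deriv x₂ t))) := by
  obtain ⟨F, G, xs, m, c, L, h⟩ := Lie.inst hμ hk hα hσ hcrit hτ hf hg
  exact h.main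
end
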